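/- arXiv:1302.2745 — 2 statements merged into one kernel-verified Lean document; each statement's English description precedes it below -/
import Mathlib

section
/- Let G be a finitely presented group having a solvable subgroup of finite index and finite Prüfer rank, and let n = rk G/G' be the torsion-free rank of its abelianization; assume n ≥ 1. Then there exists a finitely generated subgroup K with G' ≤ K ≤ G such that the torsion-free rank of G/K equals n − 1. -/
/-- A group is finitely presented if it is the quotient of a finitely generated free group
by the normal closure of finitely many relators. -/
def FinitelyPresentedGroup (G : Type*) [Group G] : Prop :=
  ∃ (n : ℕ) (f : FreeGroup (Fin n) →* G) (S : Finset (FreeGroup (Fin n))),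
    Function.Surjective f ∧ f.ker = Subgroup.normalClosure (S : Set (FreeGroup (Fin n)))

/-- The torsion-free rank of the abelianization of `G`, i.e. `rk G/G'`. -/
noncomputable def rkAb (G : Type*) [Group G] : ℕ :=
  Module.finrank ℤ (Additive (Abelianization G))

/-- The torsion-free rank of the quotient `G ⧸ K` (for `K` a normal subgroup). -/
noncomputable def rkQuot {G : Type*} [Group G] (K : Subgroup G) (hK : K.Normal) : ℕ :=
  letI := hK
  rkAb (G ⧸ K)

/-- A group has finite Prüfer rank if there is an integer `r` such that every finitely
generated subgroup can be generated by at most `r` elements. -/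
def FinitePruferRank (G : Type*) [Group G] : Prop :=
  ∃ r : ℕ, ∀ H : Subgroup G, H.FG →
    ∃ S : Finset G, S.card ≤ r ∧ Subgroup.closure (S : Set G) = H

section
namespace PRK

/-- The `O[P]`-submodule generated by `Y`. -/
def orb {O G V : Type*} [CommRing O] [Group G] [AddCommGroup V] [Module O V]
    (ρ : Representation O G V) (P : Subgroup G) (Y : Submodule O V) : Submodule O V :=
  ⨆ h : P, Y.map (ρ (h : G))

/-- Every f.g. submodule is contained in a `G`-invariant submodule f.g. over `O[P]`. -/
def Good {O G V : Type*} [CommRing O] [Group G] [AddCommGroup V] [Module O V]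
    (ρ : Representation O G V) (P : Subgroup G) : Prop :=
  ∀ X : Submodule O V, X.FG → ∃ Y : Submodule O V, Y.FG ∧ X ≤ Y ∧
    ∀ g, (orb ρ P Y).map (ρ g) ≤ orb ρ P Y

section
variable {O G V : Type*} [CommRing O] [Group G] [AddCommGroup V] [Module O V]
    (ρ : Representation O G V) (P : Subgroup G)

lemma map_map' (g h : G) (Y : Submodule O V) : (Y.map (ρ h)).map (ρ g) = Y.map (ρ (g * h)) := by
  rw [map_mul]; exact (Submodule.map_comp _ _ _).symm

lemma map_le_orb {h : G} (hh : h ∈ P) (Y : Submodule O V) : Y.map (ρ h) ≤ orb ρ P Y :=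
  le_iSup (fun h : P => Y.map (ρ (h : G))) ⟨h, hh⟩

lemma le_orb (Y : Submodule O V) : Y ≤ orb ρ P Y := by
  have := map_le_orb ρ P P.one_mem Y
  rw [map_one] at this
  simpa [Module.End.one_eq_id] using this

lemma orb_inv {h : G} (hh : h ∈ P) (Y : Submodule O V) :
    (orb ρ P Y).map (ρ h) ≤ orb ρ P Y := by
  unfold orb
  rw [Submodule.map_iSup]
  refine iSup_le fun k => ?_
  rw [map_map']
  exact map_le_orb ρ P (P.mul_mem hh k.2) Y

lemma orb_le {Y Z : Submodule O V} (hYZ : Y ≤ Z) (hZ : ∀ h ∈ P, Z.map (ρ h) ≤ Z) :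
    orb ρ P Y ≤ Z :=
  iSup_le fun h => (Submodule.map_mono hYZ).trans (hZ h h.2)

lemma orb_mono {Y Z : Submodule O V} (hYZ : Y ≤ Z) : orb ρ P Y ≤ orb ρ P Z :=
  orb_le ρ P (hYZ.trans (le_orb ρ P Z)) fun _ hh => orb_inv ρ P hh Z

lemma map_orb_le [P.Normal] (g : G) (Y : Submodule O V) :
    (orb ρ P Y).map (ρ g) ≤ orb ρ P (Y.map (ρ g)) := by
  conv_lhs => unfold orb
  rw [Submodule.map_iSup]
  refine iSup_le fun k => ?_
  rw [map_map']
  have : g * (k : G) = (g * k * g⁻¹) * g := by group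
  rw [this, ← map_map']
  exact map_le_orb ρ P (Subgroup.Normal.conj_mem inferInstance _ k.2 g) _

lemma inv_of_gen (u : G) (hu : P ⊔ Subgroup.zpowers u = ⊤) (Z : Submodule O V)
    (hZ : ∀ h ∈ P, Z.map (ρ h) ≤ Z) (h1 : Z.map (ρ u) ≤ Z) (h2 : Z.map (ρ u⁻¹) ≤ Z) (g : G) :
    Z.map (ρ g) ≤ Z := by
  let S : Subgroup G :=
    { carrier := {g | Z.map (ρ g) ≤ Z ∧ Z.map (ρ g⁻¹) ≤ Z}
      one_mem' := by simp [Module.End.one_eq_id]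
      mul_mem' := by
        rintro a b ⟨ha, ha'⟩ ⟨hb, hb'⟩
        refine ⟨?_, ?_⟩
        · rw [← map_map']
          exact (Submodule.map_mono hb).trans ha
        · rw [mul_inv_rev, ← map_map']
          exact (Submodule.map_mono ha').trans hb'
      inv_mem' := by
        rintro a ⟨ha, ha'⟩
        exact ⟨ha', by simpa using ha⟩ }
  have : (⊤ : Subgroup G) ≤ S := by
    rw [← hu, sup_le_iff]
    refine ⟨fun h hh => ⟨hZ h hh, hZ _ (P.inv_mem hh)⟩, ?_⟩
    rw [Subgroup.zpowers_le]
    exact ⟨h1, h2⟩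
  exact (this (Subgroup.mem_top g)).1

lemma fg_lift {Y A B : Submodule O V} (hY : Y.FG) (h : Y ≤ A ⊔ B) :
    ∃ Z : Submodule O V, Z.FG ∧ Z ≤ B ∧ Y ≤ A ⊔ Z := by
  classical
  obtain ⟨s, rfl⟩ := hY
  have : ∀ x : V, ∃ b : V, x ∈ s → b ∈ B ∧ x - b ∈ A := by
    intro x
    by_cases hx : x ∈ s
    · obtain ⟨a, ha, b, hb, hab⟩ := Submodule.mem_sup.1 (h (Submodule.subset_span hx))
      exact ⟨b, fun _ => ⟨hb, by rw [← hab]; simpa using ha⟩⟩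
    · exact ⟨0, fun h => absurd h hx⟩
  choose f hf using this
  refine ⟨Submodule.span O (s.image f : Finset V), ⟨_, rfl⟩, ?_, ?_⟩
  · rw [Submodule.span_le]
    intro y hy
    simp only [Finset.coe_image, Set.mem_image] at hy
    obtain ⟨x, hx, rfl⟩ := hy
    exact (hf x hx).1
  · rw [Submodule.span_le]
    intro x hx
    have h1 : f x ∈ Submodule.span O ((s.image f : Finset V) : Set V) :=
      Submodule.subset_span (by simpa using ⟨x, hx, rfl⟩)
    exact Submodule.mem_sup.2 ⟨x - f x, (hf x hx).2, f x, h1, by abel⟩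

lemma fg_lift_map {V₂ : Type*} [AddCommGroup V₂] [Module O V₂] (q : V →ₗ[O] V₂)
    {Y : Submodule O V₂} (hY : Y.FG) {A : Submodule O V} (h : Y ≤ A.map q) :
    ∃ Z : Submodule O V, Z.FG ∧ Z ≤ A ∧ Z.map q = Y := by
  classical
  obtain ⟨s, rfl⟩ := hY
  have : ∀ x : V₂, ∃ b : V, x ∈ s → b ∈ A ∧ q b = x := by
    intro x
    by_cases hx : x ∈ s
    · obtain ⟨b, hb⟩ := h (Submodule.subset_span hx)
      exact ⟨b, fun _ => hb⟩
    · exact ⟨0, fun h => absurd h hx⟩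
  choose f hf using this
  refine ⟨Submodule.span O (s.image f : Finset V), ⟨_, rfl⟩, ?_, ?_⟩
  · rw [Submodule.span_le]
    intro y hy
    simp only [Finset.coe_image, Set.mem_image] at hy
    obtain ⟨x, hx, rfl⟩ := hy
    exact (hf x hx).1
  · rw [Submodule.map_span]
    congr 1
    ext y
    simp only [Finset.coe_image, Set.mem_image, Finset.mem_coe, exists_exists_and_eq_and]
    constructor
    · rintro ⟨x, hx, rfl⟩
      rwa [(hf x hx).2]
    · intro hy
      exact ⟨y, hy, (hf y hy).2⟩

lemma map_orb_equiv {V₂ : Type*} [AddCommGroup V₂] [Module O V₂] (ρ₂ : Representation O G V₂)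
    (q : V →ₗ[O] V₂) (hq : ∀ g v, q (ρ g v) = ρ₂ g (q v)) (Y : Submodule O V) :
    (orb ρ P Y).map q = orb ρ₂ P (Y.map q) := by
  unfold orb
  rw [Submodule.map_iSup]
  congr 1
  ext1 h
  rw [← Submodule.map_comp, ← Submodule.map_comp]
  congr 1
  ext v
  exact hq h v

theorem good_ext {V₁ V₂ : Type*} [AddCommGroup V₁] [Module O V₁] [AddCommGroup V₂] [Module O V₂]
    (ρ₁ : Representation O G V₁) (ρ₂ : Representation O G V₂)
    (i : V₁ →ₗ[O] V) (q : V →ₗ[O] V₂) (hi : ∀ g v, i (ρ₁ g v) = ρ g (i v))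
    (hq : ∀ g v, q (ρ g v) = ρ₂ g (q v)) (hqs : Function.Surjective q)
    (hiq : LinearMap.ker q = LinearMap.range i) [P.Normal]
    (u : G) (hu : P ⊔ Subgroup.zpowers u = ⊤) (h1 : Good ρ₁ P) (h2 : Good ρ₂ P) : Good ρ P := by
  intro X hX
  obtain ⟨Y₂, hY₂, hXY₂, hinv₂⟩ := h2 (X.map q) (hX.map q)
  obtain ⟨Y₀, hY₀, -, hY₀m⟩ := fg_lift_map q hY₂ (A := ⊤)
    (by rw [Submodule.map_top, LinearMap.range_eq_top.2 hqs]; exact le_top)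
  set Y₁ := Y₀ ⊔ X with hY₁
  have hY₁fg : Y₁.FG := hY₀.sup hX
  have hY₁m : Y₁.map q = Y₂ := by
    rw [hY₁, Submodule.map_sup, hY₀m]; exact sup_eq_left.2 hXY₂
  have key : ∀ g, Y₁.map (ρ g) ≤ orb ρ P Y₁ ⊔ LinearMap.range i := by
    intro g
    rw [← hiq, ← Submodule.comap_map_eq, map_orb_equiv ρ P ρ₂ q hq, hY₁m,
      ← Submodule.map_le_iff_le_comap]
    refine le_trans ?_ (hinv₂ g)
    rw [← hY₁m, ← map_orb_equiv ρ P ρ₂ q hq, ← Submodule.map_comp, ← Submodule.map_comp]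
    have : q ∘ₗ (ρ g) = (ρ₂ g) ∘ₗ q := by ext v; exact hq g v
    rw [this]
    exact Submodule.map_mono (le_orb ρ P Y₁)
  obtain ⟨Z, hZ, hZi, hYZ⟩ := fg_lift (hY₁fg.map (ρ u)) (key u)
  obtain ⟨Z', hZ', hZi', hYZ'⟩ := fg_lift (hY₁fg.map (ρ u⁻¹)) (key u⁻¹)
  obtain ⟨W, hW, -, hWm⟩ := fg_lift_map i (hZ.sup hZ') (A := ⊤)
    (by rw [Submodule.map_top]; exact sup_le hZi hZi')
  obtain ⟨W₁, hW₁, hWW₁, hinv₁⟩ := h1 W hW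
  have hWi : ∀ g, (orb ρ P (W₁.map i)).map (ρ g) ≤ orb ρ P (W₁.map i) := by
    intro g
    have hi' : ∀ g v, i (ρ₁ g v) = ρ g (i v) := hi
    rw [← map_orb_equiv ρ₁ P ρ i hi, ← Submodule.map_comp]
    have : (ρ g) ∘ₗ i = i ∘ₗ (ρ₁ g) := by ext v; exact (hi g v).symm
    rw [this, Submodule.map_comp]
    exact Submodule.map_mono (hinv₁ g)
  have hZW : Z ⊔ Z' ≤ W₁.map i := by rw [← hWm]; exact Submodule.map_mono hWW₁
  refine ⟨Y₁ ⊔ W₁.map i, hY₁fg.sup (hW₁.map i), le_sup_of_le_left le_sup_right, ?_⟩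
  have main : ∀ g Z, Z ≤ W₁.map i → Y₁.map (ρ g) ≤ orb ρ P Y₁ ⊔ Z →
      (orb ρ P (Y₁ ⊔ W₁.map i)).map (ρ g) ≤ orb ρ P (Y₁ ⊔ W₁.map i) := by
    intro g Z hZ hg
    refine (map_orb_le ρ P g _).trans (orb_le ρ P ?_ fun h hh => orb_inv ρ P hh _)
    rw [Submodule.map_sup, sup_le_iff]
    constructor
    · refine hg.trans (sup_le (orb_mono ρ P le_sup_left) ?_)
      exact hZ.trans (le_sup_right.trans (le_orb ρ P _))
    · refine (Submodule.map_mono (le_orb ρ P _)).trans ((hWi g).trans (orb_mono ρ P le_sup_right))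
  exact inv_of_gen ρ P u hu _ (fun h hh => orb_inv ρ P hh _)
    (main u Z (le_sup_left.trans hZW) hYZ) (main u⁻¹ Z' (le_sup_right.trans hZW) hYZ')
end
end PRK
end

section
namespace PRK

section bdd
variable {p : ℕ} [Fact p.Prime]

lemma mem_range_iff (x : ℚ_[p]) : x ∈ Set.range (algebraMap ℤ_[p] ℚ_[p]) ↔ ‖x‖ ≤ 1 := by
  constructor
  · rintro ⟨y, rfl⟩
    exact y.2
  · intro h
    exact ⟨⟨x, h⟩, rfl⟩

theorem bdd_of_no_line {V : Type*} [AddCommGroup V] [Module ℚ_[p] V] [Module ℤ_[p] V]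
    [IsScalarTower ℤ_[p] ℚ_[p] V] {d : ℕ} (b : Module.Basis (Fin d) ℚ_[p] V)
    (M : Submodule ℤ_[p] V) (hM : Submodule.span ℤ_[p] (Set.range b) ≤ M)
    (hline : ∀ x : V, (∀ c : ℚ_[p], c • x ∈ M) → x = 0) :
    ∃ c : ℤ_[p], c ≠ 0 ∧ ∀ x ∈ M, c • x ∈ Submodule.span ℤ_[p] (Set.range b) := by
  have hp : p.Prime := Fact.out
  have hp0 : (p : ℚ_[p]) ≠ 0 := by exact_mod_cast hp.ne_zero
  have hsm : ∀ (c : ℤ_[p]) (x : V), c • x = (c : ℚ_[p]) • x := fun c x =>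
    (algebraMap_smul ℚ_[p] c x).symm
  have hmem : ∀ x : V, x ∈ Submodule.span ℤ_[p] (Set.range b) ↔ ‖b.equivFun x‖ ≤ 1 := by
    intro x
    rw [b.mem_span_iff_repr_mem ℤ_[p], pi_norm_le_iff_of_nonneg zero_le_one]
    simp_rw [mem_range_iff]
    rfl
  by_contra hcon
  push Not at hcon
  let M' : AddSubgroup (Fin d → ℚ_[p]) :=
    M.toAddSubgroup.comap (b.equivFun.symm : (Fin d → ℚ_[p]) →ₗ[ℚ_[p]] V).toAddMonoidHom
  have hM'mem : ∀ y, y ∈ M' ↔ b.equivFun.symm y ∈ M := fun y => Iff.rfl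
  have hball : Metric.closedBall (0 : Fin d → ℚ_[p]) 1 ⊆ M' := by
    intro y hy
    rw [SetLike.mem_coe, hM'mem]
    apply hM
    rw [hmem, LinearEquiv.apply_symm_apply]
    exact mem_closedBall_zero_iff.1 hy
  have hopen : IsOpen (M' : Set (Fin d → ℚ_[p])) :=
    AddSubgroup.isOpen_of_mem_nhds (g := 0) M'
      (Filter.mem_of_superset (Metric.closedBall_mem_nhds _ one_pos) hball)
  have hclosed : IsClosed (M' : Set (Fin d → ℚ_[p])) := AddSubgroup.isClosed_of_isOpen M' hopen
  let D : ℕ → Set (Fin d → ℚ_[p]) := fun k =>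
    Metric.sphere 0 1 ∩ {y | ((p : ℚ_[p]) ^ k)⁻¹ • y ∈ M'}
  have hDcl : ∀ k, IsClosed (D k) := fun k =>
    Metric.isClosed_sphere.inter (hclosed.preimage (continuous_const_smul _))
  have hDanti : ∀ k, D (k + 1) ⊆ D k := by
    rintro k y ⟨hy1, hy2⟩
    refine ⟨hy1, ?_⟩
    simp only [Set.mem_ofPred_eq, hM'mem] at hy2 ⊢
    have := M.smul_mem (p : ℤ_[p]) hy2
    rw [hsm, map_smul, smul_smul] at this
    rw [map_smul]
    convert this using 2
    push_cast
    rw [pow_succ]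
    field_simp
  have hDne : ∀ k, (D k).Nonempty := by
    intro k
    obtain ⟨x, hxM, hx⟩ := hcon ((p : ℤ_[p]) ^ k) (pow_ne_zero _ (by exact_mod_cast hp.ne_zero))
    rw [hmem, hsm, map_smul, norm_smul] at hx
    push Not at hx
    set y := b.equivFun x with hy
    have hyne : y ≠ 0 := by
      intro h
      rw [h] at hx
      simp at hx
      linarith
    have : Nonempty (Fin d) := by
      by_contra hne
      rw [not_nonempty_iff] at hne
      exact hyne (Subsingleton.elim _ _)
    obtain ⟨i, hi⟩ : ∃ i, ‖y i‖ = ‖y‖ := by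
      obtain ⟨i, -, hi⟩ := Finset.exists_max_image Finset.univ (fun i => ‖y i‖)
        Finset.univ_nonempty
      refine ⟨i, le_antisymm (norm_le_pi_norm y i) ?_⟩
      rw [pi_norm_le_iff_of_nonneg (norm_nonneg _)]
      exact fun j => hi j (Finset.mem_univ _)
    have hyi : y i ≠ 0 := by
      rw [← norm_ne_zero_iff, hi, norm_ne_zero_iff]
      exact hyne
    obtain ⟨j, hj⟩ := Padic.padicNormE.image hyi
    have hyn : ‖y‖ = (p : ℝ) ^ (-j) := by
      rw [← hi, hj]; push_cast; rfl
    have hp1 : (1 : ℝ) < p := by exact_mod_cast hp.one_lt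
    have hkj : (k : ℤ) ≤ -j := by
      have h1 : ‖((p : ℤ_[p]) ^ k : ℤ_[p])‖ = (p : ℝ) ^ (-(k : ℤ)) := by simp
      have h2 : ‖(((p : ℤ_[p]) ^ k : ℤ_[p]) : ℚ_[p])‖ = (p : ℝ) ^ (-(k : ℤ)) := by
        rw [← h1]; rfl
      rw [h2, hyn, ← zpow_add₀ (by positivity)] at hx
      by_contra hlt
      push Not at hlt
      have : (p : ℝ) ^ (-(k : ℤ) + -j) ≤ 1 := zpow_le_one_of_nonpos₀ hp1.le (by omega)
      linarith
    obtain ⟨l, hl⟩ := Int.eq_ofNat_of_zero_le (sub_nonneg.2 hkj)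
    have hj' : j = -(k + l : ℤ) := by omega
    refine ⟨((p : ℚ_[p]) ^ (k + l)) • y, ?_, ?_⟩
    · rw [mem_sphere_zero_iff_norm, norm_smul, norm_pow, Padic.norm_p, hyn, hj']
      rw [neg_neg, inv_pow, ← zpow_natCast]
      push_cast
      exact inv_mul_cancel₀ (by positivity)
    · simp only [Set.mem_ofPred_eq, hM'mem]
      have := M.smul_mem ((p : ℤ_[p]) ^ l) hxM
      rw [hsm] at this
      rw [smul_smul, map_smul, hy, LinearEquiv.symm_apply_apply]
      convert this using 2
      push_cast
      rw [pow_add]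
      field_simp
  obtain ⟨y, hy⟩ := IsCompact.nonempty_iInter_of_sequence_nonempty_isCompact_isClosed D hDanti hDne
    ((isCompact_sphere _ _).of_isClosed_subset (hDcl 0) Set.inter_subset_left) hDcl
  rw [Set.mem_iInter] at hy
  have hy1 : ‖y‖ = 1 := by simpa using (hy 0).1
  have := hline (b.equivFun.symm y) ?_
  · rw [LinearEquiv.map_eq_zero_iff] at this
    simp [this] at hy1
  · intro c
    obtain ⟨k, hk⟩ : ∃ k : ℕ, ‖(p : ℚ_[p]) ^ k * c‖ ≤ 1 := by
      have hp1 : ‖(p : ℚ_[p])‖ < 1 := Padic.norm_p_lt_one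
      have := (tendsto_pow_atTop_nhds_zero_of_lt_one (norm_nonneg _) hp1).mul_const ‖c‖
      rw [zero_mul] at this
      obtain ⟨k, hk⟩ := (this.eventually (ge_mem_nhds one_pos)).exists
      exact ⟨k, by rw [norm_mul, norm_pow]; exact hk⟩
    have h2 := (hy k).2
    simp only [Set.mem_ofPred_eq, hM'mem] at h2
    have := M.smul_mem (⟨_, hk⟩ : ℤ_[p]) h2
    erw [hsm] at this
    rw [map_smul, smul_smul] at this
    convert this using 2
    field_simp
end bdd
end PRK
end

section
universe u
namespace PRK

section padic
variable {p : ℕ} [Fact p.Prime] {G : Type*} [Group G]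
    {V : Type*} [AddCommGroup V] [Module ℚ_[p] V] [Module ℤ_[p] V]
    [IsScalarTower ℤ_[p] ℚ_[p] V]

/-- Restriction of scalars of a representation from `ℚ_p` to `ℤ_p`. -/
noncomputable def resO (ρ : Representation ℚ_[p] G V) : Representation ℤ_[p] G V where
  toFun g := (ρ g).restrictScalars ℤ_[p]
  map_one' := by rw [map_one]; rfl
  map_mul' a b := by rw [map_mul]; rfl

lemma resO_apply (ρ : Representation ℚ_[p] G V) (g : G) (v : V) : resO ρ g v = ρ g v := rfl

lemma absorb {d : ℕ} (b : Module.Basis (Fin d) ℚ_[p] V) {X : Submodule ℤ_[p] V} (hX : X.FG) :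
    ∃ c : ℤ_[p], c ≠ 0 ∧ ∀ x ∈ X, c • x ∈ Submodule.span ℤ_[p] (Set.range b) := by
  classical
  obtain ⟨s, rfl⟩ := hX
  have : ∀ x : V, ∃ c : ℤ_[p], c ≠ 0 ∧ c • x ∈ Submodule.span ℤ_[p] (Set.range b) := by
    intro x
    obtain ⟨c, hc⟩ := IsLocalization.exist_integer_multiples_of_finite
      (nonZeroDivisors ℤ_[p]) (fun i => b.repr x i)
    refine ⟨c, nonZeroDivisors.coe_ne_zero c, ?_⟩
    rw [b.mem_span_iff_repr_mem ℤ_[p]]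
    intro i
    obtain ⟨y, hy⟩ := hc i
    refine ⟨y, ?_⟩
    rw [hy, ← algebraMap_smul ℚ_[p] (c : ℤ_[p]) x, map_smul, Finsupp.smul_apply]
    exact (algebraMap_smul ℚ_[p] (c : ℤ_[p]) _).symm
  choose f hf0 hf using this
  refine ⟨∏ x ∈ s, f x, Finset.prod_ne_zero_iff.2 fun x _ => hf0 x, fun x hx => ?_⟩
  have : Submodule.span ℤ_[p] (s : Set V) ≤
      (Submodule.span ℤ_[p] (Set.range b)).comap (LinearMap.lsmul ℤ_[p] V (∏ x ∈ s, f x)) := by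
    rw [Submodule.span_le]
    intro y hy
    simp only [Submodule.comap_coe, Set.mem_preimage, LinearMap.lsmul_apply, SetLike.mem_coe]
    rw [← Finset.prod_erase_mul s f hy, mul_smul]
    exact Submodule.smul_mem _ _ (hf y)
  exact this hx

lemma smul_inj' {c : ℤ_[p]} (hc : c ≠ 0) : Function.Injective (LinearMap.lsmul ℤ_[p] V c) := by
  intro x y h
  simp only [LinearMap.lsmul_apply] at h
  rw [← algebraMap_smul ℚ_[p] c x, ← algebraMap_smul ℚ_[p] c y] at h
  refine smul_right_injective V ?_ h
  intro h0
  exact hc (Subtype.ext h0)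

theorem bdd_good {d : ℕ} (b : Module.Basis (Fin d) ℚ_[p] V) (ρ : Representation ℚ_[p] G V)
    (P : Subgroup G) {c : ℤ_[p]} (hc : c ≠ 0)
    (h : ∀ g : G, ∀ x ∈ Submodule.span ℤ_[p] (Set.range b),
      c • ρ g x ∈ Submodule.span ℤ_[p] (Set.range b)) : Good (resO ρ) P := by
  intro X hX
  obtain ⟨a, ha, haX⟩ := absorb b hX
  set X₀ := Submodule.span ℤ_[p] (Set.range b) with hX₀
  refine ⟨orb (resO ρ) ⊤ X, ?_, le_orb _ _ _, fun g => ?_⟩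
  · have hle : (orb (resO ρ) ⊤ X).map (LinearMap.lsmul ℤ_[p] V (c * a)) ≤ X₀ := by
      rw [Submodule.map_le_iff_le_comap]
      refine iSup_le fun k => ?_
      rintro _ ⟨x, hx, rfl⟩
      simp only [Submodule.mem_comap, LinearMap.lsmul_apply]
      have := h k _ (haX x hx)
      rw [mul_smul, ← map_smul]
      exact this
    have hfgX : X₀.FG := Submodule.fg_span (Set.finite_range b)
    have : IsNoetherian ℤ_[p] X₀ := isNoetherian_of_fg_of_noetherian _ hfgX
    have := isNoetherian_submodule.1 this _ hle
    exact Submodule.fg_of_fg_map_injective _ (smul_inj' (mul_ne_zero hc ha)) this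
  · have he : orb (resO ρ) P (orb (resO ρ) ⊤ X) = orb (resO ρ) ⊤ X :=
      le_antisymm (orb_le _ _ le_rfl fun h _ => orb_inv _ _ (Subgroup.mem_top h) _) (le_orb _ _ _)
    rw [he]
    exact orb_inv _ _ (Subgroup.mem_top g) _

theorem irr_case {d : ℕ} (b : Module.Basis (Fin d) ℚ_[p] V) (ρ : Representation ℚ_[p] G V)
    (hirr : ∀ W : Submodule ℚ_[p] V, (∀ g, W ≤ W.comap (ρ g)) → W = ⊥ ∨ W = ⊤)
    (P : Subgroup G) [P.Normal] : Good (resO ρ) P ∨ ∃ c : ℤ_[p], c ≠ 0 ∧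
      ∀ g ∈ P, ∀ x ∈ Submodule.span ℤ_[p] (Set.range b),
      c • ρ g x ∈ Submodule.span ℤ_[p] (Set.range b) := by
  set X₀ := Submodule.span ℤ_[p] (Set.range b) with hX₀
  have hfgX : X₀.FG := Submodule.fg_span (Set.finite_range b)
  set M := orb (resO ρ) P X₀ with hM
  let W : Submodule ℚ_[p] V :=
    { carrier := {x | ∀ c : ℚ_[p], c • x ∈ M}
      zero_mem' := by intro c; rw [smul_zero]; exact M.zero_mem
      add_mem' := by intro x y hx hy c; rw [smul_add]; exact M.add_mem (hx c) (hy c)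
      smul_mem' := by intro a x hx c; rw [smul_smul]; exact hx _ }
  have hWmem : ∀ x, x ∈ W ↔ ∀ c : ℚ_[p], c • x ∈ M := fun x => Iff.rfl
  have hWinv : ∀ g, W ≤ W.comap (ρ g) := by
    intro g x hx
    rw [Submodule.mem_comap, hWmem]
    intro c
    obtain ⟨a, ha, haX⟩ := absorb b (hfgX.map (resO ρ g))
    have ha' : (a : ℚ_[p]) ≠ 0 := fun h0 => ha (Subtype.ext h0)
    have h1 : ∀ y ∈ M, a • ρ g y ∈ M := by
      intro y hy
      have h2 : resO ρ g y ∈ orb (resO ρ) P (X₀.map (resO ρ g)) :=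
        map_orb_le (resO ρ) P g X₀ (Submodule.mem_map_of_mem hy)
      have h3 : orb (resO ρ) P (X₀.map (resO ρ g)) ≤ M.comap (LinearMap.lsmul ℤ_[p] V a) := by
        refine orb_le _ _ ?_ ?_
        · intro z hz
          exact le_orb (resO ρ) P X₀ (haX z hz)
        · intro h hh
          rintro _ ⟨z, hz, rfl⟩
          simp only [Submodule.mem_comap, LinearMap.lsmul_apply, SetLike.mem_coe] at hz ⊢
          rw [← map_smul]
          exact orb_inv (resO ρ) P hh X₀ (Submodule.mem_map_of_mem hz)
      exact h3 h2
    have h4 := h1 _ (hx ((a : ℚ_[p])⁻¹ * c))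
    rw [← algebraMap_smul ℚ_[p] a, map_smul, smul_smul] at h4
    convert h4 using 2
    exact (mul_inv_cancel_left₀ ha' c).symm
  rcases hirr W hWinv with hW | hW
  · right
    obtain ⟨c, hc, hcM⟩ := bdd_of_no_line b M (le_orb _ _ _) (by
      intro x hx
      have : x ∈ W := hx
      rw [hW] at this
      simpa using this)
    exact ⟨c, hc, fun g hg x hx => hcM _
      (map_le_orb (resO ρ) P hg X₀ (Submodule.mem_map_of_mem hx))⟩
  · left
    intro X hX
    have htop : orb (resO ρ) P (X ⊔ X₀) = ⊤ := by
      rw [eq_top_iff]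
      intro x _
      have : x ∈ W := by rw [hW]; trivial
      have := this 1
      rw [one_smul] at this
      exact orb_mono _ _ le_sup_right this
    exact ⟨X ⊔ X₀, hX.sup hfgX, le_sup_left, fun g => by rw [htop]; exact le_top⟩

theorem bdd_two {d : ℕ} (b : Module.Basis (Fin d) ℚ_[p] V) (ρ : Representation ℚ_[p] G V)
    (P Q : Subgroup G) [P.Normal] (hPQ : (P ⊔ Q).FiniteIndex)
    (hP : ∃ c : ℤ_[p], c ≠ 0 ∧ ∀ g ∈ P, ∀ x ∈ Submodule.span ℤ_[p] (Set.range b),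
      c • ρ g x ∈ Submodule.span ℤ_[p] (Set.range b))
    (hQ : ∃ c : ℤ_[p], c ≠ 0 ∧ ∀ g ∈ Q, ∀ x ∈ Submodule.span ℤ_[p] (Set.range b),
      c • ρ g x ∈ Submodule.span ℤ_[p] (Set.range b)) :
    ∃ c : ℤ_[p], c ≠ 0 ∧ ∀ g : G, ∀ x ∈ Submodule.span ℤ_[p] (Set.range b),
      c • ρ g x ∈ Submodule.span ℤ_[p] (Set.range b) := by
  classical
  set X₀ := Submodule.span ℤ_[p] (Set.range b) with hX₀
  have hfgX : X₀.FG := Submodule.fg_span (Set.finite_range b)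
  obtain ⟨c₁, hc₁, h₁⟩ := hP
  obtain ⟨c₂, hc₂, h₂⟩ := hQ
  have hmul : ∀ (a a' : ℤ_[p]) (g g' : G), (∀ x ∈ X₀, a • ρ g x ∈ X₀) →
      (∀ x ∈ X₀, a' • ρ g' x ∈ X₀) → ∀ x ∈ X₀, (a * a') • ρ (g * g') x ∈ X₀ := by
    intro a a' g g' h h' x hx
    have := h _ (h' x hx)
    have e : (a * a') • ρ (g * g') x = a • ρ g (a' • ρ g' x) := by
      rw [mul_smul, map_mul, ← resO_apply ρ g (a' • _), map_smul]
      rfl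
    rw [e]; exact this
  have hfin : Finite (G ⧸ (P ⊔ Q)) := Subgroup.finite_quotient_of_finiteIndex
  have := Fintype.ofFinite (G ⧸ (P ⊔ Q))
  have h3 : ∀ t : G ⧸ (P ⊔ Q), ∃ c : ℤ_[p], c ≠ 0 ∧ ∀ x ∈ X₀, c • ρ t.out x ∈ X₀ := by
    intro t
    obtain ⟨c, hc, h⟩ := absorb b (hfgX.map (resO ρ t.out))
    exact ⟨c, hc, fun x hx => h _ (Submodule.mem_map_of_mem hx)⟩
  choose f hf0 hf using h3
  refine ⟨(∏ t, f t) * (c₁ * c₂), mul_ne_zero (Finset.prod_ne_zero_iff.2 fun x _ => hf0 x)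
    (mul_ne_zero hc₁ hc₂), fun g => ?_⟩
  set t : G ⧸ (P ⊔ Q) := (g : G ⧸ (P ⊔ Q)) with ht
  have h4 : t.out⁻¹ * g ∈ P ⊔ Q := by
    rw [← QuotientGroup.eq, ← ht]
    exact Quotient.out_eq t
  obtain ⟨x, hx, y, hy, hxy⟩ := Subgroup.mem_sup_of_normal_left.1 h4
  have e : g = t.out * (x * y) := by rw [hxy]; group
  rw [e]
  refine hmul _ _ _ _ ?_ (hmul _ _ _ _ (h₁ x hx) (h₂ y hy))
  intro z hz
  rw [← Finset.prod_erase_mul Finset.univ f (Finset.mem_univ t), mul_smul]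
  exact X₀.smul_mem _ (hf t z hz)

end padic

theorem padic_main {p : ℕ} [Fact p.Prime] {G : Type*} [Group G] (P : ℕ → Subgroup G)
    (hPn : ∀ k, (P k).Normal) (hPf : ∀ i j, i ≠ j → (P i ⊔ P j).FiniteIndex)
    (hPu : ∀ k, ∃ u, P k ⊔ Subgroup.zpowers u = ⊤) (n : ℕ) :
    ∀ (V : Type u) [AddCommGroup V] [Module ℚ_[p] V] [Module ℤ_[p] V]
    [IsScalarTower ℤ_[p] ℚ_[p] V] [FiniteDimensional ℚ_[p] V] (ρ : Representation ℚ_[p] G V),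
    Module.finrank ℚ_[p] V = n → {k | ¬ Good (resO ρ) (P k)}.Finite := by
  induction n using Nat.strong_induction_on with
  | _ n ih =>
  intro V _ _ _ _ _ ρ hn
  by_cases hirr : ∀ W : Submodule ℚ_[p] V, (∀ g, W ≤ W.comap (ρ g)) → W = ⊥ ∨ W = ⊤
  · refine Set.Subsingleton.finite ?_
    intro i hi j hj
    by_contra hij
    let b := Module.finBasis ℚ_[p] V
    have := hPn i
    have := hPn j
    have h1 := (irr_case b ρ hirr (P i)).resolve_left hi
    have h2 := (irr_case b ρ hirr (P j)).resolve_left hj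
    obtain ⟨c, hc, h⟩ := bdd_two b ρ (P i) (P j) (hPf i j hij) h1 h2
    exact hi (bdd_good b ρ (P i) hc h)
  · push Not at hirr
    obtain ⟨W, hW, hbot, htop⟩ := hirr
    have hlt : Module.finrank ℚ_[p] W < n := by
      rw [← hn]; exact Submodule.finrank_lt htop
    have hlt2 : Module.finrank ℚ_[p] (V ⧸ W) < n := by
      have := Submodule.finrank_quotient_add_finrank W
      have : 0 < Module.finrank ℚ_[p] W := by
        rw [Module.finrank_pos_iff]
        exact Submodule.nontrivial_iff_ne_bot.2 hbot
      omega
    have h1 := ih _ hlt W (ρ.subrepresentation W hW) rfl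
    have h2 := ih _ hlt2 (V ⧸ W) (ρ.quotient W hW) rfl
    refine (h1.union h2).subset ?_
    intro k hk
    by_contra hcon
    simp only [Set.mem_union, Set.mem_ofPred_eq, not_or, not_not] at hcon
    obtain ⟨u, hu⟩ := hPu k
    have := hPn k
    refine hk (good_ext (resO ρ) (P k) _ _ (W.subtype.restrictScalars ℤ_[p])
      (W.mkQ.restrictScalars ℤ_[p]) ?_ ?_ ?_ ?_ u hu hcon.1 hcon.2)
    · intro g v; rfl
    · intro g v; rfl
    · exact W.mkQ_surjective
    · ext x
      simp
end PRK
end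

section
universe u
namespace PRK

/-- Prüfer rank at most `r` for abelian groups. -/
def PR (r : ℕ) (A : Type*) [AddCommGroup A] : Prop :=
  ∀ X : Submodule ℤ A, X.FG → ∃ s : Finset A, s.card ≤ r ∧ Submodule.span ℤ (s : Set A) = X

lemma PR.quot {r : ℕ} {A : Type*} [AddCommGroup A] (h : PR r A) {C : Type*} [AddCommGroup C]
    (q : A →ₗ[ℤ] C) (hq : Function.Surjective q) : PR r C := by
  classical
  intro X hX
  obtain ⟨Z, hZ, -, rfl⟩ := fg_lift_map q hX (A := ⊤)
    (by rw [Submodule.map_top, LinearMap.range_eq_top.2 hq]; exact le_top)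
  obtain ⟨s, hs, rfl⟩ := h Z hZ
  exact ⟨s.image q, Finset.card_image_le.trans hs, by rw [Submodule.map_span]; simp⟩

lemma PR.sub {r : ℕ} {A : Type*} [AddCommGroup A] (h : PR r A) {C : Type*} [AddCommGroup C]
    (i : C →ₗ[ℤ] A) (hi : Function.Injective i) : PR r C := by
  classical
  intro X hX
  obtain ⟨s, hs, hsX⟩ := h (X.map i) (hX.map i)
  refine ⟨s.preimage i hi.injOn, ?_, ?_⟩
  · rw [← Finset.card_image_of_injective _ hi]
    exact (Finset.card_le_card (by
      intro y hy
      obtain ⟨x, hx, rfl⟩ := Finset.mem_image.1 hy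
      exact Finset.mem_preimage.1 hx)).trans hs
  · apply Submodule.map_injective_of_injective hi
    rw [Submodule.map_span, ← hsX]
    congr 1
    rw [Finset.coe_preimage]
    apply Set.image_preimage_eq_of_subset
    intro x hx
    have : x ∈ X.map i := by rw [← hsX]; exact Submodule.subset_span hx
    obtain ⟨y, -, rfl⟩ := this
    exact ⟨y, rfl⟩

lemma PR.finite {r : ℕ} {A : Type*} [AddCommGroup A] (h : PR r A) {n : ℕ} (hn : n ≠ 0)
    (hA : ∀ x : A, n • x = 0) : Finite A := by
  classical
  by_contra hinf
  rw [not_finite_iff_infinite] at hinf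
  have : NeZero n := ⟨hn⟩
  obtain ⟨t, ht⟩ := Infinite.exists_subset_card_eq A (n ^ r + 1)
  obtain ⟨s, hs, hst⟩ := h (Submodule.span ℤ (t : Set A)) ⟨t, rfl⟩
  let Φ : (s → ZMod n) → A := fun f => ∑ x, (f x).val • (x : A)
  have hsub : t ⊆ Finset.univ.image Φ := by
    intro y hy
    have hy' : y ∈ Submodule.span ℤ (s : Set A) := by rw [hst]; exact Submodule.subset_span hy
    rw [Submodule.mem_span_finset] at hy'
    obtain ⟨f, -, hf⟩ := hy'
    rw [Finset.mem_image]
    refine ⟨fun x => (f x : ZMod n), Finset.mem_univ _, ?_⟩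
    rw [← hf, ← Finset.sum_coe_sort s]
    refine Finset.sum_congr rfl fun x _ => ?_
    rw [← natCast_zsmul, ZMod.val_intCast, Int.emod_def, sub_smul, mul_comm, mul_smul,
      natCast_zsmul, hA, smul_zero, sub_zero]
  have := Finset.card_le_card hsub
  have h2 := (this.trans Finset.card_image_le)
  rw [ht, Finset.card_univ, Fintype.card_fun, ZMod.card, Fintype.card_coe] at h2
  have := Nat.pow_le_pow_right (Nat.pos_of_ne_zero hn) hs
  omega

lemma PR.fin_index {r : ℕ} {A : Type*} [AddCommGroup A] (h : PR r A) {n : ℕ} (hn : n ≠ 0)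
    (B₀ B₁ : Submodule ℤ A) (hB : ∀ x ∈ B₁, n • x ∈ B₀) :
    ∃ F : Submodule ℤ A, F.FG ∧ F ≤ B₁ ∧ B₁ ≤ B₀ ⊔ F := by
  have h1 : PR r (B₁.map B₀.mkQ) :=
    (h.quot B₀.mkQ B₀.mkQ_surjective).sub (B₁.map B₀.mkQ).subtype Subtype.val_injective
  have : Finite (B₁.map B₀.mkQ) := by
    refine h1.finite hn ?_
    rintro ⟨y, hy⟩
    obtain ⟨x, hx, hxy⟩ := hy
    apply Subtype.ext
    have : n • y = 0 := by
      rw [← hxy, ← map_nsmul, Submodule.mkQ_apply, Submodule.Quotient.mk_eq_zero]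
      exact hB x hx
    exact this
  have hfg : (B₁.map B₀.mkQ).FG := by
    rw [← Submodule.span_eq (B₁.map B₀.mkQ)]
    exact Submodule.fg_span (Set.toFinite _)
  obtain ⟨F, hF, hFB, hFm⟩ := fg_lift_map B₀.mkQ hfg le_rfl
  refine ⟨F, hF, hFB, ?_⟩
  intro x hx
  have : B₀.mkQ x ∈ F.map B₀.mkQ := by rw [hFm]; exact Submodule.mem_map_of_mem hx
  rw [← Submodule.mem_comap, Submodule.comap_map_mkQ] at this
  exact this

lemma orb_top_smul {G A : Type*} [Group G] [AddCommGroup A] (ρ : Representation ℤ G A)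
    (X B : Submodule ℤ A) (n : ℕ) (h : ∀ g, ∀ x ∈ X, n • ρ g x ∈ B) :
    ∀ x ∈ orb ρ ⊤ X, n • x ∈ B := by
  have : orb ρ ⊤ X ≤ B.comap (LinearMap.lsmul ℤ A (n : ℤ)) := by
    refine iSup_le fun g => ?_
    rintro _ ⟨x, hx, rfl⟩
    have := h g x hx
    simpa using this
  intro x hx
  have := this hx
  simpa using this

lemma exists_smul {A : Type*} [AddCommGroup A] (B X : Submodule ℤ A) (hX : X.FG)
    (h : ∀ x ∈ X, ∃ n : ℕ, n ≠ 0 ∧ n • x ∈ B) : ∃ n : ℕ, n ≠ 0 ∧ ∀ x ∈ X, n • x ∈ B := by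
  classical
  obtain ⟨s, rfl⟩ := hX
  have : ∀ x : A, ∃ c : ℕ, c ≠ 0 ∧ (x ∈ s → c • x ∈ B) := by
    intro x
    by_cases hx : x ∈ s
    · obtain ⟨n, hn, h⟩ := h x (Submodule.subset_span hx)
      exact ⟨n, hn, fun _ => h⟩
    · exact ⟨1, one_ne_zero, fun h => absurd h hx⟩
  choose f hf0 hf using this
  refine ⟨∏ x ∈ s, f x, Finset.prod_ne_zero_iff.2 fun x _ => hf0 x, fun x hx => ?_⟩
  have : Submodule.span ℤ (s : Set A) ≤
      B.comap (LinearMap.lsmul ℤ A ((∏ x ∈ s, f x : ℕ) : ℤ)) := by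
    rw [Submodule.span_le]
    intro y hy
    simp only [Submodule.comap_coe, Set.mem_preimage, LinearMap.lsmul_apply, SetLike.mem_coe]
    rw [← Finset.prod_erase_mul s f hy, natCast_zsmul, mul_smul]
    exact nsmul_mem (hf y hy) _
  have := this hx
  simpa only [Submodule.mem_comap, LinearMap.lsmul_apply, natCast_zsmul] using this

/-- From a uniform exponent to `Good`. -/
theorem good_of_exp {G A : Type*} [Group G] [AddCommGroup A] (ρ : Representation ℤ G A)
    {r : ℕ} (hr : PR r A) (P : Subgroup G) (E : Submodule ℤ A) (hE : E.FG)
    (htor : ∀ a : A, ∃ n : ℕ, n ≠ 0 ∧ n • a ∈ E) {n : ℕ} (hn : n ≠ 0)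
    (h : ∀ g, ∀ x ∈ E, n • ρ g x ∈ orb ρ P E) : Good ρ P := by
  intro X hX
  obtain ⟨c, hc, hcX⟩ := exists_smul E X hX fun x _ => htor x
  obtain ⟨F, hF, hFle, hleF⟩ := hr.fin_index (mul_ne_zero hn hc) (orb ρ P E) (orb ρ ⊤ (E ⊔ X)) (by
    apply orb_top_smul
    intro g x hx
    obtain ⟨y, hy, z, hz, rfl⟩ := Submodule.mem_sup.1 hx
    have : (n * c) • ρ g (y + z) = n • ρ g (c • y + c • z) := by
      rw [mul_smul, ← smul_add, map_nsmul]
    rw [this]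
    exact h g _ (E.add_mem (nsmul_mem hy _) (hcX z hz)))
  have hY : orb ρ P (E ⊔ X ⊔ F) = orb ρ ⊤ (E ⊔ X) := by
    apply le_antisymm
    · exact orb_le _ _ (sup_le (le_orb _ _ _) hFle) fun h _ => orb_inv _ _ (Subgroup.mem_top h) _
    · refine hleF.trans (sup_le (orb_mono _ _ (le_sup_left.trans le_sup_left)) ?_)
      exact le_sup_right.trans (le_orb _ _ _)
  refine ⟨E ⊔ X ⊔ F, (hE.sup hX).sup hF, le_sup_right.trans le_sup_left, fun g => ?_⟩
  rw [hY]
  exact orb_inv _ _ (Subgroup.mem_top g) _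

theorem good_torsion {G A : Type*} [Group G] [AddCommGroup A] (ρ : Representation ℤ G A)
    {r : ℕ} (hr : PR r A) (P : Subgroup G) (htor : ∀ a : A, ∃ n : ℕ, n ≠ 0 ∧ n • a = 0) :
    Good ρ P := by
  refine good_of_exp ρ hr P ⊥ Submodule.fg_bot (by simpa using htor) one_ne_zero ?_
  intro g x hx
  rw [Submodule.mem_bot] at hx
  simp [hx]

lemma exists_max_indep {A : Type*} [AddCommGroup A] {r : ℕ} (hr : PR r A) :
    ∃ E : Submodule ℤ A, E.FG ∧ ∀ a : A, ∃ n : ℕ, n ≠ 0 ∧ n • a ∈ E := by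
  classical
  obtain ⟨s, hs, hmax⟩ := exists_maximal_linearIndepOn ℤ (id : A → A)
  have hfin : s.Finite := by
    by_contra hinf
    obtain ⟨t, hts, htc⟩ := Set.Infinite.exists_subset_card_eq hinf (r + 1)
    have hti : LinearIndepOn ℤ id (t : Set A) := hs.mono hts
    obtain ⟨s', hs', hspan⟩ := hr (Submodule.span ℤ (t : Set A)) ⟨t, rfl⟩
    have h1 : Module.finrank ℤ (Submodule.span ℤ (t : Set A)) = t.card :=
      finrank_span_finset_eq_card hti
    have h2 := finrank_span_finset_le_card (R := ℤ) s'
    rw [Set.finrank, hspan, h1] at h2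
    omega
  refine ⟨Submodule.span ℤ s, Submodule.fg_span hfin, fun a => ?_⟩
  by_cases ha : a ∈ s
  · exact ⟨1, one_ne_zero, by simpa using Submodule.subset_span ha⟩
  · obtain ⟨c, hc, h⟩ := hmax a ha
    rw [Set.image_id] at h
    refine ⟨c.natAbs, Int.natAbs_ne_zero.2 hc, ?_⟩
    rcases Int.natAbs_eq c with h' | h'
    · rw [← natCast_zsmul, ← h']; exact h
    · have : (c.natAbs : ℤ) = -c := by omega
      rw [← natCast_zsmul, this, neg_smul]; exact neg_mem h
end PRK
end

section
universe u
open TensorProduct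
namespace PRK

section
variable {p : ℕ} [Fact p.Prime] {A : Type u} [AddCommGroup A]

/-- Base change of an integral representation to `ℚ_p`. -/
noncomputable def bc (p : ℕ) [Fact p.Prime] {G : Type*} [Group G] (ρ : Representation ℤ G A) :
    Representation ℚ_[p] G (ℚ_[p] ⊗[ℤ] A) where
  toFun g := (ρ g).baseChange ℚ_[p]
  map_one' := by rw [map_one]; exact LinearMap.baseChange_id
  map_mul' a b := by rw [map_mul]; exact LinearMap.baseChange_comp _ _

lemma bc_tmul {G : Type*} [Group G] (ρ : Representation ℤ G A) (g : G) (c : ℚ_[p]) (a : A) :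
    bc p ρ g (c ⊗ₜ a) = c ⊗ₜ ρ g a := rfl

lemma not_dvd_order [Module.IsTorsionFree ℤ A] (B : Submodule ℤ A) (x : A)
    (hx : (1 : ℚ_[p]) ⊗ₜ[ℤ] x ∈
      Submodule.span ℤ_[p] ((fun a : A => (1 : ℚ_[p]) ⊗ₜ[ℤ] a) '' (B : Set A)))
    {n : ℕ} (hn : n ≠ 0) (hnx : n • x ∈ B) : ∃ c : ℕ, ¬ p ∣ c ∧ c • x ∈ B := by
  have hp : p.Prime := Fact.out
  set xb : A ⧸ B := B.mkQ x with hxb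
  refine ⟨addOrderOf xb, ?_, ?_⟩
  swap
  · rw [← Submodule.Quotient.mk_eq_zero, Submodule.Quotient.mk_smul]
    exact addOrderOf_nsmul_eq_zero xb
  intro hdvd
  have hpos : addOrderOf xb ≠ 0 := by
    intro h0
    have : n • xb = 0 := by
      rw [hxb, ← map_nsmul, Submodule.mkQ_apply, Submodule.Quotient.mk_eq_zero]; exact hnx
    have := addOrderOf_dvd_of_nsmul_eq_zero this
    rw [h0, zero_dvd_iff] at this
    exact hn this
  set y : A ⧸ B := (addOrderOf xb / p) • xb with hy
  have hyo : addOrderOf y = p := by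
    obtain ⟨m, hm⟩ := hdvd
    have hm0 : m ≠ 0 := by rintro rfl; simp at hm; exact hpos (by simp [hm])
    rw [hy, addOrderOf_nsmul_of_dvd]
    · rw [hm, Nat.mul_div_cancel_left _ hp.pos, Nat.mul_div_cancel _ (Nat.pos_of_ne_zero hm0)]
    · rw [hm, Nat.mul_div_cancel_left _ hp.pos]; exact hm0
    · exact Nat.div_dvd_of_dvd ⟨m, hm⟩
  -- step 1: `1 ⊗ xb = 0` in `ℤ_p ⊗ A/B`
  let Θ : ℤ_[p] ⊗[ℤ] A →ₗ[ℤ_[p]] ℚ_[p] ⊗[ℤ] A :=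
    TensorProduct.AlgebraTensorModule.map (Algebra.linearMap ℤ_[p] ℚ_[p]) LinearMap.id
  have hΘ1 : ∀ a : A, Θ (1 ⊗ₜ a) = 1 ⊗ₜ a := by
    intro a
    simp [Θ]
  have hΘ : Function.Injective Θ := by
    have h1 : Function.Injective
        (LinearMap.rTensor A ((Algebra.linearMap ℤ_[p] ℚ_[p]).restrictScalars ℤ)) := by
      apply Module.Flat.rTensor_preserves_injective_linearMap
      exact IsFractionRing.injective ℤ_[p] ℚ_[p]
    exact h1
  have h1 : (1 : ℤ_[p]) ⊗ₜ[ℤ] xb = 0 := by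
    have himg : ((fun a : A => (1 : ℚ_[p]) ⊗ₜ[ℤ] a) '' (B : Set A)) =
        Θ '' ((fun a : A => (1 : ℤ_[p]) ⊗ₜ[ℤ] a) '' (B : Set A)) := by
      rw [Set.image_image]
      simp_rw [hΘ1]
    rw [himg, ← Submodule.map_span] at hx
    obtain ⟨z, hz, hzx⟩ := hx
    rw [← hΘ1] at hzx
    have hzx := hΘ hzx
    have hle : Submodule.span ℤ_[p] ((fun a : A => (1 : ℤ_[p]) ⊗ₜ[ℤ] a) '' (B : Set A)) ≤
        LinearMap.ker (B.mkQ.baseChange ℤ_[p]) := by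
      rw [Submodule.span_le]
      rintro _ ⟨b, hb, rfl⟩
      simp only [SetLike.mem_coe, LinearMap.mem_ker, LinearMap.baseChange_tmul]
      rw [Submodule.mkQ_apply, (Submodule.Quotient.mk_eq_zero B).2 hb, tmul_zero]
    have := hle hz
    rw [hzx, LinearMap.mem_ker, LinearMap.baseChange_tmul] at this
    exact this
  have h2 : (1 : ℤ_[p]) ⊗ₜ[ℤ] y = 0 := by
    rw [hy, tmul_smul, h1, smul_zero]
  let j : ZMod p →ₗ[ℤ] (A ⧸ B) := (ZMod.lift p ⟨(zmultiplesHom _ y), by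
    simp only [zmultiplesHom_apply, natCast_zsmul]
    rw [← hyo]; exact addOrderOf_nsmul_eq_zero y⟩).toIntLinearMap
  have hj1 : j 1 = y := by
    have := ZMod.lift_coe p ⟨(zmultiplesHom (A ⧸ B) y), by
      simp only [zmultiplesHom_apply, natCast_zsmul]
      rw [← hyo]; exact addOrderOf_nsmul_eq_zero y⟩ 1
    have h' : ZMod.lift p ⟨(zmultiplesHom (A ⧸ B) y), by
      simp only [zmultiplesHom_apply, natCast_zsmul]
      rw [← hyo]; exact addOrderOf_nsmul_eq_zero y⟩ 1 = y := by simpa using this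
    exact h'
  have hj : Function.Injective j := by
    rw [← LinearMap.ker_eq_bot, LinearMap.ker_eq_bot']
    intro a ha
    have : NeZero p := ⟨hp.ne_zero⟩
    have h3 : j a = a.val • y := by
      conv_lhs => rw [← ZMod.natCast_zmod_val a, ← nsmul_one, map_nsmul, hj1]
    rw [h3] at ha
    have := addOrderOf_dvd_of_nsmul_eq_zero ha
    rw [hyo] at this
    rw [← ZMod.natCast_zmod_val a]
    exact (ZMod.natCast_eq_zero_iff _ _).2 this
  have h4 : (1 : ℤ_[p]) ⊗ₜ[ℤ] (1 : ZMod p) = 0 := by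
    have hl : Function.Injective (LinearMap.lTensor ℤ_[p] j) :=
      Module.Flat.lTensor_preserves_injective_linearMap _ hj
    apply hl
    rw [LinearMap.lTensor_tmul, hj1, h2, map_zero]
  let f : ℤ_[p] →ₗ[ℤ] ZMod p := (PadicInt.toZMod (p := p)).toAddMonoidHom.toIntLinearMap
  let g : ℤ_[p] ⊗[ℤ] ZMod p →ₗ[ℤ] ZMod p := LinearMap.mul' ℤ (ZMod p) ∘ₗ LinearMap.rTensor _ f
  have h5 : g (1 ⊗ₜ 1) = 1 := by
    have hf : f 1 = 1 := map_one (PadicInt.toZMod (p := p))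
    change LinearMap.mul' ℤ (ZMod p) (f 1 ⊗ₜ 1) = 1
    rw [hf, LinearMap.mul'_apply, mul_one]
  rw [h4, map_zero] at h5
  exact zero_ne_one h5

lemma absorb_tensor (E : Submodule ℤ A) (htor : ∀ a : A, ∃ n : ℕ, n ≠ 0 ∧ n • a ∈ E)
    (x : ℚ_[p] ⊗[ℤ] A) : ∃ c : ℤ_[p], c ≠ 0 ∧ c • x ∈
      Submodule.span ℤ_[p] ((fun a : A => (1 : ℚ_[p]) ⊗ₜ[ℤ] a) '' (E : Set A)) := by
  induction x using TensorProduct.induction_on with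
  | zero => exact ⟨1, one_ne_zero, by rw [smul_zero]; exact Submodule.zero_mem _⟩
  | tmul k a =>
    obtain ⟨n, hn, hna⟩ := htor a
    obtain ⟨c, hc⟩ := IsLocalization.exists_integer_multiple (nonZeroDivisors ℤ_[p]) k
    obtain ⟨z, hz⟩ := hc
    refine ⟨(n : ℤ_[p]) * c, mul_ne_zero (by exact_mod_cast hn) (nonZeroDivisors.coe_ne_zero c), ?_⟩
    have : ((n : ℤ_[p]) * c) • (k ⊗ₜ[ℤ] a) = z • ((1 : ℚ_[p]) ⊗ₜ[ℤ] (n • a)) := by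
      rw [mul_smul, smul_tmul', ← hz, smul_tmul', Nat.cast_smul_eq_nsmul, smul_tmul', smul_tmul,
        Algebra.smul_def z, mul_one]
    rw [this]
    exact Submodule.smul_mem _ _ (Submodule.subset_span ⟨_, hna, rfl⟩)
  | add x y hx hy =>
    obtain ⟨c, hc, hx⟩ := hx
    obtain ⟨d, hd, hy⟩ := hy
    refine ⟨d * c, mul_ne_zero hd hc, ?_⟩
    rw [smul_add]
    refine Submodule.add_mem _ ?_ ?_
    · rw [mul_smul]; exact Submodule.smul_mem _ _ hx
    · rw [mul_comm, mul_smul]; exact Submodule.smul_mem _ _ hy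

lemma fd_tensor (E : Submodule ℤ A) (hE : E.FG)
    (htor : ∀ a : A, ∃ n : ℕ, n ≠ 0 ∧ n • a ∈ E) :
    FiniteDimensional ℚ_[p] (ℚ_[p] ⊗[ℤ] A) := by
  obtain ⟨s, rfl⟩ := hE
  refine ⟨Submodule.fg_def.2 ⟨(fun a : A => (1 : ℚ_[p]) ⊗ₜ[ℤ] a) '' s,
    s.finite_toSet.image _, ?_⟩⟩
  rw [eq_top_iff]
  intro x _
  obtain ⟨c, hc, hx⟩ := absorb_tensor (p := p) _ htor x
  have hc' : (c : ℚ_[p]) ≠ 0 := fun h0 => hc (Subtype.ext h0)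
  set T := Submodule.span ℚ_[p] ((fun a : A => (1 : ℚ_[p]) ⊗ₜ[ℤ] a) '' s) with hT
  have h1 : Submodule.span ℤ (s : Set A) ≤
      (T.restrictScalars ℤ).comap (TensorProduct.mk ℤ ℚ_[p] A 1) := by
    rw [Submodule.span_le]
    intro a ha
    exact Submodule.subset_span ⟨a, ha, rfl⟩
  have h2 : Submodule.span ℤ_[p] ((fun a : A => (1 : ℚ_[p]) ⊗ₜ[ℤ] a) ''
      (Submodule.span ℤ (s : Set A) : Set A)) ≤ T.restrictScalars ℤ_[p] := by
    rw [Submodule.span_le]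
    rintro _ ⟨a, ha, rfl⟩
    exact h1 ha
  have h3 : c • x ∈ T := h2 hx
  rw [← algebraMap_smul ℚ_[p] c x] at h3
  exact (T.smul_mem_iff hc').1 h3

lemma fg_tensor (E : Submodule ℤ A) (hE : E.FG) :
    (Submodule.span ℤ_[p] ((fun a : A => (1 : ℚ_[p]) ⊗ₜ[ℤ] a) '' (E : Set A))).FG := by
  obtain ⟨s, rfl⟩ := hE
  refine Submodule.fg_def.2 ⟨(fun a : A => (1 : ℚ_[p]) ⊗ₜ[ℤ] a) '' s, s.finite_toSet.image _, ?_⟩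
  apply le_antisymm
  · exact Submodule.span_mono (Set.image_mono Submodule.subset_span)
  · rw [Submodule.span_le]
    rintro _ ⟨a, ha, rfl⟩
    set T := Submodule.span ℤ_[p] ((fun a : A => (1 : ℚ_[p]) ⊗ₜ[ℤ] a) '' s) with hT
    have h1 : Submodule.span ℤ (s : Set A) ≤
        (T.restrictScalars ℤ).comap (TensorProduct.mk ℤ ℚ_[p] A 1) := by
      rw [Submodule.span_le]
      intro a ha
      exact Submodule.subset_span ⟨a, ha, rfl⟩
    exact h1 ha

lemma absorb_tensor_fg (E : Submodule ℤ A) (htor : ∀ a : A, ∃ n : ℕ, n ≠ 0 ∧ n • a ∈ E)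
    (Y : Submodule ℤ_[p] (ℚ_[p] ⊗[ℤ] A)) (hY : Y.FG) : ∃ m : ℕ, ∀ x ∈ Y, ((p : ℤ_[p]) ^ m) • x ∈
      Submodule.span ℤ_[p] ((fun a : A => (1 : ℚ_[p]) ⊗ₜ[ℤ] a) '' (E : Set A)) := by
  classical
  set X₀ := Submodule.span ℤ_[p] ((fun a : A => (1 : ℚ_[p]) ⊗ₜ[ℤ] a) '' (E : Set A)) with hX₀
  have hm : ∀ x : ℚ_[p] ⊗[ℤ] A, ∃ m : ℕ, ((p : ℤ_[p]) ^ m) • x ∈ X₀ := by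
    intro x
    obtain ⟨c, hc, hx⟩ := absorb_tensor E htor x
    refine ⟨c.valuation, ?_⟩
    have h1 := PadicInt.unitCoeff_spec hc
    have h2 : (p : ℤ_[p]) ^ c.valuation = ((PadicInt.unitCoeff hc)⁻¹ : ℤ_[p]ˣ) * c :=
      (Units.eq_inv_mul_iff_mul_eq _).2 h1.symm
    rw [h2, mul_smul]
    exact X₀.smul_mem _ hx
  choose f hf using hm
  obtain ⟨s, rfl⟩ := hY
  refine ⟨s.sup f, fun x hx => ?_⟩
  have : Submodule.span ℤ_[p] (s : Set (ℚ_[p] ⊗[ℤ] A)) ≤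
      X₀.comap (LinearMap.lsmul ℤ_[p] _ ((p : ℤ_[p]) ^ (s.sup f))) := by
    rw [Submodule.span_le]
    intro y hy
    simp only [Submodule.comap_coe, Set.mem_preimage, LinearMap.lsmul_apply, SetLike.mem_coe]
    rw [← Nat.sub_add_cancel (Finset.le_sup (f := f) hy), pow_add, mul_smul]
    exact Submodule.smul_mem _ _ (hf y)
  exact this hx

/-- The local statement at `p`. -/
lemma local_exp [Module.IsTorsionFree ℤ A] {G : Type*} [Group G] (ρ : Representation ℤ G A)
    (P : Subgroup G)
    (E : Submodule ℤ A) (hE : E.FG) (htor : ∀ a : A, ∃ n : ℕ, n ≠ 0 ∧ n • a ∈ E)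
    (hgood : Good (resO (bc p ρ)) P) :
    ∃ m : ℕ, ∀ g, ∀ x ∈ E, ∃ c : ℕ, ¬ p ∣ c ∧ c • (p ^ m • ρ g x) ∈ orb ρ P E := by
  set X₀ := Submodule.span ℤ_[p] ((fun a : A => (1 : ℚ_[p]) ⊗ₜ[ℤ] a) '' (E : Set A)) with hX₀
  obtain ⟨Y, hY, hXY, hinv⟩ := hgood X₀ (fg_tensor E hE)
  obtain ⟨m, hm⟩ := absorb_tensor_fg E htor Y hY
  refine ⟨m, fun g x hx => ?_⟩
  obtain ⟨n, hn, hnx⟩ := htor (p ^ m • ρ g x)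
  refine not_dvd_order (p := p) (orb ρ P E) _ ?_ hn (le_orb ρ P E hnx)
  set J := Submodule.span ℤ_[p] ((fun a : A => (1 : ℚ_[p]) ⊗ₜ[ℤ] a) '' (orb ρ P E : Set A)) with hJ
  have hJinv : ∀ h ∈ P, J.map (resO (bc p ρ) h) ≤ J := by
    intro h hh
    rw [hJ, Submodule.map_span, Submodule.span_le]
    rintro _ ⟨_, ⟨a, ha, rfl⟩, rfl⟩
    exact Submodule.subset_span ⟨ρ h a, orb_inv ρ P hh E (Submodule.mem_map_of_mem ha), rfl⟩
  have hX₀J : X₀ ≤ J := Submodule.span_mono (Set.image_mono (le_orb ρ P E))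
  have h1 : orb (resO (bc p ρ)) P Y ≤ J.comap (LinearMap.lsmul ℤ_[p] _ ((p : ℤ_[p]) ^ m)) := by
    refine orb_le _ _ (fun y hy => hX₀J (hm y hy)) ?_
    intro h hh
    rintro _ ⟨z, hz, rfl⟩
    simp only [Submodule.mem_comap, LinearMap.lsmul_apply, SetLike.mem_coe] at hz ⊢
    rw [← map_smul]
    exact hJinv h hh (Submodule.mem_map_of_mem hz)
  have h2 : (1 : ℚ_[p]) ⊗ₜ[ℤ] x ∈ orb (resO (bc p ρ)) P Y :=
    le_orb _ _ _ (hXY (Submodule.subset_span ⟨x, hx, rfl⟩))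
  have h3 := h1 (hinv g (Submodule.mem_map_of_mem h2))
  simp only [Submodule.mem_comap, LinearMap.lsmul_apply] at h3
  rw [resO_apply, bc_tmul] at h3
  convert h3 using 1
  rw [← Nat.cast_pow, Nat.cast_smul_eq_nsmul, tmul_smul]
end

theorem good_torsionfree {G : Type*} [Group G] (hG : Group.FG G) (P : ℕ → Subgroup G)
    (hPn : ∀ k, (P k).Normal) (hPf : ∀ i j, i ≠ j → (P i ⊔ P j).FiniteIndex)
    (hPu : ∀ k, ∃ u, P k ⊔ Subgroup.zpowers u = ⊤)
    (A : Type u) [AddCommGroup A] [Module.IsTorsionFree ℤ A] (ρ : Representation ℤ G A)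
    {r : ℕ} (hr : PR r A) : {k | ¬ Good ρ (P k)}.Finite := by
  classical
  obtain ⟨E, hE, htor⟩ := exists_max_indep hr
  -- a bad integer
  have hN : ∀ g : G, ∃ N : ℕ, N ≠ 0 ∧ (∀ x ∈ E, N • ρ g x ∈ E) := by
    intro g
    obtain ⟨n, hn, h⟩ := exists_smul E (E.map (ρ g)) (hE.map _) fun x _ => htor x
    exact ⟨n, hn, fun x hx => h _ (Submodule.mem_map_of_mem hx)⟩
  choose f hf0 hf using hN
  obtain ⟨S, hS⟩ := hG.1
  set N : ℕ := ∏ g ∈ S, (f g * f g⁻¹) with hNdef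
  have hN0 : N ≠ 0 := Finset.prod_ne_zero_iff.2 fun x _ => mul_ne_zero (hf0 _) (hf0 _)
  have hNS : ∀ g ∈ S, (∀ x ∈ E, N • ρ g x ∈ E) ∧ (∀ x ∈ E, N • ρ g⁻¹ x ∈ E) := by
    intro g hg
    constructor
    · intro x hx
      rw [hNdef, ← Finset.prod_erase_mul S _ hg, mul_comm (f g), ← mul_assoc, mul_smul]
      exact nsmul_mem (hf g x hx) _
    · intro x hx
      rw [hNdef, ← Finset.prod_erase_mul S _ hg, ← mul_assoc, mul_smul]
      exact nsmul_mem (hf g⁻¹ x hx) _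
  have hNmul : ∀ a b : G, ∀ i j : ℕ, (∀ x ∈ E, N ^ i • ρ a x ∈ E) → (∀ x ∈ E, N ^ j • ρ b x ∈ E) →
      ∀ x ∈ E, N ^ (i + j) • ρ (a * b) x ∈ E := by
    intro a b i j ha hb x hx
    have := ha _ (hb x hx)
    rw [pow_add, mul_smul, map_mul, Module.End.mul_apply, ← map_nsmul]
    exact this
  have hNG : ∀ g : G, ∃ K : ℕ, (∀ x ∈ E, N ^ K • ρ g x ∈ E) ∧ (∀ x ∈ E, N ^ K • ρ g⁻¹ x ∈ E) := by
    intro g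
    have hg : g ∈ Subgroup.closure (S : Set G) := by rw [hS]; trivial
    induction hg using Subgroup.closure_induction with
    | mem x hx => exact ⟨1, by simpa using hNS x hx⟩
    | one => exact ⟨0, by simp⟩
    | mul a b _ _ iha ihb =>
      obtain ⟨i, hi, hi'⟩ := iha
      obtain ⟨j, hj, hj'⟩ := ihb
      refine ⟨i + j, hNmul a b i j hi hj, ?_⟩
      rw [mul_inv_rev, add_comm]
      exact hNmul _ _ _ _ hj' hi'
    | inv a _ iha =>
      obtain ⟨i, hi, hi'⟩ := iha
      exact ⟨i, hi', by simpa using hi⟩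
  -- the bad set
  have hbad : ∀ p ∈ N.primeFactors, {k | ∃ hp : Fact p.Prime, ¬ Good (resO (bc p ρ)) (P k)}.Finite := by
    intro p hp
    have hp' : Fact p.Prime := ⟨Nat.prime_of_mem_primeFactors hp⟩
    have := fd_tensor (p := p) E hE htor
    refine (padic_main (p := p) P hPn hPf hPu _ _ (bc p ρ) rfl).subset ?_
    rintro k ⟨_, hk⟩
    exact hk
  refine (Set.Finite.biUnion N.primeFactors.finite_toSet hbad).subset ?_
  intro k hk
  by_contra hcon
  simp only [Set.mem_iUnion, not_exists, Set.mem_ofPred_eq, not_not] at hcon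
  apply hk
  have hloc : ∀ p : ℕ, ∃ m : ℕ, p ∈ N.primeFactors → ∀ g, ∀ x ∈ E,
      ∃ c : ℕ, ¬ p ∣ c ∧ c • (p ^ m • ρ g x) ∈ orb ρ (P k) E := by
    intro p
    by_cases hp : p ∈ N.primeFactors
    · have hp' : Fact p.Prime := ⟨Nat.prime_of_mem_primeFactors hp⟩
      obtain ⟨m, hm⟩ := local_exp (p := p) ρ (P k) E hE htor (hcon p hp hp')
      exact ⟨m, fun _ => hm⟩
    · exact ⟨0, fun h => absurd h hp⟩
  choose m hm using hloc
  set n : ℕ := ∏ p ∈ N.primeFactors, p ^ m p with hn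
  have hn0 : n ≠ 0 := Finset.prod_ne_zero_iff.2 fun p hp =>
    pow_ne_zero _ (Nat.prime_of_mem_primeFactors hp).ne_zero
  refine good_of_exp ρ hr (P k) E hE htor hn0 ?_
  intro g x hx
  set B := orb ρ (P k) E with hB
  have hord : ∀ c : ℕ, c • (n • ρ g x) ∈ B → addOrderOf (B.mkQ (n • ρ g x)) ∣ c := by
    intro c hc
    apply addOrderOf_dvd_of_nsmul_eq_zero
    rw [← map_nsmul, Submodule.mkQ_apply, Submodule.Quotient.mk_eq_zero]
    exact hc
  have h1 : addOrderOf (B.mkQ (n • ρ g x)) = 1 := by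
    by_contra hne
    obtain ⟨q, hq, hqd⟩ := Nat.exists_prime_and_dvd hne
    obtain ⟨K, hK, -⟩ := hNG g
    have h2 : q ∣ N ^ K := hqd.trans (hord _ (by
      rw [smul_comm]; exact nsmul_mem (le_orb ρ (P k) E (hK x hx)) _))
    have hqN : q ∈ N.primeFactors := Nat.mem_primeFactors.2 ⟨hq, hq.dvd_of_dvd_pow h2, hN0⟩
    obtain ⟨c, hc, hcx⟩ := hm q hqN g x hx
    refine hc (hqd.trans (hord c ?_))
    rw [hn, ← Finset.prod_erase_mul _ _ hqN, mul_smul, smul_comm]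
    exact nsmul_mem hcx _
  rw [AddMonoid.addOrderOf_eq_one_iff, Submodule.mkQ_apply, Submodule.Quotient.mk_eq_zero] at h1
  exact h1

theorem good_module {G : Type*} [Group G] (hG : Group.FG G) (P : ℕ → Subgroup G)
    (hPn : ∀ k, (P k).Normal) (hPf : ∀ i j, i ≠ j → (P i ⊔ P j).FiniteIndex)
    (hPu : ∀ k, ∃ u, P k ⊔ Subgroup.zpowers u = ⊤)
    (A : Type u) [AddCommGroup A] (ρ : Representation ℤ G A)
    {r : ℕ} (hr : PR r A) : {k | ¬ Good ρ (P k)}.Finite := by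
  set T := Submodule.torsion ℤ A with hT
  have hTinv : ∀ g, T ≤ T.comap (ρ g) := by
    intro g x hx
    rw [Submodule.mem_comap]
    rw [hT, Submodule.mem_torsion_iff] at hx ⊢
    obtain ⟨a, ha⟩ := hx
    refine ⟨a, ?_⟩
    have : (a : ℤ) • x = 0 := ha
    change (a : ℤ) • ρ g x = 0
    rw [← map_smul, this, map_zero]
  have h1 := good_torsionfree hG P hPn hPf hPu (A ⧸ T) (ρ.quotient T hTinv)
    (hr.quot T.mkQ T.mkQ_surjective)
  refine h1.subset ?_
  intro k hk hcon
  have := hPn k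
  obtain ⟨u, hu⟩ := hPu k
  refine hk (good_ext ρ (P k) (ρ.subrepresentation T hTinv) (ρ.quotient T hTinv) T.subtype T.mkQ
    (fun g v => rfl) (fun g v => rfl) T.mkQ_surjective (by simp) u hu ?_ hcon)
  refine good_torsion _ (hr.sub T.subtype Subtype.val_injective) _ ?_
  rintro ⟨a, ha⟩
  rw [hT, Submodule.mem_torsion_iff] at ha
  obtain ⟨⟨c, hc⟩, ha⟩ := ha
  have hca : c • a = 0 := ha
  have hc0 : c ≠ 0 := nonZeroDivisors.ne_zero hc
  refine ⟨c.natAbs, Int.natAbs_ne_zero.2 hc0, ?_⟩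
  apply Subtype.ext
  change c.natAbs • a = 0
  rw [← natCast_zsmul]
  rcases Int.natAbs_eq c with h' | h'
  · rw [← h']; exact hca
  · have : (c.natAbs : ℤ) = -c := by omega
    rw [this, neg_smul, hca, neg_zero]
end PRK
end

section
namespace PRK
open scoped commutatorElement
universe u

section
variable {G : Type u} [Group G]

/-- The conjugation action of `G` on the abelianization of a normal subgroup. -/
noncomputable def conjRep (M : Subgroup G) [M.Normal] :
    Representation ℤ G (Additive (Abelianization M)) where
  toFun g := (MonoidHom.toAdditive
    (Abelianization.map (MulAut.conjNormal g : M ≃* M).toMonoidHom)).toIntLinearMap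
  map_one' := by
    ext x
    induction x using Additive.rec with | ofMul x => ?_
    obtain ⟨x, rfl⟩ := QuotientGroup.mk_surjective x
    simp only [map_one]
    rfl
  map_mul' g h := by
    ext x
    induction x using Additive.rec with | ofMul x => ?_
    obtain ⟨x, rfl⟩ := QuotientGroup.mk_surjective x
    simp only [map_mul]
    rfl

/-- The quotient map to the abelianization, written additively. -/
def qq (M : Subgroup G) (x : M) : Additive (Abelianization M) :=
  Additive.ofMul (Abelianization.of x)

lemma qq_surj (M : Subgroup G) : Function.Surjective (qq M) := by
  intro x
  induction x using Additive.rec with | ofMul x => ?_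
  obtain ⟨x, rfl⟩ := QuotientGroup.mk_surjective x
  exact ⟨x, rfl⟩

lemma qq_mul (M : Subgroup G) (x y : M) : qq M (x * y) = qq M x + qq M y := rfl
lemma qq_inv (M : Subgroup G) (x : M) : qq M (x⁻¹) = - qq M x := rfl
lemma qq_one (M : Subgroup G) : qq M 1 = 0 := rfl

lemma qq_conj (M : Subgroup G) [M.Normal] (g : G) (x : M) :
    conjRep M g (qq M x) = qq M (MulAut.conjNormal g x) := rfl

lemma qq_eq (M : Subgroup G) (x y : M) (h : qq M x = qq M y) :
    (y : G)⁻¹ * x ∈ ⁅M, M⁆ := by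
  have h1 : (Abelianization.of x : Abelianization M) = Abelianization.of y := h
  have h2 : y⁻¹ * x ∈ commutator M := by
    rw [← Abelianization.ker_of, MonoidHom.mem_ker, map_mul, map_inv, h1, inv_mul_cancel]
  have h3 := Subgroup.mem_map_of_mem M.subtype h2
  rwa [Subgroup.map_subtype_commutator] at h3

/-- Preimage in `G` of a submodule of the abelianization. -/
def pre (M : Subgroup G) (X : Submodule ℤ (Additive (Abelianization M))) : Subgroup G where
  carrier := {g | ∃ h : g ∈ M, qq M ⟨g, h⟩ ∈ X}
  one_mem' := ⟨M.one_mem, X.zero_mem⟩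
  mul_mem' := by
    rintro a b ⟨ha, ha'⟩ ⟨hb, hb'⟩
    exact ⟨M.mul_mem ha hb, X.add_mem ha' hb'⟩
  inv_mem' := by
    rintro a ⟨ha, ha'⟩
    exact ⟨M.inv_mem ha, X.neg_mem ha'⟩

/-- Image in the abelianization of the intersection with `M`. -/
def img (M N : Subgroup G) : Submodule ℤ (Additive (Abelianization M)) :=
  AddSubgroup.toIntSubmodule
  { carrier := {a | ∃ x : M, (x : G) ∈ N ∧ qq M x = a}
    zero_mem' := ⟨1, N.one_mem, rfl⟩
    add_mem' := by
      rintro _ _ ⟨x, hx, rfl⟩ ⟨y, hy, rfl⟩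
      exact ⟨x * y, N.mul_mem hx hy, rfl⟩
    neg_mem' := by
      rintro _ ⟨x, hx, rfl⟩
      exact ⟨x⁻¹, N.inv_mem hx, rfl⟩ }

lemma mem_img (M N : Subgroup G) (a : Additive (Abelianization M)) :
    a ∈ img M N ↔ ∃ x : M, (x : G) ∈ N ∧ qq M x = a := Iff.rfl

lemma pr_ab {r : ℕ} (hr : ∀ H : Subgroup G, H.FG →
    ∃ S : Finset G, S.card ≤ r ∧ Subgroup.closure (S : Set G) = H) (M : Subgroup G) :
    PR r (Additive (Abelianization M)) := by
  classical
  rintro X ⟨t, rfl⟩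
  choose σ hσ using qq_surj M
  obtain ⟨S, hS, hSH⟩ := hr (Subgroup.closure ((t.image fun a => (σ a : G) : Finset G) : Set G))
    ⟨_, rfl⟩
  have hle : Subgroup.closure (S : Set G) ≤ pre M (Submodule.span ℤ (t : Set _)) := by
    rw [hSH, Subgroup.closure_le]
    intro g hg
    simp only [Finset.coe_image, Set.mem_image] at hg
    obtain ⟨a, ha, rfl⟩ := hg
    refine ⟨(σ a).2, ?_⟩
    change qq M (σ a) ∈ _
    rw [hσ]
    exact Submodule.subset_span ha
  have hSM : ∀ g ∈ S, g ∈ pre M (Submodule.span ℤ (t : Set _)) := fun g hg =>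
    hle (Subgroup.subset_closure hg)
  let F : G → Additive (Abelianization M) := fun g => if h : g ∈ M then qq M ⟨g, h⟩ else 0
  refine ⟨S.image F, Finset.card_image_le.trans hS, le_antisymm ?_ ?_⟩
  · rw [Submodule.span_le]
    intro a ha
    simp only [Finset.coe_image, Set.mem_image] at ha
    obtain ⟨g, hg, rfl⟩ := ha
    obtain ⟨h, h'⟩ := hSM g hg
    simp only [F, dif_pos h]
    exact h'
  · rw [Submodule.span_le]
    intro a ha
    have h1 : Subgroup.closure (S : Set G) ≤
        pre M (Submodule.span ℤ ((S.image F : Finset _) : Set _)) := by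
      rw [Subgroup.closure_le]
      intro g hg
      obtain ⟨h, h'⟩ := hSM g hg
      refine ⟨h, Submodule.subset_span ?_⟩
      simp only [Finset.coe_image, Set.mem_image]
      exact ⟨g, hg, by simp only [F, dif_pos h]⟩
    rw [hSH] at h1
    obtain ⟨h, h'⟩ := h1 (Subgroup.subset_closure (by
      simp only [Finset.coe_image, Set.mem_image]; exact ⟨a, ha, rfl⟩) : (σ a : G) ∈ _)
    have h2 : qq M (σ a) ∈ Submodule.span ℤ ((S.image F : Finset _) : Set _) := h'
    rwa [hσ] at h2

lemma step (M P : Subgroup G) [M.Normal] [P.Normal] (hMP : M ≤ P) (u : G)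
    (hgood : Good (conjRep M) P) (S : Set G) (hSP : Subgroup.normalClosure S = P)
    (hSu : Subgroup.closure (insert u S) = ⊤) (K : Subgroup G) (hK : K.FG) (hSK : S ⊆ K)
    (hKP : K ≤ P) (hPK : P ≤ K ⊔ M) :
    ∃ K₂ : Subgroup G, K₂.FG ∧ S ⊆ K₂ ∧ K₂ ≤ P ∧ P ≤ K₂ ⊔ ⁅M, M⁆ := by
  classical
  obtain ⟨T, rfl⟩ := hK
  set K := Subgroup.closure (T : Set G) with hKdef
  have hdec : ∀ v : G, ∃ f : G → M, ∀ t ∈ T, ∃ k ∈ K, k * (f t : G) = v * t * v⁻¹ := by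
    intro v
    have : ∀ t : G, ∃ m : M, t ∈ T → ∃ k ∈ K, k * (m : G) = v * t * v⁻¹ := by
      intro t
      by_cases ht : t ∈ T
      · have h1 : v * t * v⁻¹ ∈ K ⊔ M := hPK (Subgroup.Normal.conj_mem inferInstance _
          (hKP (Subgroup.subset_closure ht)) v)
        obtain ⟨k, hk, m, hm, h⟩ := Subgroup.mem_sup_of_normal_right.1 h1
        exact ⟨⟨m, hm⟩, fun _ => ⟨k, hk, h⟩⟩
      · exact ⟨1, fun h => absurd h ht⟩
    choose f hf using this
    exact ⟨f, hf⟩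
  obtain ⟨f, hf⟩ := hdec u
  obtain ⟨f', hf'⟩ := hdec u⁻¹
  obtain ⟨Y, ⟨Z, hZ⟩, hXY, hinv⟩ := hgood (Submodule.span ℤ
    ((T.image (fun t => qq M (f t)) ∪ T.image (fun t => qq M (f' t)) : Finset _) : Set _)) ⟨_, rfl⟩
  choose σ hσ using qq_surj M
  let R : Finset G := Z.image fun a => (σ a : G)
  have hRM : ∀ r ∈ R, r ∈ M := by
    intro r hr
    simp only [R, Finset.mem_image] at hr
    obtain ⟨a, _, rfl⟩ := hr
    exact (σ a).2
  set K₂ := Subgroup.closure ((T ∪ R : Finset G) : Set G) with hK₂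
  have hKK₂ : K ≤ K₂ := Subgroup.closure_mono (by simp)
  have hRK₂ : ∀ r ∈ R, r ∈ K₂ := fun r hr => Subgroup.subset_closure (by simp [hr])
  set N := K₂ ⊔ ⁅M, M⁆ with hN
  have hK₂N : K₂ ≤ N := le_sup_left
  have hMN : ⁅M, M⁆ ≤ N := le_sup_right
  have hYN : Y ≤ img M N := by
    rw [← hZ, Submodule.span_le]
    intro a ha
    refine ⟨σ a, hK₂N (hRK₂ _ (Finset.mem_image_of_mem _ ha)), hσ a⟩
  have horb : orb (conjRep M) P Y ≤ img M N := by
    refine orb_le _ _ hYN ?_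
    rintro h hh _ ⟨_, ⟨x, hx, rfl⟩, rfl⟩
    refine ⟨MulAut.conjNormal h x, ?_, (qq_conj M h x).symm⟩
    obtain ⟨k, hk, m, hm, rfl⟩ := Subgroup.mem_sup_of_normal_right.1 (hPK hh)
    have hkN : k ∈ N := hK₂N (hKK₂ hk)
    rw [MulAut.conjNormal_apply]
    have : k * m * (x : G) * (k * m)⁻¹ = k * (⁅m, (x : G)⁆ * x) * k⁻¹ := by
      rw [commutatorElement_def]; group
    rw [this]
    exact N.mul_mem (N.mul_mem hkN (N.mul_mem (hMN (Subgroup.commutator_mem_commutator hm x.2))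
      hx)) (N.inv_mem hkN)
  have hpre : ∀ x : M, qq M x ∈ orb (conjRep M) P Y → (x : G) ∈ N := by
    intro x hx
    obtain ⟨y, hy, hyx⟩ := horb hx
    have h1 := qq_eq M x y hyx.symm
    have : (x : G) = y * ((y : G)⁻¹ * x) := by group
    rw [this]
    exact N.mul_mem hy (hMN h1)
  have hconj : ∀ v : G, (∀ t ∈ T, v * t * v⁻¹ ∈ N) → ∀ x ∈ N, v * x * v⁻¹ ∈ N := by
    intro v hv
    have : N ≤ N.comap (MulAut.conj v).toMonoidHom := by
      refine sup_le ?_ ?_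
      · rw [hK₂, Subgroup.closure_le]
        intro t ht
        simp only [Finset.coe_union, Set.mem_union, Finset.mem_coe] at ht
        change v * t * v⁻¹ ∈ N
        rcases ht with ht | ht
        · exact hv t ht
        · have h1 := hpre (MulAut.conjNormal v ⟨t, hRM t ht⟩) (by
            rw [← qq_conj]
            refine hinv v ⟨_, le_orb _ _ _ ?_, rfl⟩
            simp only [R, Finset.mem_image] at ht
            obtain ⟨a, ha, rfl⟩ := ht
            change qq M (σ a) ∈ _
            rw [hσ, ← hZ]
            exact Submodule.subset_span ha)
          rwa [MulAut.conjNormal_apply] at h1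
      · intro t ht
        exact hMN (Subgroup.Normal.conj_mem inferInstance _ ht v)
    exact fun x hx => this hx
  have hu1 : ∀ x ∈ N, u * x * u⁻¹ ∈ N := by
    refine hconj u fun t ht => ?_
    obtain ⟨k, hk, h⟩ := hf t ht
    rw [← h]
    refine N.mul_mem (hK₂N (hKK₂ hk)) (hpre _ (le_orb _ _ _ (hXY (Submodule.subset_span ?_))))
    simp only [Finset.coe_union, Finset.coe_image]
    exact Or.inl ⟨t, ht, rfl⟩
  have hu2 : ∀ x ∈ N, u⁻¹ * x * u⁻¹⁻¹ ∈ N := by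
    refine hconj u⁻¹ fun t ht => ?_
    obtain ⟨k, hk, h⟩ := hf' t ht
    rw [← h]
    refine N.mul_mem (hK₂N (hKK₂ hk)) (hpre _ (le_orb _ _ _ (hXY (Submodule.subset_span ?_))))
    simp only [Finset.coe_union, Finset.coe_image]
    exact Or.inr ⟨t, ht, rfl⟩
  have hSN : S ⊆ N := fun s hs => hK₂N (hKK₂ (hSK hs))
  have hnorm : Subgroup.normalizer (N : Set G) = ⊤ := by
    rw [eq_top_iff, ← hSu, Subgroup.closure_le]
    intro v hv
    rcases hv with rfl | hv
    · rw [SetLike.mem_coe, Subgroup.mem_normalizer_iff]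
      refine fun x => ⟨hu1 x, fun hx => ?_⟩
      have := hu2 _ hx
      have h2 : v⁻¹ * (v * x * v⁻¹) * v⁻¹⁻¹ = x := by group
      rwa [h2] at this
    · exact Subgroup.le_normalizer (hSN hv)
  have hNn : N.Normal := Subgroup.normalizer_eq_top_iff.1 hnorm
  refine ⟨K₂, ⟨_, rfl⟩, fun s hs => hKK₂ (hSK hs), ?_, ?_⟩
  · rw [hK₂, Subgroup.closure_le]
    intro t ht
    simp only [Finset.coe_union, Set.mem_union, Finset.mem_coe] at ht
    rcases ht with ht | ht
    · exact hKP (Subgroup.subset_closure ht)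
    · exact hMP (hRM t ht)
  · rw [← hSP]
    exact Subgroup.normalClosure_le_normal hSN
end
end PRK
end

section
namespace PRK
universe u

section
variable {G : Type u} [Group G]

lemma lift_gen {Q : Type*} [Group Q] (f : G →* Q) (P : Subgroup G) (h : (P.map f).FG) :
    ∃ T : Finset G, (T : Set G) ⊆ P ∧ P ≤ Subgroup.closure (T : Set G) ⊔ f.ker := by
  classical
  obtain ⟨Z, hZ⟩ := h
  have h1 : ∀ z : Q, ∃ g : G, z ∈ Z → g ∈ P ∧ f g = z := by
    intro z
    by_cases hz : z ∈ Z
    · have : z ∈ P.map f := by rw [← hZ]; exact Subgroup.subset_closure hz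
      obtain ⟨g, hg, rfl⟩ := this
      exact ⟨g, fun _ => ⟨hg, rfl⟩⟩
    · exact ⟨1, fun h => absurd h hz⟩
  choose σ hσ using h1
  refine ⟨Z.image σ, ?_, ?_⟩
  · intro g hg
    simp only [Finset.coe_image, Set.mem_image] at hg
    obtain ⟨z, hz, rfl⟩ := hg
    exact (hσ z hz).1
  · rw [← Subgroup.comap_map_eq, ← Subgroup.map_le_iff_le_comap, ← hZ, Subgroup.closure_le]
    intro z hz
    refine ⟨σ z, Subgroup.subset_closure ?_, (hσ z hz).2⟩
    simp only [Finset.coe_image, Set.mem_image]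
    exact ⟨z, hz, rfl⟩

lemma fg_comm {A : Type*} [CommGroup A] (hA : Group.FG A) (H : Subgroup A) : H.FG := by
  have h1 : AddGroup.FG (Additive A) := GroupFG.iff_add_fg.1 hA
  have h2 : Module.Finite ℤ (Additive A) := Module.Finite.iff_addGroup_fg.2 h1
  have h3 : IsNoetherian ℤ (Additive A) := inferInstance
  rw [Subgroup.fg_iff_add_fg]
  have := h3.noetherian (AddSubgroup.toIntSubmodule (Subgroup.toAddSubgroup H))
  rw [Submodule.fg_iff_addSubgroup_fg] at this
  exact this

lemma start (hG : Group.FG G) (H P : Subgroup G) [H.Normal] [H.FiniteIndex]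
    (hP : commutator G ≤ P) :
    ∃ T : Finset G, (T : Set G) ⊆ P ∧ P ≤ Subgroup.closure (T : Set G) ⊔ (commutator G ⊓ H) := by
  classical
  have hab : Group.FG (Abelianization G) := Group.fg_of_surjective (f := Abelianization.of)
    QuotientGroup.mk_surjective
  obtain ⟨T₁, h1, h1'⟩ := lift_gen (Abelianization.of (G := G)) P (fg_comm hab _)
  rw [Abelianization.ker_of] at h1'
  have hfin : Finite (G ⧸ H) := inferInstance
  obtain ⟨T₂, h2, h2'⟩ := lift_gen (QuotientGroup.mk' H) (commutator G) (by
    have : Finite (Subgroup.map (QuotientGroup.mk' H) (commutator G)) := inferInstance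
    rw [← Group.fg_iff_subgroup_fg]
    infer_instance)
  rw [QuotientGroup.ker_mk'] at h2'
  refine ⟨T₁ ∪ T₂, ?_, ?_⟩
  · rw [Finset.coe_union]
    exact Set.union_subset h1 (h2.trans hP)
  · have hle : ∀ T : Finset G, T ⊆ T₁ ∪ T₂ → Subgroup.closure (T : Set G) ≤
      Subgroup.closure ((T₁ ∪ T₂ : Finset G) : Set G) ⊔ (commutator G ⊓ H) := fun T hT =>
      (Subgroup.closure_mono (Finset.coe_subset.2 hT)).trans le_sup_left
    refine h1'.trans (sup_le (hle _ Finset.subset_union_left) ?_)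
    intro g hg
    obtain ⟨k, hk, m, hm, rfl⟩ := Subgroup.mem_sup_of_normal_right.1 (h2' hg)
    have hk' : k ∈ commutator G := (Subgroup.closure_le _).2 h2 hk
    refine Subgroup.mul_mem _ (hle _ Finset.subset_union_right hk) (le_sup_right (a :=
      Subgroup.closure ((T₁ ∪ T₂ : Finset G) : Set G)) ?_)
    exact ⟨(Subgroup.mul_mem_cancel_left _ hk').1 hg, hm⟩

lemma exists_gen (χ : G →* Multiplicative ℤ) :
    ∃ u : G, χ.ker ⊔ Subgroup.zpowers u = ⊤ := by
  obtain ⟨⟨c, u, rfl⟩, hc⟩ := (inferInstance : IsCyclic χ.range).exists_generator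
  refine ⟨u, ?_⟩
  rw [eq_top_iff]
  intro g _
  obtain ⟨m, hm⟩ := Subgroup.mem_zpowers_iff.1 (hc ⟨χ g, g, rfl⟩)
  have hm' : χ u ^ m = χ g := congrArg Subtype.val hm
  have : g = (g * (u ^ m)⁻¹) * u ^ m := by group
  rw [this]
  refine Subgroup.mul_mem_sup ?_ (Subgroup.zpow_mem_zpowers u m)
  rw [MonoidHom.mem_ker, map_mul, map_inv, map_zpow, hm', mul_inv_cancel]

lemma exists_normal_gen (hG : Group.FG G) (χ : G →* Multiplicative ℤ) (u : G)
    (hu : χ.ker ⊔ Subgroup.zpowers u = ⊤) (hχ : χ ≠ 1) :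
    ∃ S : Finset G, Subgroup.normalClosure (S : Set G) = χ.ker ∧
      Subgroup.closure (insert u (S : Set G)) = ⊤ := by
  classical
  obtain ⟨T, hT⟩ := hG.out
  have h1 : ∀ g : G, ∃ p : G, χ p = 1 ∧ ∃ m : ℤ, g = p * u ^ m := by
    intro g
    have : g ∈ χ.ker ⊔ Subgroup.zpowers u := by rw [hu]; trivial
    obtain ⟨p, hp, m, hm, rfl⟩ := Subgroup.mem_sup_of_normal_left.1 this
    obtain ⟨m, rfl⟩ := hm
    exact ⟨p, hp, m, rfl⟩
  have hu1 : χ u ≠ 1 := by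
    intro h
    apply hχ
    ext g
    obtain ⟨p, hp, m, rfl⟩ := h1 g
    simp [hp, h]
  choose σ hσ μ hμ using h1
  have hgen : ∀ N : Subgroup G, u ∈ N → (∀ t ∈ T, σ t ∈ N) → N = ⊤ := by
    intro N huN hN
    rw [eq_top_iff, ← hT, Subgroup.closure_le]
    intro t ht
    rw [hμ t]
    exact N.mul_mem (hN t ht) (N.zpow_mem huN _)
  refine ⟨T.image σ, le_antisymm ?_ ?_, ?_⟩
  · refine Subgroup.normalClosure_le_normal ?_
    intro g hg
    simp only [Finset.coe_image, Set.mem_image] at hg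
    obtain ⟨t, ht, rfl⟩ := hg
    exact hσ t
  · intro g hg
    have h2 : Subgroup.normalClosure ((T.image σ : Finset G) : Set G) ⊔ Subgroup.zpowers u = ⊤ := by
      refine hgen _ (le_sup_right (a := Subgroup.normalClosure _)
        (Subgroup.mem_zpowers u)) fun t ht => ?_
      refine le_sup_left (b := Subgroup.zpowers u) (Subgroup.subset_normalClosure ?_)
      simp only [Finset.coe_image, Set.mem_image]
      exact ⟨t, ht, rfl⟩
    have h3 : g ∈ Subgroup.normalClosure ((T.image σ : Finset G) : Set G) ⊔ Subgroup.zpowers u := by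
      rw [h2]; trivial
    have hker : Subgroup.normalClosure ((T.image σ : Finset G) : Set G) ≤ χ.ker := by
      refine Subgroup.normalClosure_le_normal ?_
      intro g hg
      simp only [Finset.coe_image, Set.mem_image] at hg
      obtain ⟨t, ht, rfl⟩ := hg
      exact hσ t
    obtain ⟨p, hp, _, ⟨m, rfl⟩, rfl⟩ := Subgroup.mem_sup_of_normal_left.1 h3
    have h4 : χ u ^ m = 1 := by
      have h5 : χ p = 1 := hker hp
      have h6 : χ (p * u ^ m) = 1 := hg
      rwa [map_mul, map_zpow, h5, one_mul] at h6
    have h7 : m * (χ u).toAdd = 0 := by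
      have := congrArg Multiplicative.toAdd h4
      simpa using this
    have h8 : m = 0 := by
      rcases mul_eq_zero.1 h7 with h | h
      · exact h
      · exact absurd (Multiplicative.toAdd.injective h) hu1
    subst h8
    simpa using hp
  · refine hgen _ (Subgroup.subset_closure (Set.mem_insert _ _)) fun t ht => ?_
    refine Subgroup.subset_closure (Set.mem_insert_of_mem _ ?_)
    simp only [Finset.coe_image, Set.mem_image]
    exact ⟨t, ht, rfl⟩

lemma fin_idx (χ : G →* Multiplicative ℤ) (P : Subgroup G) (e : G) (he : e ∈ P) (h : χ e ≠ 1) :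
    (P ⊔ χ.ker).FiniteIndex := by
  rw [← Subgroup.comap_map_eq]
  have h1 : (P.map χ).FiniteIndex := by
    have hle : Subgroup.zpowers (χ e) ≤ P.map χ := by
      rw [Subgroup.zpowers_le]
      exact ⟨e, he, rfl⟩
    have : (Subgroup.zpowers (χ e)).FiniteIndex := by
      refine ⟨fun h0 => ?_⟩
      have h2 := Int.index_zmultiples (χ e).toAdd
      have h3 : (Subgroup.zpowers (χ e)).index =
        (AddSubgroup.zmultiples (χ e).toAdd).index := rfl
      rw [h3, h2, Int.natAbs_eq_zero] at h0
      exact h (Multiplicative.toAdd.injective h0)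
    exact Subgroup.finiteIndex_of_le hle
  refine ⟨?_⟩
  rw [Subgroup.index_comap]
  exact fun h0 => h1.index_ne_zero (Nat.eq_zero_of_zero_dvd
    (h0 ▸ Subgroup.relIndex_dvd_index_of_normal _ _))

lemma det_aux (x y : G →* Multiplicative ℤ) (k : ℕ) (g : G) :
    ((x * y ^ k) g).toAdd = (x g).toAdd + k * (y g).toAdd := by
  simp

theorem exists_fg_ker (hG : Group.FG G) (H : Subgroup G) (hH : H.FiniteIndex)
    (hsol : Group.IsSolvable H) {r : ℕ} (hr : ∀ H : Subgroup G, H.FG →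
    ∃ S : Finset G, S.card ≤ r ∧ Subgroup.closure (S : Set G) = H)
    (x y : G →* Multiplicative ℤ) (a b : G)
    (hD : (x a).toAdd * (y b).toAdd - (x b).toAdd * (y a).toAdd ≠ 0) :
    ∃ k : ℕ, (x * y ^ k).ker.FG := by
  classical
  let P : ℕ → Subgroup G := fun k => (x * y ^ k).ker
  have hPn : ∀ k, (P k).Normal := fun k => inferInstanceAs ((x * y ^ k).ker.Normal)
  have hPc : ∀ k, commutator G ≤ P k := fun k => Abelianization.commutator_subset_ker _
  have hPf : ∀ i j, i ≠ j → (P i ⊔ P j).FiniteIndex := by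
    intro i j hij
    refine fin_idx (x * y ^ j) (P i)
      (a ^ ((x * y ^ i) b).toAdd * b ^ (-((x * y ^ i) a).toAdd)) ?_ ?_
    · rw [MonoidHom.mem_ker]
      apply Multiplicative.toAdd.injective
      rw [map_mul, map_zpow, map_zpow, toAdd_mul, toAdd_zpow, toAdd_zpow, toAdd_one]
      simp only [smul_eq_mul]
      ring
    · intro h
      have h1 := congrArg Multiplicative.toAdd h
      rw [map_mul, map_zpow, map_zpow, toAdd_mul, toAdd_zpow, toAdd_zpow, toAdd_one] at h1
      simp only [smul_eq_mul, det_aux] at h1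
      have h2 : ((j : ℤ) - i) * ((x a).toAdd * (y b).toAdd - (x b).toAdd * (y a).toAdd) = 0 ∨
        ((i : ℤ) - j) * ((x a).toAdd * (y b).toAdd - (x b).toAdd * (y a).toAdd) = 0 := by
        first
        | (left; linear_combination h1)
        | (right; linear_combination h1)
      rcases h2 with h2 | h2 <;> rcases mul_eq_zero.1 h2 with h3 | h3
      · omega
      · exact hD h3
      · omega
      · exact hD h3
  have hPu : ∀ k, ∃ u, P k ⊔ Subgroup.zpowers u = ⊤ := fun k => exists_gen _
  have hne : ∀ k : ℕ, x * y ^ k ≠ 1 := by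
    intro k h
    have ha := det_aux x y k a
    have hb := det_aux x y k b
    rw [h] at ha hb
    simp only [MonoidHom.one_apply, toAdd_one] at ha hb
    apply hD
    linear_combination (y a).toAdd * hb - (y b).toAdd * ha
  obtain ⟨M, hM0, hMs⟩ : ∃ M : ℕ → Subgroup G, M 0 = commutator G ⊓ H.normalCore ∧
      ∀ i, M (i + 1) = ⁅M i, M i⁆ :=
    ⟨fun i => Nat.rec (commutator G ⊓ H.normalCore) (fun _ N => ⁅N, N⁆) i, rfl, fun _ => rfl⟩
  have hMn : ∀ i, (M i).Normal := by
    intro i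
    induction i with
    | zero => rw [hM0]; infer_instance
    | succ i ih =>
      rw [hMs]; exact @Subgroup.commutator_normal G _ (M i) (M i) ih ih
  have hMc : ∀ i, M i ≤ commutator G := by
    intro i
    induction i with
    | zero => rw [hM0]; exact inf_le_left
    | succ i ih =>
      have := hMn i
      rw [hMs]; exact (@Subgroup.commutator_le_left G _ (M i) (M i) (hMn i)).trans ih
  have hMd : ∀ i, M i ≤ (derivedSeries H i).map H.subtype := by
    intro i
    induction i with
    | zero =>
      intro g hg
      rw [hM0] at hg
      have : g ∈ H := H.normalCore_le hg.2
      exact ⟨⟨g, this⟩, by simp, rfl⟩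
    | succ i ih =>
      rw [hMs, derivedSeries_succ, Subgroup.map_commutator]
      exact Subgroup.commutator_mono ih ih
  obtain ⟨d, hd⟩ := (Group.isSolvable_def H).1 hsol
  have hMd0 : M d = ⊥ := by
    have := hMd d
    rw [hd, Subgroup.map_bot] at this
    exact le_bot_iff.1 this
  have hbad : (⋃ i ∈ Finset.range d, {k | ¬ Good (@conjRep G _ (M i) (hMn i)) (P k)}).Finite := by
    refine Set.Finite.biUnion (Finset.finite_toSet _) fun i _ => ?_
    have := hMn i
    exact good_module hG P hPn hPf hPu _ _ (pr_ab hr (M i))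
  obtain ⟨k, hk⟩ := hbad.infinite_compl.nonempty
  refine ⟨k, ?_⟩
  change (P k).FG
  have hgood : ∀ i < d, Good (@conjRep G _ (M i) (hMn i)) (P k) := by
    intro i hi
    by_contra hcon
    exact hk (Set.mem_biUnion (Finset.mem_coe.2 (Finset.mem_range.2 hi)) hcon)
  obtain ⟨u, hu⟩ := hPu k
  obtain ⟨S, hS, hSu⟩ := exists_normal_gen hG _ u hu (hne k)
  have hPkn := hPn k
  have key : ∀ i ≤ d, ∃ K : Subgroup G, K.FG ∧ (S : Set G) ⊆ K ∧ K ≤ P k ∧ P k ≤ K ⊔ M i := by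
    intro i
    induction i with
    | zero =>
      intro _
      have : H.normalCore.FiniteIndex := inferInstance
      obtain ⟨T, hT, hT'⟩ := start hG H.normalCore (P k) (hPc k)
      refine ⟨Subgroup.closure ((S ∪ T : Finset G) : Set G), ⟨_, rfl⟩, ?_, ?_, ?_⟩
      · exact (Finset.coe_subset.2 Finset.subset_union_left).trans Subgroup.subset_closure
      · rw [Subgroup.closure_le, Finset.coe_union]
        refine Set.union_subset ?_ hT
        intro s hs
        change s ∈ (x * y ^ k).ker
        rw [← hS]
        exact Subgroup.subset_normalClosure hs
      · rw [hM0]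
        refine hT'.trans (sup_le_sup_right (Subgroup.closure_mono ?_) _)
        exact Finset.coe_subset.2 Finset.subset_union_right
    | succ i ih =>
      intro hi
      obtain ⟨K, h1, h2, h3, h4⟩ := ih (by omega)
      have := hMn i
      rw [hMs]
      exact step (M i) (P k) ((hMc i).trans (hPc k)) u (hgood i (by omega)) S hS hSu K h1 h2 h3 h4
  obtain ⟨K, h1, h2, h3, h4⟩ := key d le_rfl
  rw [hMd0, sup_bot_eq] at h4
  rw [le_antisymm h4 h3]
  exact h1
end
end PRK
end

section
namespace PRK
universe u

section
variable {G : Type u} [Group G]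

/-- Preimage in `G` of a submodule of the abelianization. -/
def cB (B : Submodule ℤ (Additive (Abelianization G))) : Subgroup G where
  carrier := {g | Additive.ofMul (Abelianization.of g) ∈ B}
  one_mem' := B.zero_mem
  mul_mem' := fun ha hb => B.add_mem ha hb
  inv_mem' := fun ha => B.neg_mem ha

lemma mem_cB (B : Submodule ℤ (Additive (Abelianization G))) (g : G) :
    g ∈ cB B ↔ Additive.ofMul (Abelianization.of g) ∈ B := Iff.rfl

lemma comm_le_cB (B : Submodule ℤ (Additive (Abelianization G))) : commutator G ≤ cB B := by
  intro g hg
  rw [← Abelianization.ker_of, MonoidHom.mem_ker] at hg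
  rw [mem_cB, hg]
  exact B.zero_mem

lemma cB_normal (B : Submodule ℤ (Additive (Abelianization G))) : (cB B).Normal := by
  refine ⟨fun n hn g => ?_⟩
  rw [mem_cB] at hn ⊢
  have : Abelianization.of (g * n * g⁻¹) = Abelianization.of n := by
    rw [map_mul, map_mul, map_inv, mul_comm, inv_mul_cancel_left]
  rwa [this]

lemma finrank_quot (B : Submodule ℤ (Additive (Abelianization G))) [hn : (cB B).Normal] :
    Module.finrank ℤ (Additive (Abelianization (G ⧸ cB B))) =
      Module.finrank ℤ (Additive (Abelianization G) ⧸ B) := by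
  let F : Additive (Abelianization G) →ₗ[ℤ] Additive (Abelianization (G ⧸ cB B)) :=
    (MonoidHom.toAdditive (Abelianization.map (QuotientGroup.mk' (cB B)))).toIntLinearMap
  have hF : ∀ g : G, F (Additive.ofMul (Abelianization.of g)) =
    Additive.ofMul (Abelianization.of (QuotientGroup.mk' (cB B) g)) := fun g => rfl
  have hsurj : Function.Surjective F := by
    intro x
    induction x using Additive.rec with | ofMul x => ?_
    obtain ⟨x, rfl⟩ := QuotientGroup.mk_surjective x
    obtain ⟨x, rfl⟩ := QuotientGroup.mk_surjective x
    exact ⟨_, hF x⟩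
  have hker : LinearMap.ker F = B := by
    ext x
    induction x using Additive.rec with | ofMul x => ?_
    obtain ⟨x, rfl⟩ := QuotientGroup.mk_surjective x
    rw [LinearMap.mem_ker]
    change F (Additive.ofMul (Abelianization.of x)) = 0 ↔ Additive.ofMul (Abelianization.of x) ∈ B
    rw [hF, ← mem_cB]
    constructor
    · intro h
      have h1 : Abelianization.of (QuotientGroup.mk' (cB B) x) = 1 := h
      rw [← MonoidHom.mem_ker, Abelianization.ker_of, commutator_def,
        ← Subgroup.map_top_of_surjective _ (QuotientGroup.mk'_surjective (cB B)),
        ← Subgroup.map_commutator, ← commutator_def] at h1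
      obtain ⟨c, hc, hcx⟩ := h1
      have h2 := comm_le_cB B hc
      have h3 : c⁻¹ * x ∈ cB B := QuotientGroup.eq.1 hcx
      exact ((cB B).mul_mem_cancel_left ((cB B).inv_mem h2)).1 h3
    · intro h
      have : QuotientGroup.mk' (cB B) x = 1 := (QuotientGroup.eq_one_iff x).2 h
      rw [this, map_one]
      rfl
  exact (F.quotKerEquivOfSurjective hsurj).finrank_eq.symm.trans
    (Submodule.quotEquivOfEq _ _ hker).finrank_eq

lemma fg_map {Q : Type*} [Group Q] (f : G →* Q) {H : Subgroup G} (h : H.FG) : (H.map f).FG := by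
  classical
  obtain ⟨S, rfl⟩ := h
  exact ⟨S.image f, by rw [MonoidHom.map_closure, Finset.coe_image]⟩

lemma pr_sub {r : ℕ} (hr : ∀ H : Subgroup G, H.FG →
    ∃ S : Finset G, S.card ≤ r ∧ Subgroup.closure (S : Set G) = H) (K : Subgroup G)
    (H : Subgroup K) (hH : H.FG) :
    ∃ S : Finset K, S.card ≤ r ∧ Subgroup.closure (S : Set K) = H := by
  classical
  obtain ⟨S, hS, hSH⟩ := hr (H.map K.subtype) (fg_map K.subtype hH)
  have hSK : ∀ s ∈ S, s ∈ K := by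
    intro s hs
    have : s ∈ H.map K.subtype := by rw [← hSH]; exact Subgroup.subset_closure hs
    obtain ⟨k, _, rfl⟩ := this
    exact k.2
  let F : S → K := fun s => ⟨s.1, hSK s.1 s.2⟩
  refine ⟨S.attach.image F, Finset.card_image_le.trans (by simpa using hS), ?_⟩
  apply Subgroup.map_injective K.subtype_injective
  rw [MonoidHom.map_closure, ← hSH]
  congr 1
  ext g
  simp only [Finset.coe_image, Set.mem_image, Finset.coe_attach, Set.mem_univ, true_and,
    Finset.mem_coe]
  constructor
  · rintro ⟨_, ⟨s, rfl⟩, rfl⟩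
    exact s.2
  · intro hg
    exact ⟨_, ⟨⟨g, hg⟩, rfl⟩, rfl⟩

lemma exists_two {B : Type*} [AddCommGroup B] [Module.Finite ℤ B] (h : 2 ≤ Module.finrank ℤ B) :
    ∃ (x y : B →ₗ[ℤ] ℤ) (a b : B), x a = 1 ∧ y a = 0 ∧ x b = 0 ∧ y b = 1 := by
  let T := Submodule.torsion ℤ B
  have h1 : Module.finrank ℤ (B ⧸ T) = Module.finrank ℤ B := by
    have h2 := Submodule.finrank_quotient_add_finrank T
    have h3 : Module.finrank ℤ T = 0 := by
      rw [Module.finrank_eq_zero_iff]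
      rintro ⟨t, ht⟩
      obtain ⟨c, hc⟩ := (Submodule.mem_torsion_iff t).1 ht
      exact ⟨c, nonZeroDivisors.coe_ne_zero c, Subtype.ext hc⟩
    omega
  have hfree : Module.Free ℤ (B ⧸ T) := inferInstance
  let β := Module.finBasis ℤ (B ⧸ T)
  let i : Fin (Module.finrank ℤ (B ⧸ T)) := ⟨0, by omega⟩
  let j : Fin (Module.finrank ℤ (B ⧸ T)) := ⟨1, by omega⟩
  have hij : i ≠ j := by
    intro h
    have := congrArg Fin.val h
    simp [i, j] at this
  obtain ⟨a, ha⟩ := T.mkQ_surjective (β i)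
  obtain ⟨b, hb⟩ := T.mkQ_surjective (β j)
  refine ⟨(β.coord i).comp T.mkQ, (β.coord j).comp T.mkQ, a, b, ?_, ?_, ?_, ?_⟩
  · rw [LinearMap.comp_apply, ha]; simp
  · rw [LinearMap.comp_apply, ha]; simp [hij]
  · rw [LinearMap.comp_apply, hb]; simp [hij.symm]
  · rw [LinearMap.comp_apply, hb]; simp

/-- A linear functional on `B`, as a homomorphism from the preimage of `B`. -/
def toHom (B : Submodule ℤ (Additive (Abelianization G))) (x : B →ₗ[ℤ] ℤ) :
    cB B →* Multiplicative ℤ where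
  toFun g := Multiplicative.ofAdd (x ⟨Additive.ofMul (Abelianization.of (g : G)), g.2⟩)
  map_one' := by
    rw [← ofAdd_zero, ← map_zero x]
    rfl
  map_mul' g h := by
    rw [← ofAdd_add, ← map_add x]
    rfl

lemma lower (H : Subgroup G) (hH : H.FiniteIndex)
    (hsol : Group.IsSolvable H) {r : ℕ} (hr : ∀ H : Subgroup G, H.FG →
    ∃ S : Finset G, S.card ≤ r ∧ Subgroup.closure (S : Set G) = H)
    [Module.Finite ℤ (Additive (Abelianization G))]
    (B : Submodule ℤ (Additive (Abelianization G))) (hB : (cB B).FG)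
    (h2 : 2 ≤ Module.finrank ℤ B) :
    ∃ B' : Submodule ℤ (Additive (Abelianization G)), (cB B').FG ∧
      Module.finrank ℤ B' = Module.finrank ℤ B - 1 := by
  obtain ⟨x, y, a, b, hxa, hya, hxb, hyb⟩ := exists_two h2
  have hlift : ∀ a : B, ∃ g : cB B, (⟨Additive.ofMul (Abelianization.of (g : G)), g.2⟩ : B) = a := by
    rintro ⟨a, ha⟩
    induction a using Additive.rec with | ofMul a => ?_
    obtain ⟨g, rfl⟩ := QuotientGroup.mk_surjective a
    exact ⟨⟨g, ha⟩, rfl⟩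
  obtain ⟨ga, hga⟩ := hlift a
  obtain ⟨gb, hgb⟩ := hlift b
  have hval : ∀ (z : B →ₗ[ℤ] ℤ) (g : cB B), (toHom B z g).toAdd =
    z ⟨Additive.ofMul (Abelianization.of (g : G)), g.2⟩ := fun z g => rfl
  have hsol' : Group.IsSolvable (H.subgroupOf (cB B)) := by
    let f : H.subgroupOf (cB B) →* H :=
      { toFun := fun g => ⟨g.1.1, g.2⟩
        map_one' := rfl
        map_mul' := fun _ _ => rfl }
    refine Group.isSolvable_of_isSolvable_injective (f := f) ?_
    intro g h hgh
    exact Subtype.ext (Subtype.ext (congrArg (fun t : H => (t : G)) hgh))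
  obtain ⟨k, hk⟩ := exists_fg_ker (G := cB B) ((Group.fg_iff_subgroup_fg _).2 hB)
    (H.subgroupOf (cB B)) inferInstance hsol' (pr_sub hr (cB B)) (toHom B x) (toHom B y) ga gb (by
      rw [hval, hval, hval, hval, hga, hgb, hxa, hya, hxb, hyb]; norm_num)
  let z : B →ₗ[ℤ] ℤ := x + (k : ℤ) • y
  have hz : ∀ g : cB B, g ∈ (toHom B x * toHom B y ^ k).ker ↔
      z ⟨Additive.ofMul (Abelianization.of (g : G)), g.2⟩ = 0 := by
    intro g
    rw [MonoidHom.mem_ker, ← Multiplicative.toAdd.injective.eq_iff, det_aux, hval, hval, toAdd_one]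
    simp [z]
  refine ⟨(LinearMap.ker z).map B.subtype, ?_, ?_⟩
  · have : cB ((LinearMap.ker z).map B.subtype) =
      (toHom B x * toHom B y ^ k).ker.map (cB B).subtype := by
      ext g
      constructor
      · rintro ⟨⟨c, hc⟩, hc', h⟩
        have h' : c = Additive.ofMul (Abelianization.of g) := h
        subst h'
        exact ⟨⟨g, hc⟩, (hz _).2 hc', rfl⟩
      · rintro ⟨g, hg, rfl⟩
        exact ⟨_, (hz _).1 hg, rfl⟩
    rw [this]
    exact fg_map _ hk
  · rw [Submodule.finrank_map_subtype_eq]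
    have h3 := Submodule.finrank_quotient_add_finrank (LinearMap.ker z)
    rw [z.quotKerEquivRange.finrank_eq] at h3
    have h4 : LinearMap.range z = ⊤ := by
      rw [LinearMap.range_eq_top]
      intro c
      refine ⟨c • a, ?_⟩
      simp [z, hxa, hya]
    rw [h4, finrank_top, Module.finrank_self] at h3
    omega

lemma iter (hG : Group.FG G) (H : Subgroup G) (hH : H.FiniteIndex)
    (hsol : Group.IsSolvable H) {r : ℕ} (hr : ∀ H : Subgroup G, H.FG →
    ∃ S : Finset G, S.card ≤ r ∧ Subgroup.closure (S : Set G) = H)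
    [Module.Finite ℤ (Additive (Abelianization G))] (m : ℕ)
    (hm : m + 1 ≤ Module.finrank ℤ (Additive (Abelianization G))) :
    ∃ B : Submodule ℤ (Additive (Abelianization G)), (cB B).FG ∧
      Module.finrank ℤ B = Module.finrank ℤ (Additive (Abelianization G)) - m := by
  induction m with
  | zero =>
    refine ⟨⊤, ?_, by simp⟩
    have : cB (⊤ : Submodule ℤ (Additive (Abelianization G))) = ⊤ := by
      ext g; simp [mem_cB]
    rw [this]
    exact hG.out
  | succ m ih =>
    obtain ⟨B, h1, h2⟩ := ih (by omega)
    obtain ⟨B', h3, h4⟩ := lower H hH hsol hr B h1 (by omega)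
    exact ⟨B', h3, by omega⟩

theorem final (hG : Group.FG G) (H : Subgroup G) (hH : H.FiniteIndex)
    (hsol : Group.IsSolvable H) {r : ℕ} (hr : ∀ H : Subgroup G, H.FG →
    ∃ S : Finset G, S.card ≤ r ∧ Subgroup.closure (S : Set G) = H)
    (hn : 1 ≤ Module.finrank ℤ (Additive (Abelianization G))) :
    ∃ (K : Subgroup G) (_ : K.Normal), commutator G ≤ K ∧ K.FG ∧
      Module.finrank ℤ (Additive (Abelianization (G ⧸ K))) =
        Module.finrank ℤ (Additive (Abelianization G)) - 1 := by
  have hab : Group.FG (Abelianization G) := Group.fg_of_surjective (f := Abelianization.of)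
    QuotientGroup.mk_surjective
  have hfin : Module.Finite ℤ (Additive (Abelianization G)) :=
    Module.Finite.iff_addGroup_fg.2 (GroupFG.iff_add_fg.1 hab)
  obtain ⟨B, h1, h2⟩ := iter hG H hH hsol hr
    (Module.finrank ℤ (Additive (Abelianization G)) - 1) (by omega)
  refine ⟨cB B, cB_normal B, comm_le_cB B, h1, ?_⟩
  have := cB_normal B
  rw [finrank_quot]
  have h3 := Submodule.finrank_quotient_add_finrank B
  omega
end
end PRK
end

/-- If `G` is finitely presented, virtually solvable, of finite Prüfer rank, and
`n = rk G/G' ≥ 1`, then there is a finitely generated subgroup `G' ≤ K ≤ G` of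
co-rank `n − 1`. -/
theorem exists_fg_subgroup_corank_pred_of_prufer {G : Type*} [Group G]
    (hfp : FinitelyPresentedGroup G)
    (hvs : ∃ H : Subgroup G, H.FiniteIndex ∧ IsSolvable ↥H)
    (hpr : FinitePruferRank G)
    (n : ℕ) (hn : rkAb G = n) (hn1 : 1 ≤ n) :
    ∃ (K : Subgroup G) (hKn : K.Normal),
      commutator G ≤ K ∧ K.FG ∧ rkQuot K hKn = n - 1 := by
  obtain ⟨N, f, _, hf, _⟩ := hfp
  obtain ⟨H, hH, hsol⟩ := hvs
  obtain ⟨r, hr⟩ := hpr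
  have hG : Group.FG G := Group.fg_of_surjective (f := f) hf
  subst hn
  obtain ⟨K, hK, h1, h2, h3⟩ := PRK.final hG H hH hsol hr hn1
  exact ⟨K, hK, h1, h2, h3⟩
end

section
/- Let F be the free group on two generators a, b, let u and v be distinct elements of the submonoid of F generated by {a, b} (positive words) such that the exponent sum of a in u equals that in v and the exponent sum of b in u equals that in v, and let G = ⟨a, b | u = v⟩ be the corresponding one-relator group. Then there exists an automorphism μ of G/G' such that the twisted G'-fibre product H_μ = {(g₁,g₂) ∈ G × G : μ(g₁G') = g₂G'} is finitely presented. -/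
/-- The fibre product associated to an isomorphism `μ : G₁⧸N₁ ≃* G₂⧸N₂`. -/
def fibreProduct {G₁ G₂ : Type*} [Group G₁] [Group G₂]
    (N₁ : Subgroup G₁) (N₂ : Subgroup G₂) [N₁.Normal] [N₂.Normal]
    (μ : (G₁ ⧸ N₁) ≃* (G₂ ⧸ N₂)) : Subgroup (G₁ × G₂) where
  carrier := {p | μ (QuotientGroup.mk p.1) = QuotientGroup.mk p.2}
  one_mem' := by simp
  mul_mem' := by
    intro a b ha hb
    simp only [Set.mem_setOf_eq] at *
    rw [Prod.fst_mul, Prod.snd_mul, QuotientGroup.mk_mul, QuotientGroup.mk_mul, map_mul, ha, hb]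
  inv_mem' := by
    intro a ha
    simp only [Set.mem_setOf_eq] at *
    rw [Prod.fst_inv, Prod.snd_inv, QuotientGroup.mk_inv, QuotientGroup.mk_inv, map_inv, ha]

/-- The exponent-sum homomorphism `FreeGroup (Fin 2) → ℤ` of the generator `i₀`. -/
def expSum (i₀ : Fin 2) : FreeGroup (Fin 2) →* Multiplicative ℤ :=
  FreeGroup.lift (fun i => if i = i₀ then Multiplicative.ofAdd (1 : ℤ) else 1)

abbrev F2 := FreeGroup (Fin 2)

def gX : F2 := FreeGroup.of 0
def gY : F2 := FreeGroup.of 1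

/-- Product of the blocks `x` (for `false`) and `x * x * y` (for `true`). -/
def blk {G : Type*} [Group G] (x y : G) (l : List Bool) : G :=
  (l.map (fun b => if b then x * x * y else x)).prod

lemma blk_cons {G : Type*} [Group G] (x y : G) (b : Bool) (l : List Bool) :
    blk x y (b :: l) = (if b then x * x * y else x) * blk x y l := by
  simp [blk]

lemma blk_nil {G : Type*} [Group G] (x y : G) : blk x y [] = 1 := by
  simp [blk]

lemma norm_blk {x y : F2} (hx : x.norm ≤ 1) (hy : y.norm ≤ 1) (l : List Bool) :
    (blk x y l).norm ≤ 3 * l.length := by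
  induction l with
  | nil => simp [blk_nil]
  | cons b l ih =>
    rw [blk_cons, List.length_cons]
    refine (FreeGroup.norm_mul_le _ _).trans ?_
    have : (if b then x * x * y else x).norm ≤ 3 := by
      split
      · have h1 := FreeGroup.norm_mul_le (x * x) y
        have h2 := FreeGroup.norm_mul_le x x
        omega
      · omega
    omega

lemma fnorm_pow_le {x : F2} (hx : x.norm ≤ 1) (n : ℕ) : (x ^ n).norm ≤ n := by
  induction n with
  | zero => simp
  | succ n ih =>
    rw [pow_succ]
    have := FreeGroup.norm_mul_le (x ^ n) x
    omega

lemma walk_flip {D : Set F2} {x y : F2} (hx : x.norm ≤ 1) (hy : y.norm ≤ 1)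
    (hM : ∀ pre suf, pre * x⁻¹ ∈ D → pre * y ∈ D → x⁻¹ * suf ∈ D → y * suf ∈ D →
      pre * y * x⁻¹ * suf ∈ D → pre * x⁻¹ * y * suf ∈ D)
    (L : ℕ) (hshort : ∀ g : F2, g.norm ≤ L → g ∈ D) (h : F2) (i : ℕ)
    (hA : ∀ k ≤ i, h * x⁻¹ ^ k ∈ D) (hB : ∀ k ≤ i, h * y * x⁻¹ ^ k ∈ D) :
    ∀ (i1 i2 : ℕ) (q : F2), i1 + i2 ≤ i → q.norm + i + 2 ≤ L →
      h * y * x⁻¹ ^ (i1 + i2) * q ∈ D → h * x⁻¹ ^ i1 * y * x⁻¹ ^ i2 * q ∈ D := by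
  have hx' : (x⁻¹).norm ≤ 1 := by rwa [FreeGroup.norm_inv_eq]
  intro i1
  induction i1 with
  | zero => intro i2 q _ _ h1; simpa using h1
  | succ i1 ih =>
    intro i2 q hi hq h1
    have key := hM (h * x⁻¹ ^ i1) (x⁻¹ ^ i2 * q) ?_ ?_ ?_ ?_ ?_
    · simpa [pow_succ, mul_assoc] using key
    · simpa [pow_succ, mul_assoc] using hA (i1 + 1) (by omega)
    · have := ih 0 1 (by omega) (by simp; omega) (by simpa using hB i1 (by omega))
      simpa using this
    · apply hshort
      have h2 := fnorm_pow_le hx' i2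
      have h3 := FreeGroup.norm_mul_le (x⁻¹ ^ i2) q
      have h4 := FreeGroup.norm_mul_le x⁻¹ (x⁻¹ ^ i2 * q)
      omega
    · apply hshort
      have h2 := fnorm_pow_le hx' i2
      have h3 := FreeGroup.norm_mul_le (x⁻¹ ^ i2) q
      have h4 := FreeGroup.norm_mul_le y (x⁻¹ ^ i2 * q)
      omega
    · have := ih (i2 + 1) q (by omega) hq (by rwa [show i1 + (i2 + 1) = i1 + 1 + i2 by ring])
      rw [pow_succ'] at this
      simpa [mul_assoc] using this

lemma good_norm (R K a b : ℕ) (y0 : ℤ) (h1 : 2 * R + 1 ≤ (K : ℤ)) (h2 : 2 * R + 1 ≤ 2 * (K : ℤ) - y0)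
    (ha : 1 ≤ a) (haR : a ≤ R) (hab : 2 * b ≤ a) :
    ((K : ℤ) - a) ^ 2 + (y0 + b) ^ 2 < (K : ℤ) ^ 2 + y0 ^ 2 := by
  have ha' : (1 : ℤ) ≤ a := by exact_mod_cast ha
  have haR' : (a : ℤ) ≤ R := by exact_mod_cast haR
  have hab' : 2 * (b : ℤ) ≤ a := by exact_mod_cast hab
  have hb : (0 : ℤ) ≤ b := by positivity
  have e1 : (K : ℤ) * (a - 2 * b) ≥ (2 * R + 1) * (a - 2 * b) :=
    mul_le_mul_of_nonneg_right h1 (by linarith)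
  have e2 : (2 * (K : ℤ) - y0) * b ≥ (2 * R + 1) * b := mul_le_mul_of_nonneg_right h2 hb
  have e3 : (a : ℤ) * a ≤ R * a := mul_le_mul_of_nonneg_right haR' (by linarith)
  have e4 : (b : ℤ) * b ≤ a * a := by nlinarith
  have e5 : (2 * (R : ℤ) + 1) * (2 * b) ≤ (2 * R + 1) * a :=
    mul_le_mul_of_nonneg_left hab' (by linarith)
  nlinarith

lemma walk {D : Set F2} {x y : F2} (hx : x.norm ≤ 1) (hy : y.norm ≤ 1)
    (hM : ∀ pre suf, pre * x⁻¹ ∈ D → pre * y ∈ D → x⁻¹ * suf ∈ D → y * suf ∈ D →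
      pre * y * x⁻¹ * suf ∈ D → pre * x⁻¹ * y * suf ∈ D)
    (L R : ℕ) (hL : 3 * R + 2 ≤ L) (hshort : ∀ g : F2, g.norm ≤ L → g ∈ D)
    (m : ℕ) (y0 : ℤ) (h1 : 2 * R + 1 ≤ ((m + R : ℕ) : ℤ))
    (h2 : 2 * R + 1 ≤ 2 * ((m + R : ℕ) : ℤ) - y0)
    (hIH : ∀ (m' i : ℕ) (j : ℤ), ((m' + i : ℕ) : ℤ) ^ 2 + j ^ 2 < ((m + R : ℕ) : ℤ) ^ 2 + y0 ^ 2 →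
      x⁻¹ ^ m' * y ^ j * x⁻¹ ^ i ∈ D) :
    ∀ (l : List Bool) (i b : ℕ), 2 * l.length ≤ i → i ≤ R → 2 * b ≤ R - i → (l ≠ [] ∨ i < R) →
      x⁻¹ ^ m * y ^ (y0 + b) * x⁻¹ ^ i * blk x y l ∈ D := by
  have good : ∀ (i b : ℕ), i < R → 2 * b ≤ R - i → x⁻¹ ^ m * y ^ (y0 + b) * x⁻¹ ^ i ∈ D := by
    intro i b hi hb
    apply hIH
    have := good_norm R (m + R) (R - i) b y0 h1 h2 (by omega) (by omega) hb
    have e : ((m + R : ℕ) : ℤ) - ((R - i : ℕ) : ℤ) = ((m + i : ℕ) : ℤ) := by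
      rw [Nat.cast_sub hi.le]; push_cast; ring
    rwa [e] at this
  intro l
  induction l with
  | nil =>
    intro i b _ hi hb hne
    rw [blk_nil, mul_one]
    exact good i b (by simpa using hne) hb
  | cons c l ih =>
    intro i b hl hi hb _
    rw [List.length_cons] at hl
    rw [blk_cons]
    cases c with
    | false =>
      obtain ⟨i, rfl⟩ : ∃ i', i = i' + 1 := ⟨i - 1, by omega⟩
      have := ih i b (by omega) (by omega) (by omega) (Or.inr (by omega))
      rw [pow_succ]
      simpa [mul_assoc] using this
    | true =>
      obtain ⟨i, rfl⟩ : ∃ i', i = i' + 2 := ⟨i - 2, by omega⟩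
      have h3 := ih i (b + 1) (by omega) (by omega) (by omega) (Or.inr (by omega))
      have hn := norm_blk hx hy l
      have e : x⁻¹ ^ m * y ^ (y0 + (b + 1 : ℕ)) = x⁻¹ ^ m * y ^ (y0 + b) * y := by
        rw [mul_assoc, ← zpow_add_one]; push_cast; rw [add_assoc]
      have := walk_flip hx hy hM L hshort (x⁻¹ ^ m * y ^ (y0 + b)) i
        (fun k hk => good k b (by omega) (by omega))
        (fun k hk => by
          have := good k (b + 1) (by omega) (by omega)
          rwa [e] at this) i 0 (blk x y l) (by omega) (by omega) (by rwa [e] at h3)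
      rw [pow_succ, pow_succ]
      simpa [mul_assoc] using this

lemma push_step {D : Set F2} {x y : F2} (hx : x.norm ≤ 1) (hy : y.norm ≤ 1)
    (hM : ∀ pre suf, pre * x⁻¹ ∈ D → pre * y ∈ D → x⁻¹ * suf ∈ D → y * suf ∈ D →
      pre * y * x⁻¹ * suf ∈ D → pre * x⁻¹ * y * suf ∈ D)
    (L R : ℕ) (hL : 3 * R + 2 ≤ L) (hshort : ∀ g : F2, g.norm ≤ L → g ∈ D)
    (T : Set (List Bool)) (hT : ∀ l ∈ T, l ≠ [] ∧ 2 * l.length ≤ R)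
    (hpush : ∀ g, (∀ l ∈ T, g * blk x y l ∈ D) → g ∈ D)
    (m : ℕ) (y0 : ℤ) (h1 : 2 * R + 1 ≤ ((m + R : ℕ) : ℤ))
    (h2 : 2 * R + 1 ≤ 2 * ((m + R : ℕ) : ℤ) - y0)
    (hIH : ∀ (m' i : ℕ) (j : ℤ), ((m' + i : ℕ) : ℤ) ^ 2 + j ^ 2 < ((m + R : ℕ) : ℤ) ^ 2 + y0 ^ 2 →
      x⁻¹ ^ m' * y ^ j * x⁻¹ ^ i ∈ D) :
    x⁻¹ ^ m * y ^ y0 * x⁻¹ ^ R ∈ D := by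
  apply hpush
  intro l hl
  obtain ⟨h3, h4⟩ := hT l hl
  have := walk hx hy hM L R hL hshort m y0 h1 h2 hIH l R 0 h4 le_rfl
    (by omega) (Or.inl h3)
  simpa using this

lemma mk_append2 (l1 l2 : List (Fin 2 × Bool)) :
    (FreeGroup.mk (l1 ++ l2) : F2) = FreeGroup.mk l1 * FreeGroup.mk l2 := FreeGroup.mul_mk.symm

lemma mk_cons2 (a : Fin 2 × Bool) (l : List (Fin 2 × Bool)) :
    (FreeGroup.mk (a :: l) : F2) = FreeGroup.mk [a] * FreeGroup.mk l := by
  rw [← mk_append2]; rfl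

lemma mk_lX : (FreeGroup.mk [((0 : Fin 2), true)] : F2) = gX := rfl
lemma mk_lY : (FreeGroup.mk [((1 : Fin 2), true)] : F2) = gY := rfl
lemma mk_lX' : (FreeGroup.mk [((0 : Fin 2), false)] : F2) = gX⁻¹ := rfl
lemma mk_lY' : (FreeGroup.mk [((1 : Fin 2), false)] : F2) = gY⁻¹ := rfl

def gc : F2 := gX * gY * gX⁻¹ * gY⁻¹

structure Rules (D : Set F2) : Prop where
  mid : ∀ g1 ∈ D, ∀ g2 ∈ D, (g1 * gc * g2 ∈ D ↔ g1 * g2 ∈ D)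
  left : ∀ g, (gc * g ∈ D ↔ g ∈ D)
  right : ∀ g, (g * gc ∈ D ↔ g ∈ D)

lemma letter_cases (a : Fin 2 × Bool) :
    a = (0, true) ∨ a = (0, false) ∨ a = (1, true) ∨ a = (1, false) := by
  revert a; decide

lemma Rules.mid_eq {D : Set F2} (hD : Rules D) {g1 g2 : F2} (h1 : g1 ∈ D) (h2 : g2 ∈ D)
    (p q : F2) (hp : p = g1 * gc * g2) (hq : q = g1 * g2) : p ∈ D ↔ q ∈ D := by
  subst hp hq; exact hD.mid _ h1 _ h2

lemma Rules.mid_inv {D : Set F2} (hD : Rules D) {g1 g2 : F2} (h1 : g1 ∈ D) (h2 : g2 ∈ D)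
    (p q : F2) (hp : p = g1 * gc⁻¹ * g2) (hq : q = g1 * g2) : p ∈ D ↔ q ∈ D := by
  have h3 : g1 * gc⁻¹ ∈ D := by rw [← hD.right]; simpa using h1
  have := hD.mid _ h3 _ h2
  subst hp hq
  simpa using this.symm

lemma Rules.left_eq {D : Set F2} (hD : Rules D) (p q : F2) (hp : p = gc * q) : p ∈ D ↔ q ∈ D := by
  subst hp; exact hD.left _

lemma Rules.right_eq {D : Set F2} (hD : Rules D) (p q : F2) (hp : p = q * gc) : p ∈ D ↔ q ∈ D := by
  subst hp; exact hD.right _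

lemma flip_mixed {D : Set F2} (hD : Rules D) (a b : Fin 2 × Bool) (h1 : a.1 ≠ b.1)
    (h2 : a.2 ≠ b.2) (pre suf : F2)
    (h3 : pre * FreeGroup.mk [a] ∈ D) (h4 : pre * FreeGroup.mk [b] ∈ D)
    (h5 : FreeGroup.mk [a] * suf ∈ D) (h6 : FreeGroup.mk [b] * suf ∈ D)
    (h7 : pre * FreeGroup.mk [a] * FreeGroup.mk [b] * suf ∈ D) :
    pre * FreeGroup.mk [b] * FreeGroup.mk [a] * suf ∈ D := by
  rcases letter_cases a with rfl | rfl | rfl | rfl <;>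
  rcases letter_cases b with rfl | rfl | rfl | rfl <;>
  simp_all only [ne_eq, not_true_eq_false, mk_lX, mk_lY, mk_lX', mk_lY']
  · refine (hD.mid_inv h4 h5 _ _ ?_ ?_).1 h7 <;> (try simp only [gc]) <;> group
  · refine (hD.mid_eq h3 h6 _ _ ?_ ?_).2 h7 <;> (try simp only [gc]) <;> group
  · refine (hD.mid_eq h4 h5 _ _ ?_ ?_).1 h7 <;> (try simp only [gc]) <;> group
  · refine (hD.mid_inv h3 h6 _ _ ?_ ?_).2 h7 <;> (try simp only [gc]) <;> group

lemma flip_same {D : Set F2} (hD : Rules D) (a b : Fin 2 × Bool) (h1 : a.1 ≠ b.1)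
    (h2 : a.2 = b.2) (pre suf : F2)
    (h3 : pre ∈ D) (h4 : suf ∈ D)
    (h5 : pre = 1 ∨ (FreeGroup.mk [a] * FreeGroup.mk [b] * suf ∈ D ∧
      FreeGroup.mk [b] * FreeGroup.mk [a] * suf ∈ D))
    (h6 : suf = 1 ∨ (pre * FreeGroup.mk [a] * FreeGroup.mk [b] ∈ D ∧
      pre * FreeGroup.mk [b] * FreeGroup.mk [a] ∈ D))
    (h7 : pre * FreeGroup.mk [a] * FreeGroup.mk [b] * suf ∈ D) :
    pre * FreeGroup.mk [b] * FreeGroup.mk [a] * suf ∈ D := by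
  rcases letter_cases a with rfl | rfl | rfl | rfl <;>
  rcases letter_cases b with rfl | rfl | rfl | rfl <;>
  simp only [ne_eq, not_true_eq_false, mk_lX, mk_lY, mk_lX', mk_lY', Bool.true_eq_false,
    Bool.false_eq_true] at *
  · rcases h5 with rfl | ⟨h8, h9⟩
    · refine (hD.left_eq _ _ ?_).1 h7; simp only [gc]; group
    · refine (hD.mid_eq h3 h9 _ _ ?_ ?_).1 h7 <;> (try simp only [gc]) <;> group
  · rcases h6 with rfl | ⟨h8, h9⟩
    · refine (hD.right_eq _ _ ?_).1 h7; simp only [gc]; group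
    · refine (hD.mid_eq h9 h4 _ _ ?_ ?_).1 h7 <;> (try simp only [gc]) <;> group
  · rcases h5 with rfl | ⟨h8, h9⟩
    · refine (hD.left_eq _ _ ?_).2 h7; simp only [gc]; group
    · refine (hD.mid_eq h3 h8 _ _ ?_ ?_).2 h7 <;> (try simp only [gc]) <;> group
  · rcases h6 with rfl | ⟨h8, h9⟩
    · refine (hD.right_eq _ _ ?_).2 h7; simp only [gc]; group
    · refine (hD.mid_eq h8 h4 _ _ ?_ ?_).2 h7 <;> (try simp only [gc]) <;> group

def cnt (i : Fin 2) (l : List (Fin 2 × Bool)) : ℕ := l.countP (fun a => a.1 = i)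

lemma cnt_append (i : Fin 2) (l1 l2) : cnt i (l1 ++ l2) = cnt i l1 + cnt i l2 := by
  simp [cnt]

lemma cnt_perm (i : Fin 2) {l1 l2} (h : l1.Perm l2) : cnt i l1 = cnt i l2 := h.countP_eq _

/-- All strictly shorter sub-multisets lie in `D`. -/
def Below (D : Set F2) (l : List (Fin 2 × Bool)) : Prop :=
  ∀ l' : List (Fin 2 × Bool), l'.Subperm l → l'.length < l.length → FreeGroup.mk l' ∈ D

lemma mk_swap_same (a b : Fin 2 × Bool) (h : a.1 = b.1) :
    (FreeGroup.mk [a] * FreeGroup.mk [b] : F2) = FreeGroup.mk [b] * FreeGroup.mk [a] := by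
  rcases letter_cases a with rfl | rfl | rfl | rfl <;>
  rcases letter_cases b with rfl | rfl | rfl | rfl <;>
  simp [mk_lX, mk_lY, mk_lX', mk_lY'] at *

lemma swap_mem {D : Set F2} (hD : Rules D) (l pre suf : List (Fin 2 × Bool)) (a b : Fin 2 × Bool)
    (hl : Below D l) (hp : (pre ++ a :: b :: suf).Perm l)
    (h : FreeGroup.mk (pre ++ a :: b :: suf) ∈ D) : FreeGroup.mk (pre ++ b :: a :: suf) ∈ D := by
  have key : ∀ l', l'.Subperm (pre ++ a :: b :: suf) → l'.length < (pre ++ a :: b :: suf).length →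
      FreeGroup.mk l' ∈ D := fun l' h1 h2 =>
    hl l' (h1.trans hp.subperm) (by rwa [hp.length_eq] at h2)
  have hp2 : (pre ++ b :: a :: suf).Perm (pre ++ a :: b :: suf) :=
    (List.Perm.swap _ _ _).append_left _
  have keyS : ∀ l', l'.Sublist (pre ++ a :: b :: suf) → l'.length < (pre ++ a :: b :: suf).length →
      FreeGroup.mk l' ∈ D := fun l' h1 h2 => key l' h1.subperm h2
  have keyS2 : ∀ l', l'.Sublist (pre ++ b :: a :: suf) → l'.length < (pre ++ a :: b :: suf).length →
      FreeGroup.mk l' ∈ D := fun l' h1 h2 => key l' (h1.subperm.trans hp2.subperm) h2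
  have e : ∀ a b : Fin 2 × Bool, (FreeGroup.mk (pre ++ a :: b :: suf) : F2) =
      FreeGroup.mk pre * FreeGroup.mk [a] * FreeGroup.mk [b] * FreeGroup.mk suf := by
    intro a b
    rw [mk_append2, mk_cons2 a, mk_cons2 b]; simp only [mul_assoc]
  rw [e] at h ⊢
  by_cases h1 : a.1 = b.1
  · rw [mul_assoc (FreeGroup.mk pre), ← mk_swap_same a b h1, ← mul_assoc (FreeGroup.mk pre)]
    exact h
  have lpre : FreeGroup.mk pre ∈ D := keyS _ (by simp) (by simp)
  have lsuf : FreeGroup.mk suf ∈ D := keyS _ (by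
    exact ((List.sublist_cons_self _ _).trans (List.sublist_cons_self _ _)).trans
      (List.sublist_append_right _ _)) (by simp; omega)
  by_cases h2 : a.2 = b.2
  · apply flip_same hD a b h1 h2 _ _ lpre lsuf _ _ h
    · by_cases h3 : pre = []
      · left; subst h3; rfl
      · right
        have : 0 < pre.length := List.length_pos_iff.2 h3
        refine ⟨?_, ?_⟩
        · rw [mul_assoc, ← mk_cons2, ← mk_cons2]
          exact keyS _ (List.sublist_append_right _ _) (by simp; omega)
        · rw [mul_assoc, ← mk_cons2, ← mk_cons2]
          exact keyS2 _ (List.sublist_append_right _ _) (by simp; omega)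
    · by_cases h3 : suf = []
      · left; subst h3; rfl
      · right
        have : 0 < suf.length := List.length_pos_iff.2 h3
        refine ⟨?_, ?_⟩
        · rw [mul_assoc, ← mk_cons2, ← mk_append2]
          exact keyS _ (by simp) (by simp; omega)
        · rw [mul_assoc, ← mk_cons2, ← mk_append2]
          exact keyS2 _ (by simp) (by simp; omega)
  · apply flip_mixed hD a b h1 h2 _ _ _ _ _ _ h
    · rw [← mk_append2]
      exact keyS _ (by simp) (by simp)
    · rw [← mk_append2]
      exact keyS2 _ (by simp) (by simp)
    · rw [← mk_cons2]
      exact keyS2 _ ((List.sublist_cons_self _ _).trans (List.sublist_append_right _ _))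
        (by simp; omega)
    · rw [← mk_cons2]
      exact keyS _ ((List.sublist_cons_self _ _).trans (List.sublist_append_right _ _))
        (by simp; omega)

lemma perm_mem_aux {D : Set F2} (hD : Rules D) (l : List (Fin 2 × Bool)) (hl : Below D l)
    {l1 l2 : List (Fin 2 × Bool)} (h12 : l1.Perm l2) :
    ∀ pre : List (Fin 2 × Bool), (pre ++ l1).Perm l → FreeGroup.mk (pre ++ l1) ∈ D →
      FreeGroup.mk (pre ++ l2) ∈ D := by
  induction h12 with
  | nil => intro pre _ h; exact h
  | cons x _ ih =>
    intro pre h1 h2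
    have := ih (pre ++ [x]) (by simpa using h1) (by simpa using h2)
    simpa using this
  | swap x y l' =>
    intro pre h1 h2
    exact swap_mem hD l pre l' y x hl h1 h2
  | trans h3 _ ih1 ih2 =>
    intro pre h1 h2
    exact ih2 pre ((h3.symm.append_left pre).trans h1) (ih1 pre h1 h2)

lemma perm_mem {D : Set F2} (hD : Rules D) {l1 l2 : List (Fin 2 × Bool)} (hl : Below D l1)
    (h12 : l1.Perm l2) (h : FreeGroup.mk l1 ∈ D) : FreeGroup.mk l2 ∈ D := by
  simpa using perm_mem_aux hD l1 hl h12 [] (by simp) (by simpa using h)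

def lt (i : Fin 2) (e : Bool) : F2 := FreeGroup.mk [(i, e)]

lemma lt_inv (i : Fin 2) (e : Bool) : (lt i e)⁻¹ = lt i (!e) := by
  simp [lt, FreeGroup.inv_mk, FreeGroup.invRev]

lemma lt_norm (i : Fin 2) (e : Bool) : (lt i e).norm ≤ 1 := by
  exact FreeGroup.norm_mk_le (L₁ := [(i, e)])

lemma lt_pow (i : Fin 2) (e : Bool) (n : ℕ) :
    lt i e ^ n = FreeGroup.mk (List.replicate n (i, e)) := by
  induction n with
  | zero => rfl
  | succ n ih => rw [List.replicate_succ, mk_cons2, pow_succ', ih]; rfl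

lemma lt_zpow (i : Fin 2) (e : Bool) (j : ℤ) :
    lt i e ^ j = FreeGroup.mk (List.replicate j.natAbs (i, if 0 ≤ j then e else !e)) := by
  rw [← lt_pow]
  rcases Int.natAbs_eq j with h | h
  · split
    · rw [← zpow_natCast]; congr 1
    · omega
  · split
    · have : j = 0 := by omega
      subst this; simp
    · rw [← lt_inv, inv_pow, ← zpow_natCast, ← zpow_neg]; congr 1

lemma subperm_rep {a b : Fin 2 × Bool} {K J : ℕ} {l' : List (Fin 2 × Bool)}
    (h : l'.Subperm (List.replicate K a ++ List.replicate J b)) :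
    ∃ K' ≤ K, ∃ J' ≤ J, l'.Perm (List.replicate K' a ++ List.replicate J' b) := by
  obtain ⟨l'', h1, h2⟩ := h
  obtain ⟨p, q, rfl, h3, h4⟩ := List.sublist_append_iff.1 h2
  obtain ⟨K', hK, rfl⟩ := List.sublist_replicate_iff.1 h3
  obtain ⟨J', hJ, rfl⟩ := List.sublist_replicate_iff.1 h4
  exact ⟨K', hK, J', hJ, h1.symm⟩

lemma Rules.hM {D : Set F2} (hD : Rules D) (e : Bool) (pre suf : F2) 
    (h1 : pre * (lt 0 (!e))⁻¹ ∈ D) (h2 : pre * lt 1 (!e) ∈ D) (h3 : (lt 0 (!e))⁻¹ * suf ∈ D)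
    (h4 : lt 1 (!e) * suf ∈ D) (h5 : pre * lt 1 (!e) * (lt 0 (!e))⁻¹ * suf ∈ D) :
    pre * (lt 0 (!e))⁻¹ * lt 1 (!e) * suf ∈ D := by
  rw [lt_inv, Bool.not_not] at *
  exact flip_mixed hD (1, !e) (0, e) (by simp) (by simp) pre suf h2 h1 h4 h3 h5

lemma Rules.hM' {D : Set F2} (hD : Rules D) (e : Bool) (pre suf : F2) 
    (h1 : (pre * (lt 1 e)⁻¹)⁻¹ ∈ D) (h2 : (pre * lt 0 e)⁻¹ ∈ D) (h3 : ((lt 1 e)⁻¹ * suf)⁻¹ ∈ D)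
    (h4 : (lt 0 e * suf)⁻¹ ∈ D) (h5 : (pre * lt 0 e * (lt 1 e)⁻¹ * suf)⁻¹ ∈ D) :
    (pre * (lt 1 e)⁻¹ * lt 0 e * suf)⁻¹ ∈ D := by
  simp only [mul_inv_rev, inv_inv, ← mul_assoc] at *
  simp only [lt_inv] at *
  exact flip_mixed hD (1, e) (0, !e) (by simp) (by simp) _ _ h3 h4 h1 h2 h5

structure Push (D : Set F2) (R : ℕ) : Prop where
  rules : Rules D
  short : ∀ g : F2, g.norm ≤ 4 * R + 2 → g ∈ D
  s : ∀ (e : Bool) (g : F2), (∀ l : List Bool, l ≠ [] → 2 * l.length ≤ R →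
    g * blk (lt 0 e) (lt 1 e) l ∈ D) → g ∈ D
  t : ∀ (e : Bool) (g : F2), (∀ l : List Bool, l ≠ [] → 2 * l.length ≤ R →
    (blk (lt 1 e) (lt 0 e) l)⁻¹ * g ∈ D) → g ∈ D

lemma mono_mem {D : Set F2} {R : ℕ} (hP : Push D R) :
    ∀ (N : ℕ) (e d : Bool) (K J : ℕ), K ^ 2 + J ^ 2 = N → ∀ l : List (Fin 2 × Bool),
      l.Perm (List.replicate K (0, e) ++ List.replicate J (1, d)) → FreeGroup.mk l ∈ D := by
  intro N
  induction N using Nat.strong_induction_on with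
  | _ N IH =>
  intro e d K J hN l hl
  have below : Below D l := by
    intro l' h1 h2
    obtain ⟨K', hK, J', hJ, hp⟩ := subperm_rep (h1.trans hl.subperm)
    refine IH (K' ^ 2 + J' ^ 2) ?_ e d K' J' rfl l' hp
    have e1 := hp.length_eq
    have e2 := hl.length_eq
    simp at e1 e2
    rw [← hN]
    rcases hK.lt_or_eq with h | h
    · nlinarith
    · have : J' < J := by omega
      nlinarith
  suffices hs : ∃ l0 : List (Fin 2 × Bool),
      l0.Perm (List.replicate K (0, e) ++ List.replicate J (1, d)) ∧ FreeGroup.mk l0 ∈ D by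
    obtain ⟨l0, h1, h2⟩ := hs
    have hp : l0.Perm l := h1.trans hl.symm
    refine perm_mem hP.rules (l1 := l0) ?_ hp h2
    intro l' h3 h4
    exact below l' (h3.trans hp.subperm) (by rwa [← hp.length_eq])
  have hcases : (K + J ≤ 4 * R + 2) ∨ (2 * R + 1 ≤ K ∧ (e ≠ d → 2 * R + 1 + J ≤ 2 * K)) ∨
      (2 * R + 1 ≤ J ∧ (e ≠ d → 2 * R + 1 + K ≤ 2 * J)) := by
    by_cases hd : e = d
    · simp [hd]; omega
    · simp [hd]; omega
  rcases hcases with h | ⟨h1, h2⟩ | ⟨h1, h2⟩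
  · refine ⟨_, List.Perm.refl _, hP.short _ ?_⟩
    refine FreeGroup.norm_mk_le.trans ?_
    simpa using h
  · obtain ⟨m, rfl⟩ : ∃ m, K = m + R := ⟨K - R, by omega⟩
    set y0 : ℤ := if e = d then -(J : ℤ) else J with hy0
    have hy2 : y0 ^ 2 = (J : ℤ) ^ 2 := by rw [hy0]; split <;> ring
    have := push_step (D := D) (x := lt 0 (!e)) (y := lt 1 (!e)) (lt_norm _ _) (lt_norm _ _)
      (hP.rules.hM e) (4 * R + 2) R (by omega) hP.short {l | l ≠ [] ∧ 2 * l.length ≤ R}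
      (fun l hl => hl) (fun g hg => hP.s (!e) g fun l h3 h4 => hg l ⟨h3, h4⟩) m y0
      (by exact_mod_cast h1) (by
        rw [hy0]; split
        · push_cast; push_cast at h1; omega
        · rename_i h; have := h2 h; push_cast; omega) (by
        intro m' i j hlt
        rw [hy2] at hlt
        rw [lt_inv, Bool.not_not, lt_pow, lt_pow, lt_zpow, ← mk_append2, ← mk_append2]
        refine IH ((m' + i) ^ 2 + j.natAbs ^ 2) ?_ e (if 0 ≤ j then !e else !!e) (m' + i) j.natAbs rfl _ ?_
        · rw [← hN]; zify; push_cast at hlt; simpa using hlt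
        · rw [List.replicate_add, List.append_assoc, List.append_assoc]
          exact List.perm_append_comm.append_left _)
    rw [lt_inv, Bool.not_not, lt_pow, lt_pow, lt_zpow, ← mk_append2, ← mk_append2] at this
    refine ⟨_, ?_, this⟩
    rw [List.replicate_add, List.append_assoc, List.append_assoc]
    refine List.Perm.append_left _ (List.perm_append_comm.trans ?_)
    apply List.Perm.append_left
    have e1 : y0.natAbs = J := by rw [hy0]; split <;> simp
    rw [e1]
    rcases Nat.eq_zero_or_pos J with h0 | h0
    · subst h0; simp
    · have : (if 0 ≤ y0 then !e else !!e) = d := by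
        rw [hy0]; split_ifs <;> simp_all <;> try omega
        cases e <;> cases d <;> simp_all
      rw [this]
  · obtain ⟨m, rfl⟩ : ∃ m, J = m + R := ⟨J - R, by omega⟩
    set y0 : ℤ := if e = d then -(K : ℤ) else K with hy0
    have hy2 : y0 ^ 2 = (K : ℤ) ^ 2 := by rw [hy0]; split <;> ring
    have := push_step (D := {g | g⁻¹ ∈ D}) (x := lt 1 d) (y := lt 0 d) (lt_norm _ _) (lt_norm _ _)
      (hP.rules.hM' d) (4 * R + 2) R (by omega)
      (fun g hg => hP.short _ (by rwa [FreeGroup.norm_inv_eq])) {l | l ≠ [] ∧ 2 * l.length ≤ R}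
      (fun l hl => hl) (fun g hg => hP.t d g⁻¹ fun l h3 h4 => by
        have := hg l ⟨h3, h4⟩
        simpa only [Set.mem_ofPred_eq, mul_inv_rev] using this) m y0
      (by exact_mod_cast h1) (by
        rw [hy0]; split
        · push_cast; push_cast at h1; omega
        · rename_i h; have := h2 h; push_cast; omega) (by
        intro m' i j hlt
        rw [hy2] at hlt
        rw [Set.mem_ofPred_eq, mul_inv_rev, mul_inv_rev, inv_pow, inv_pow, inv_inv, inv_inv,
          ← inv_zpow, lt_inv, lt_pow, lt_pow, lt_zpow, ← mk_append2, ← mk_append2]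
        refine IH (j.natAbs ^ 2 + (m' + i) ^ 2) ?_ (if 0 ≤ j then !d else !!d) d j.natAbs (m' + i) rfl _ ?_
        · rw [← hN]; zify; push_cast at hlt; simp only [sq_abs]; linarith
        · rw [add_comm m', List.replicate_add, ← List.append_assoc, ← List.append_assoc]
          exact List.perm_append_comm.append_right _)
    rw [Set.mem_ofPred_eq, mul_inv_rev, mul_inv_rev, inv_pow, inv_pow, inv_inv, inv_inv,
          ← inv_zpow, lt_inv, lt_pow, lt_pow, lt_zpow, ← mk_append2, ← mk_append2] at this
    refine ⟨_, ?_, this⟩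
    rw [add_comm m, List.replicate_add, ← List.append_assoc, ← List.append_assoc]
    refine List.Perm.append_right _ (List.perm_append_comm.trans ?_)
    apply List.Perm.append_right
    have e1 : y0.natAbs = K := by rw [hy0]; split <;> simp
    rw [e1]
    rcases Nat.eq_zero_or_pos K with h0 | h0
    · subst h0; simp
    · have : (if 0 ≤ y0 then !d else !!d) = e := by
        rw [hy0]; split_ifs <;> simp_all <;> try omega
        cases e <;> cases d <;> simp_all
      rw [this]

lemma mono_of {l : List (Fin 2 × Bool)} (e d : Bool) (h : ∀ a ∈ l, a = (0, e) ∨ a = (1, d)) :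
    ∃ K J, l.Perm (List.replicate K (0, e) ++ List.replicate J (1, d)) := by
  induction l with
  | nil => exact ⟨0, 0, by simp⟩
  | cons a l ih =>
    obtain ⟨K, J, hp⟩ := ih (fun b hb => h b (List.mem_cons_of_mem _ hb))
    rcases h a List.mem_cons_self with rfl | rfl
    · exact ⟨K + 1, J, by rw [List.replicate_succ]; exact hp.cons _⟩
    · refine ⟨K, J + 1, ?_⟩
      rw [List.replicate_succ]
      exact (hp.cons _).trans List.perm_middle.symm

theorem partA {D : Set F2} {R : ℕ} (hP : Push D R) (g : F2) : g ∈ D := by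
  suffices h : ∀ (n : ℕ) (l : List (Fin 2 × Bool)), l.length = n → FreeGroup.mk l ∈ D by
    have := h _ g.toWord rfl
    rwa [FreeGroup.mk_toWord] at this
  intro n
  induction n using Nat.strong_induction_on with
  | _ n IH =>
  intro l hl
  by_cases hc : ∃ i : Fin 2, (i, true) ∈ l ∧ (i, false) ∈ l
  · obtain ⟨i, h1, h2⟩ := hc
    have h3 : (i, false) ∈ l.erase (i, true) := by
      rw [List.mem_erase_of_ne (by simp)]; exact h2
    have hp : ((i, true) :: (i, false) :: (l.erase (i, true)).erase (i, false)).Perm l :=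
      ((List.perm_cons_erase h3).symm.cons _).trans (List.perm_cons_erase h1).symm
    have hlen := hp.length_eq
    simp only [List.length_cons] at hlen
    refine perm_mem hP.rules ?_ hp ?_
    · intro l' _ h4
      refine IH l'.length ?_ l' rfl
      rw [hp.length_eq] at h4; omega
    · rw [mk_cons2, mk_cons2 (i, false)]
      have e : (FreeGroup.mk [(i, true)] : F2) * (FreeGroup.mk [(i, false)] * FreeGroup.mk
          ((l.erase (i, true)).erase (i, false))) =
          FreeGroup.mk ((l.erase (i, true)).erase (i, false)) := by
        have : (FreeGroup.mk [(i, false)] : F2) = (FreeGroup.mk [(i, true)])⁻¹ := rfl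
        rw [this]; group
      rw [e]
      exact IH _ (by omega) _ rfl
  · push Not at hc
    obtain ⟨K, J, hp⟩ := mono_of (l := l) (decide ((0, true) ∈ l)) (decide ((1, true) ∈ l)) (by
      intro a ha
      rcases letter_cases a with rfl | rfl | rfl | rfl
      · simp [ha]
      · have := mt (hc 0) (not_not.2 ha); simp [this]
      · simp [ha]
      · have := mt (hc 1) (not_not.2 ha); simp [this])
    exact mono_mem hP _ _ _ K J rfl l hp

section partC
variable {G : Type*} [Group G]

def ev (α β : G) (l : List Bool) : G := (l.map (fun b => if b then α else β)).prod

lemma ev_nil (α β : G) : ev α β [] = 1 := by simp [ev]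
lemma ev_cons (α β : G) (b : Bool) (l : List Bool) :
    ev α β (b :: l) = (if b then α else β) * ev α β l := by simp [ev]
lemma ev_append (α β : G) (l l' : List Bool) :
    ev α β (l ++ l') = ev α β l * ev α β l' := by simp [ev]

lemma perm_conj (α β : G) (E : Subgroup G) {l l' : List Bool} (h : l.Perm l') :
    ∀ g : G, (∀ p, (g * ev α β p) * (α * β * α⁻¹ * β⁻¹) * (g * ev α β p)⁻¹ ∈ E) →
      g * ev α β l * (ev α β l')⁻¹ * g⁻¹ ∈ E := by
  induction h with
  | nil => intro g _; simp [ev_nil]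
  | cons x _ ih =>
    intro g hg
    have := ih (g * (if x then α else β)) (fun p => by
      have := hg (x :: p)
      rwa [ev_cons, ← mul_assoc g] at this)
    rw [ev_cons, ev_cons]
    convert this using 1
    group
  | swap x y l =>
    intro g hg
    have h0 := hg []
    rw [ev_nil, mul_one] at h0
    simp only [ev_cons]
    cases x <;> cases y
    · convert E.one_mem using 1; group
    · convert h0 using 1
      simp only [if_true, Bool.false_eq_true, if_false]; group
    · convert E.inv_mem h0 using 1
      simp only [if_true, Bool.false_eq_true, if_false]; group
    · convert E.one_mem using 1; group
  | trans _ _ ih1 ih2 =>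
    intro g hg
    convert E.mul_mem (ih1 g hg) (ih2 g hg) using 1
    group

lemma perm_core (α β : G) (EA EB : Subgroup G) {l1 l2 : List Bool}
    (hp : (true :: l1).Perm (false :: l2)) (he : ev α β (true :: l1) = ev α β (false :: l2))
    (hA : ∀ p, (α * ev α β p) * (α * β * α⁻¹ * β⁻¹) * (α * ev α β p)⁻¹ ∈ EA)
    (hB : ∀ p, (β * ev α β p) * (α * β * α⁻¹ * β⁻¹) * (β * ev α β p)⁻¹ ∈ EB) :
    ∃ A ∈ EA, ∃ B ∈ EB, α * β * α⁻¹ * β⁻¹ = A⁻¹ * B := by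
  have hf : false ∈ l1 := by
    have : false ∈ true :: l1 := hp.symm.subset List.mem_cons_self
    simpa using this
  have h1 : l1.Perm (false :: l1.erase false) := List.perm_cons_erase hf
  have h2 : l2.Perm (true :: l1.erase false) := by
    have := (hp.symm.trans (h1.cons true)).trans (List.Perm.swap _ _ _)
    exact this.cons_inv
  refine ⟨_, perm_conj α β EA h1 α hA, _, perm_conj α β EB h2 β hB, ?_⟩
  simp only [ev_cons, if_true, Bool.false_eq_true, if_false] at *
  rw [he]
  group

def IsBlk (x y w : G) : Prop := ∃ l : List Bool, l ≠ [] ∧ w = blk x y l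

lemma blk_append (x y : G) (l l' : List Bool) : blk x y (l ++ l') = blk x y l * blk x y l' := by
  simp [blk]

lemma IsBlk.mul {x y w w' : G} (h : IsBlk x y w) (h' : IsBlk x y w') : IsBlk x y (w * w') := by
  obtain ⟨l, h1, rfl⟩ := h
  obtain ⟨l', h1', rfl⟩ := h'
  exact ⟨l ++ l', by simp [h1], (blk_append _ _ _ _).symm⟩

lemma isBlk_x (x y : G) : IsBlk x y x := ⟨[false], by simp, by simp [blk]⟩
lemma isBlk_xxy (x y : G) : IsBlk x y (x * x * y) := ⟨[true], by simp, by simp [blk]⟩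

def EE (x y c : G) : Subgroup G := Subgroup.closure {z | ∃ w, IsBlk x y w ∧ z = w * c * w⁻¹}

lemma mem_EE {x y c w : G} (h : IsBlk x y w) : w * c * w⁻¹ ∈ EE x y c :=
  Subgroup.subset_closure ⟨w, h, rfl⟩

lemma mem_EE_conj {x y c w z u : G} (h : IsBlk x y w) (hz : z ∈ EE x y c)
    (hu : u = z * w * c⁻¹ * w⁻¹ * z⁻¹) : u ∈ EE x y c := by
  have := mul_mem (mul_mem hz (inv_mem (mem_EE (c := c) h))) (inv_mem hz)
  rw [hu]
  convert this using 1
  group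

lemma blk_ev (X Y : G) (p : List Bool) :
    IsBlk X Y (X * X * ev (Y * X ^ 4) (X * Y * X ^ 4) p) := by
  have hx := isBlk_x X Y
  have hy := isBlk_xxy X Y
  induction p with
  | nil => rw [ev_nil, mul_one]; exact hx.mul hx
  | cons b p ih =>
    rw [ev_cons]
    cases b
    · convert ((hx.mul hy).mul (hx.mul hx)).mul ih using 1
      simp only [Bool.false_eq_true, if_false]; simp [pow_succ, mul_assoc]
    · convert (hy.mul (hx.mul hx)).mul ih using 1
      simp only [if_true]; simp [pow_succ, mul_assoc]

theorem S_plus (X Y : G) {l1 l2 : List Bool} (hp : (true :: l1).Perm (false :: l2))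
    (he : ev (Y * X ^ 4) (X * Y * X ^ 4) (true :: l1) =
      ev (Y * X ^ 4) (X * Y * X ^ 4) (false :: l2)) :
    X * Y * X⁻¹ * Y⁻¹ ∈ EE X Y (X * Y * X⁻¹ * Y⁻¹) := by
  have hx := isBlk_x X Y
  have hy := isBlk_xxy X Y
  set c := X * Y * X⁻¹ * Y⁻¹ with hc
  have hz : X * c⁻¹ * X⁻¹ ∈ EE X Y c := by
    have := inv_mem (mem_EE (c := c) hx)
    convert this using 1
    group
  obtain ⟨A, hA, B, hB, h⟩ := perm_core (Y * X ^ 4) (X * Y * X ^ 4)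
    ((EE X Y c).comap (MulAut.conj c).toMonoidHom) (EE X Y c) hp he
    (by
      intro p
      simp only [Subgroup.mem_comap, MulEquiv.coe_toMonoidHom, MulAut.conj_apply]
      refine mem_EE_conj (hy.mul (blk_ev X Y p)) hz ?_
      rw [hc]; simp [pow_succ, mul_assoc])
    (by
      intro p
      refine mem_EE_conj ((hy.mul hx).mul (blk_ev X Y p)) hz ?_
      rw [hc]; simp [pow_succ, mul_assoc])
  simp only [Subgroup.mem_comap, MulEquiv.coe_toMonoidHom, MulAut.conj_apply] at hA
  have h2 : c⁻¹ = A⁻¹ * B := by rw [← h, hc]; group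
  have h3 : c = c * A * c⁻¹ * B⁻¹ := by rw [h2]; group
  have h4 := mul_mem hA (inv_mem hB)
  rw [← h3] at h4
  exact h4

lemma blk_ev' (X Y : G) (p : List Bool) (hp : p ≠ []) :
    IsBlk X⁻¹ Y⁻¹ (X * ev (Y * X ^ 4)⁻¹ (X * Y * X ^ 4)⁻¹ p) := by
  have hx := isBlk_x X⁻¹ Y⁻¹
  have hy := isBlk_xxy X⁻¹ Y⁻¹
  induction p with
  | nil => exact absurd rfl hp
  | cons b p ih =>
    rw [ev_cons]
    by_cases h : p = []
    · subst h
      rw [ev_nil, mul_one]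
      cases b
      · convert (hx.mul hy).mul hx using 1
        simp only [Bool.false_eq_true, if_false]; group
      · convert (hx.mul hy) using 1
        simp only [if_true]; group
    · cases b
      · convert (((hx.mul hy).mul hx).mul hx).mul (ih h) using 1
        simp only [Bool.false_eq_true, if_false]; group
      · convert ((hx.mul hy).mul hx).mul (ih h) using 1
        simp only [if_true]; group

lemma blk_ev'' (X Y : G) (p : List Bool) (hp : p ≠ []) :
    IsBlk X⁻¹ Y⁻¹ (ev (Y * X ^ 4)⁻¹ (X * Y * X ^ 4)⁻¹ p) := by
  convert (isBlk_x X⁻¹ Y⁻¹).mul (blk_ev' X Y p hp) using 1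
  group

theorem S_minus (X Y : G) {l1 l2 : List Bool} (hp : (true :: l1).Perm (false :: l2))
    (he : ev (Y * X ^ 4)⁻¹ (X * Y * X ^ 4)⁻¹ (true :: l1) =
      ev (Y * X ^ 4)⁻¹ (X * Y * X ^ 4)⁻¹ (false :: l2)) :
    X * Y * X⁻¹ * Y⁻¹ ∈ EE X⁻¹ Y⁻¹ (X * Y * X⁻¹ * Y⁻¹) := by
  have hx := isBlk_x X⁻¹ Y⁻¹
  set c := X * Y * X⁻¹ * Y⁻¹ with hc
  set α := Y * X ^ 4 with hα
  set β := X * Y * X ^ 4 with hβ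
  have hcc : α * β * α⁻¹ * β⁻¹ = c⁻¹ := by rw [hα, hβ, hc]; group
  have hβα : β = X * α := by rw [hα, hβ]; group
  have ha : ∀ p, IsBlk X⁻¹ Y⁻¹ (β * ev α⁻¹ β⁻¹ p * α⁻¹ * β⁻¹) := by
    intro p
    cases p with
    | nil =>
      convert blk_ev' X Y [false] (by simp) using 1
      rw [ev_nil, ev_cons, ev_nil, ← hβ, hβα]; simp
    | cons b p =>
      cases b
      · convert blk_ev'' X Y (p ++ [true, false]) (by simp) using 1
        simp [ev_append, ev_cons, ev_nil, ← hα, ← hβ, mul_assoc]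
      · convert blk_ev' X Y (p ++ [true, false]) (by simp) using 1
        rw [ev_append, ev_cons, ev_cons, ev_cons, ev_nil, ← hα, ← hβ, hβα]
        simp [mul_assoc]
  have hb : ∀ p, IsBlk X⁻¹ Y⁻¹ (α * ev α⁻¹ β⁻¹ p * α⁻¹ * β⁻¹) := by
    intro p
    cases p with
    | nil =>
      convert blk_ev'' X Y [false] (by simp) using 1
      rw [ev_nil, ev_cons, ev_nil, ← hβ]; simp
    | cons b p =>
      cases b
      · convert hx.mul (blk_ev'' X Y (p ++ [true, false]) (by simp)) using 1
        rw [ev_append, ev_cons, ev_cons, ev_cons, ev_nil, ← hα, ← hβ, hβα]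
        simp [mul_assoc]
      · convert blk_ev'' X Y (p ++ [true, false]) (by simp) using 1
        simp [ev_append, ev_cons, ev_nil, ← hα, ← hβ, mul_assoc]
  have hcb : c * α = β * α * β⁻¹ := by rw [hα, hβ, hc]; group
  obtain ⟨A, hA, B, hB, h⟩ := perm_core α⁻¹ β⁻¹
    ((EE X⁻¹ Y⁻¹ c).comap (MulAut.conj (β * α)).toMonoidHom)
    ((EE X⁻¹ Y⁻¹ c).comap (MulAut.conj (c⁻¹ * (β * α))).toMonoidHom) hp he
    (by
      intro p
      simp only [Subgroup.mem_comap, MulEquiv.coe_toMonoidHom, MulAut.conj_apply]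
      refine mem_EE_conj (ha p) (one_mem _) ?_
      rw [← hcc]; group)
    (by
      intro p
      simp only [Subgroup.mem_comap, MulEquiv.coe_toMonoidHom, MulAut.conj_apply]
      refine mem_EE_conj (hb p) (one_mem _) ?_
      rw [← hcc]; group)
  simp only [Subgroup.mem_comap, MulEquiv.coe_toMonoidHom, MulAut.conj_apply] at hA hB
  have h2 : c⁻¹ = (β * α * A * (β * α)⁻¹)⁻¹ * (β * α * B * (β * α)⁻¹) := by
    have : (β * α * A * (β * α)⁻¹)⁻¹ * (β * α * B * (β * α)⁻¹) =
      β * α * (A⁻¹ * B) * (β * α)⁻¹ := by group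
    rw [this, ← h, ← hcc]; group
  generalize hA' : β * α * A * (β * α)⁻¹ = A' at *
  generalize hB' : β * α * B * (β * α)⁻¹ = B' at *
  have h5 : c⁻¹ * (β * α) * B * (c⁻¹ * (β * α))⁻¹ = c⁻¹ * B' * c := by rw [← hB']; group
  rw [h5] at hB
  have h3 : c = A' * (c⁻¹ * B' * c)⁻¹ := by
    have e1 : B' = A' * c⁻¹ := by rw [h2]; group
    rw [e1]; group
  have h4 := mul_mem hA (inv_mem hB)
  rw [← h3] at h4
  exact h4

end partC

section partC2
variable {G : Type*} [Group G]

lemma heads_differ (α β : G) : ∀ (lu lv : List Bool), lu ≠ lv → lu.Perm lv →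
    ev α β lu = ev α β lv → ∃ l1 l2 : List Bool, (true :: l1).Perm (false :: l2) ∧
      ev α β (true :: l1) = ev α β (false :: l2) := by
  intro lu
  induction lu with
  | nil => intro lv h1 h2 _; exact absurd h2.nil_eq h1
  | cons a lu ih =>
    intro lv h1 h2 h3
    cases lv with
    | nil => exact absurd h2.eq_nil h1
    | cons b lv =>
      by_cases hab : a = b
      · subst hab
        refine ih lv (fun h => h1 (by rw [h])) h2.cons_inv ?_
        rw [ev_cons, ev_cons] at h3
        exact mul_left_cancel h3
      · cases a <;> cases b
        · exact absurd rfl hab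
        · exact ⟨lv, lu, h2.symm, h3.symm⟩
        · exact ⟨lu, lv, h2, h3⟩
        · exact absurd rfl hab

lemma ev_reverse (α β : G) (l : List Bool) : ev α⁻¹ β⁻¹ l.reverse = (ev α β l)⁻¹ := by
  induction l with
  | nil => simp [ev_nil]
  | cons a l ih =>
    rw [List.reverse_cons, ev_append, ih, ev_cons, ev_cons, ev_nil]
    cases a <;> simp

/-- Bounded version of `EE`. -/
def EER (x y c : G) (R : ℕ) : Subgroup G := Subgroup.closure
  {z | ∃ l : List Bool, l ≠ [] ∧ 2 * l.length ≤ R ∧ z = blk x y l * c * (blk x y l)⁻¹}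

lemma EER_mono (x y c : G) {R R' : ℕ} (h : R ≤ R') : EER x y c R ≤ EER x y c R' := by
  apply Subgroup.closure_mono
  rintro z ⟨l, h1, h2, h3⟩
  exact ⟨l, h1, h2.trans h, h3⟩

lemma mem_EER (x y c z : G) (h : z ∈ EE x y c) : ∃ R, z ∈ EER x y c R := by
  induction h using Subgroup.closure_induction with
  | mem z hz =>
    obtain ⟨w, ⟨l, h1, rfl⟩, rfl⟩ := hz
    exact ⟨2 * l.length, Subgroup.subset_closure ⟨l, h1, le_rfl, rfl⟩⟩
  | one => exact ⟨0, one_mem _⟩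
  | mul a b _ _ ha hb =>
    obtain ⟨R1, h1⟩ := ha
    obtain ⟨R2, h2⟩ := hb
    exact ⟨max R1 R2, mul_mem (EER_mono _ _ _ (le_max_left _ _) h1)
      (EER_mono _ _ _ (le_max_right _ _) h2)⟩
  | inv a _ ha =>
    obtain ⟨R1, h1⟩ := ha
    exact ⟨R1, inv_mem h1⟩

theorem S_both (X Y : G) (lu lv : List Bool) (h1 : lu ≠ lv) (h2 : lu.Perm lv)
    (h3 : ev (Y * X ^ 4) (X * Y * X ^ 4) lu = ev (Y * X ^ 4) (X * Y * X ^ 4) lv) :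
    ∃ R, X * Y * X⁻¹ * Y⁻¹ ∈ EER X Y (X * Y * X⁻¹ * Y⁻¹) R ∧
      X * Y * X⁻¹ * Y⁻¹ ∈ EER X⁻¹ Y⁻¹ (X * Y * X⁻¹ * Y⁻¹) R := by
  obtain ⟨l1, l2, hp, he⟩ := heads_differ _ _ lu lv h1 h2 h3
  obtain ⟨R1, hR1⟩ := mem_EER _ _ _ _ (S_plus X Y hp he)
  obtain ⟨l1, l2, hp, he⟩ := heads_differ (Y * X ^ 4)⁻¹ (X * Y * X ^ 4)⁻¹ lu.reverse lv.reverse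
    (by simpa using h1) ((List.reverse_perm _).trans (h2.trans (List.reverse_perm _).symm))
    (by rw [ev_reverse, ev_reverse, h3])
  obtain ⟨R2, hR2⟩ := mem_EER _ _ _ _ (S_minus X Y hp he)
  exact ⟨max R1 R2, EER_mono _ _ _ (le_max_left _ _) hR1, EER_mono _ _ _ (le_max_right _ _) hR2⟩

lemma EER_inv (x y c : G) (R : ℕ) : EER x y c R ≤ EER x y c⁻¹ R := by
  apply (Subgroup.closure_le _).2
  rintro z ⟨l, h1, h2, h3⟩
  have : z⁻¹ ∈ EER x y c⁻¹ R := Subgroup.subset_closure ⟨l, h1, h2, by rw [h3]; group⟩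
  simpa using inv_mem this

lemma map_blk {H : Type*} [Group H] (f : G →* H) (x y : G) (l : List Bool) :
    f (blk x y l) = blk (f x) (f y) l := by
  induction l with
  | nil => simp [blk_nil]
  | cons b l ih => rw [blk_cons, blk_cons, map_mul, ih]; cases b <;> simp

lemma EER_map {H : Type*} [Group H] (f : G →* H) (x y c : G) (R : ℕ) :
    (EER x y c R).map f = EER (f x) (f y) (f c) R := by
  rw [EER, EER, MonoidHom.map_closure]
  congr 1
  ext z
  constructor
  · rintro ⟨_, ⟨l, h1, h2, rfl⟩, rfl⟩
    exact ⟨l, h1, h2, by simp [map_blk]⟩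
  · rintro ⟨l, h1, h2, rfl⟩
    exact ⟨_, ⟨l, h1, h2, rfl⟩, by simp [map_blk]⟩

end partC2

section partD
variable {Γ : Type*} [Group Γ]

theorem all_commute (ι : F2 →* Γ) (s t : Γ) (hst : ι gc = s * t) (R : ℕ)
    (hshort : ∀ g : F2, g.norm ≤ 4 * R + 2 → Commute (ι g * s * (ι g)⁻¹) t)
    (hs : ∀ e, s ∈ EER (ι (lt 0 e)) (ι (lt 1 e)) s R)
    (ht : ∀ e, t ∈ EER (ι (lt 1 e)) (ι (lt 0 e)) t R) (g : F2) :
    Commute (ι g * s * (ι g)⁻¹) t := by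
  -- moving conjugations around
  have conj : ∀ a x y : Γ, Commute (a * x * a⁻¹) y ↔ Commute x (a⁻¹ * y * a) := by
    intro a x y
    constructor
    · intro h
      have h1 : x * (a⁻¹ * y * a) = a⁻¹ * (a * x * a⁻¹ * y) * a := by group
      have h2 : (a⁻¹ * y * a) * x = a⁻¹ * (y * (a * x * a⁻¹)) * a := by group
      rw [commute_iff_eq, h1, h2, h.eq]
    · intro h
      have h1 : a * x * a⁻¹ * y = a * (x * (a⁻¹ * y * a)) * a⁻¹ := by group
      have h2 : y * (a * x * a⁻¹) = a * ((a⁻¹ * y * a) * x) * a⁻¹ := by group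
      rw [commute_iff_eq, h1, h2, h.eq]
  have hst0 : Commute s t := by simpa using hshort 1 (by simp)
  have fixr : ∀ x y : Γ, Commute x y → y * x * y⁻¹ = x := by
    intro x y h; rw [← h.eq]; group
  have hR : Rules {g : F2 | Commute (ι g * s * (ι g)⁻¹) t} := by
    constructor
    · intro g1 h1 g2 h2
      simp only [Set.mem_ofPred_eq] at *
      have e1 : ι (g1 * gc * g2) * s * (ι (g1 * gc * g2))⁻¹ =
          ι g1 * (s * (t * (ι g2 * s * (ι g2)⁻¹) * t⁻¹) * s⁻¹) * (ι g1)⁻¹ := by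
        rw [map_mul, map_mul, hst]; group
      have e2 : ι (g1 * g2) * s * (ι (g1 * g2))⁻¹ =
          ι g1 * (ι g2 * s * (ι g2)⁻¹) * (ι g1)⁻¹ := by
        rw [map_mul]; group
      rw [e1, e2, fixr _ _ h2, conj, conj, conj (ι g1)]
      rw [conj] at h1
      have := fixr _ _ h1.symm.inv_right
      rw [inv_inv] at this
      rw [this]
    · intro g
      simp only [Set.mem_ofPred_eq] at *
      have e1 : ι (gc * g) * s * (ι (gc * g))⁻¹ =
          s * (t * (ι g * s * (ι g)⁻¹) * t⁻¹) * s⁻¹ := by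
        rw [map_mul, hst]; group
      have := fixr _ _ hst0.symm.inv_right
      rw [inv_inv] at this
      rw [e1, conj, this, conj]
      simp
    · intro g
      simp only [Set.mem_ofPred_eq] at *
      have e1 : ι (g * gc) * s * (ι (g * gc))⁻¹ =
          ι g * (s * (t * s * t⁻¹) * s⁻¹) * (ι g)⁻¹ := by
        rw [map_mul, hst]; group
      rw [e1, fixr _ _ hst0]
      simp
  refine partA (D := {g : F2 | Commute (ι g * s * (ι g)⁻¹) t}) (R := R) ⟨hR, hshort, ?_, ?_⟩ g
  · intro e g hg
    have : EER (ι (lt 0 e)) (ι (lt 1 e)) s R ≤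
        (Subgroup.centralizer {t}).comap (MulAut.conj (ι g)).toMonoidHom := by
      apply (Subgroup.closure_le _).2
      rintro z ⟨l, h1, h2, rfl⟩
      have := hg l h1 h2
      simp only [Set.mem_ofPred_eq, map_mul, map_blk] at this
      simp only [Subgroup.coe_comap, Set.mem_preimage, MulEquiv.coe_toMonoidHom,
        MulAut.conj_apply, SetLike.mem_coe, Subgroup.mem_centralizer_singleton_iff]
      convert this.eq using 1 <;> group
    have := this (hs e)
    simp only [Subgroup.mem_comap, MulEquiv.coe_toMonoidHom,
        MulAut.conj_apply, Subgroup.mem_centralizer_singleton_iff] at this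
    exact this
  · intro e g hg
    have : EER (ι (lt 1 e)) (ι (lt 0 e)) t R ≤
        Subgroup.centralizer {ι g * s * (ι g)⁻¹} := by
      apply (Subgroup.closure_le _).2
      rintro z ⟨l, h1, h2, rfl⟩
      have := hg l h1 h2
      simp only [Set.mem_ofPred_eq, map_mul, map_inv, map_blk] at this
      simp only [SetLike.mem_coe, Subgroup.mem_centralizer_singleton_iff]
      generalize blk (ι (lt 1 e)) (ι (lt 0 e)) l = w at *
      have e1 : w⁻¹ * ι g * s * (w⁻¹ * ι g)⁻¹ = w⁻¹ * (ι g * s * (ι g)⁻¹) * w⁻¹⁻¹ := by group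
      rw [e1, conj, inv_inv] at this
      exact this.symm.eq
    have := this (ht e)
    rw [Subgroup.mem_centralizer_singleton_iff] at this
    exact this.symm

end partD

abbrev F3 := FreeGroup (Fin 3)
def hX : F3 := FreeGroup.of 0
def hY : F3 := FreeGroup.of 1
def hs : F3 := FreeGroup.of 2
def inc : F2 →* F3 := FreeGroup.lift ![hX, hY]
lemma inc_X : inc gX = hX := by simp [inc, gX]
lemma inc_Y : inc gY = hY := by simp [inc, gY]
def ht : F3 := hs⁻¹ * inc gc
lemma inc_gc : inc gc = hs * ht := by simp [ht]

/-- Subgroup generated by conjugates of `s` by elements of a homomorphic image of `F2`. -/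
def conjSub {Γ : Type*} [Group Γ] (ι : F2 →* Γ) (s : Γ) : Subgroup Γ :=
  Subgroup.closure {z | ∃ g, z = ι g * s * (ι g)⁻¹}

section partE
variable {Γ : Type*} [Group Γ]

lemma conj_mem_conjSub (ι : F2 →* Γ) (s : Γ) (g : F2) : ι g * s * (ι g)⁻¹ ∈ conjSub ι s :=
  Subgroup.subset_closure ⟨g, rfl⟩

lemma self_mem_conjSub (ι : F2 →* Γ) (s : Γ) : s ∈ conjSub ι s := by
  simpa using conj_mem_conjSub ι s 1

lemma conjSub_map {H : Type*} [Group H] (f : Γ →* H) (ι : F2 →* Γ) (s : Γ) :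
    (conjSub ι s).map f = conjSub (f.comp ι) (f s) := by
  rw [conjSub, conjSub, MonoidHom.map_closure]
  congr 1
  ext z
  constructor
  · rintro ⟨_, ⟨g, rfl⟩, rfl⟩
    exact ⟨g, by simp⟩
  · rintro ⟨g, rfl⟩
    exact ⟨_, ⟨g, rfl⟩, by simp⟩

lemma EER_le_conjSub (ι : F2 →* Γ) (x y : F2) (s : Γ) (R : ℕ) :
    EER (ι x) (ι y) s R ≤ conjSub ι s := by
  apply (Subgroup.closure_le _).2
  rintro z ⟨l, _, _, rfl⟩
  rw [← map_blk]
  exact conj_mem_conjSub _ _ _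

lemma conj_conjSub (ι : F2 →* Γ) (s : Γ) (g : F2) (z : Γ) (hz : z ∈ conjSub ι s) :
    ι g * z * (ι g)⁻¹ ∈ conjSub ι s := by
  have : conjSub ι s ≤ (conjSub ι s).comap (MulAut.conj (ι g)).toMonoidHom := by
    apply (Subgroup.closure_le _).2
    rintro z ⟨h, rfl⟩
    simp only [Subgroup.coe_comap, Set.mem_preimage, MulEquiv.coe_toMonoidHom,
        MulAut.conj_apply, SetLike.mem_coe]
    have := conj_mem_conjSub ι s (g * h)
    convert this using 1
    rw [map_mul]; group
  simpa using this hz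

/-- Everything is a consequence of three generators. -/
lemma conjSub_normal (q : F3 →* Γ) (hq : Function.Surjective q) (a : Γ)
    (h1 : ∀ z ∈ conjSub (q.comp inc) a, q hs * z * (q hs)⁻¹ ∈ conjSub (q.comp inc) a)
    (h2 : ∀ z ∈ conjSub (q.comp inc) a, (q hs)⁻¹ * z * (q hs) ∈ conjSub (q.comp inc) a) :
    (conjSub (q.comp inc) a).Normal := by
  constructor
  intro z hz g
  obtain ⟨w, rfl⟩ := hq g
  induction w using FreeGroup.induction_on generalizing z with
  | C1 => simpa using hz
  | of i =>
    fin_cases i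
    · have := conj_conjSub _ _ gX _ hz
      rwa [MonoidHom.comp_apply, inc_X] at this
    · have := conj_conjSub _ _ gY _ hz
      rwa [MonoidHom.comp_apply, inc_Y] at this
    · exact h1 z hz
  | inv_of i _ =>
    fin_cases i
    · have := conj_conjSub _ _ gX⁻¹ _ hz
      rwa [MonoidHom.comp_apply, map_inv, inc_X] at this
    · have := conj_conjSub _ _ gY⁻¹ _ hz
      rwa [MonoidHom.comp_apply, map_inv, inc_Y] at this
    · have := h2 z hz
      rw [map_inv, inv_inv]
      exact this
  | mul x y hx hy =>
    have := hx _ (hy _ hz)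
    convert this using 1
    rw [map_mul]; group

lemma conjSub_s_normal (q : F3 →* Γ) (hq : Function.Surjective q) :
    (conjSub (q.comp inc) (q hs)).Normal := by
  have := self_mem_conjSub (q.comp inc) (q hs)
  apply conjSub_normal q hq
  · intro z hz
    exact mul_mem (mul_mem this hz) (inv_mem this)
  · intro z hz
    exact mul_mem (mul_mem (inv_mem this) hz) this

lemma conjSub_commute (ι : F2 →* Γ) (s t : Γ)
    (hc : ∀ g, Commute (ι g * s * (ι g)⁻¹) t) (a b : Γ) (ha : a ∈ conjSub ι s)
    (hb : b ∈ conjSub ι t) : Commute a b := by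
  have h1 : ∀ b ∈ conjSub ι t, Commute s b := by
    intro b hb
    have : conjSub ι t ≤ Subgroup.centralizer {s} := by
      apply (Subgroup.closure_le _).2
      rintro z ⟨g, rfl⟩
      rw [SetLike.mem_coe, Subgroup.mem_centralizer_singleton_iff]
      have := (hc g⁻¹).eq
      rw [map_inv] at this
      have e1 : ι g * t * (ι g)⁻¹ * s = ι g * (t * ((ι g)⁻¹ * s * (ι g)⁻¹⁻¹)) * (ι g)⁻¹ := by group
      have e2 : s * (ι g * t * (ι g)⁻¹) = ι g * (((ι g)⁻¹ * s * (ι g)⁻¹⁻¹) * t) * (ι g)⁻¹ := by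
        group
      rw [e1, e2, this]
    have := this hb
    rw [Subgroup.mem_centralizer_singleton_iff] at this
    exact this.symm
  have : conjSub ι s ≤ Subgroup.centralizer {b} := by
    apply (Subgroup.closure_le _).2
    rintro z ⟨g, rfl⟩
    rw [SetLike.mem_coe, Subgroup.mem_centralizer_singleton_iff]
    have h2 := (h1 _ (conj_conjSub ι t g⁻¹ b hb)).eq
    rw [map_inv] at h2
    have e1 : ι g * s * (ι g)⁻¹ * b = ι g * (s * ((ι g)⁻¹ * b * (ι g)⁻¹⁻¹)) * (ι g)⁻¹ := by group
    have e2 : b * (ι g * s * (ι g)⁻¹) = ι g * (((ι g)⁻¹ * b * (ι g)⁻¹⁻¹) * s) * (ι g)⁻¹ := by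
      group
    rw [e1, e2, h2]
  have := this ha
  rw [Subgroup.mem_centralizer_singleton_iff] at this
  exact this

lemma conjSub_t_normal (q : F3 →* Γ) (hq : Function.Surjective q)
    (hc : ∀ a b, a ∈ conjSub (q.comp inc) (q hs) → b ∈ conjSub (q.comp inc) (q ht) →
      Commute a b) :
    (conjSub (q.comp inc) (q ht)).Normal := by
  have := self_mem_conjSub (q.comp inc) (q hs)
  apply conjSub_normal q hq
  · intro z hz
    rw [(hc _ _ this hz).eq]; simpa using hz
  · intro z hz
    have := hc _ _ (inv_mem this) hz
    rw [this.eq]; simpa using hz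

/-- The intersection of the two commuting subgroups is trivial. -/
theorem inter_trivial (q : F3 →* Γ) (hq : Function.Surjective q)
    (hc : ∀ a b, a ∈ conjSub (q.comp inc) (q hs) → b ∈ conjSub (q.comp inc) (q ht) →
      Commute a b)
    (Rel : Set F3) (hker : q.ker = Subgroup.normalClosure Rel)
    (hRel : ∀ r ∈ Rel, r ∈ conjSub inc hs ∨ r ∈ conjSub inc ht ∨ ∃ z, r = z * ht * z⁻¹ * ht⁻¹)
    (x : Γ) (hxS : x ∈ conjSub (q.comp inc) (q hs)) (hxT : x ∈ conjSub (q.comp inc) (q ht)) :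
    x = 1 := by
  have hN := conjSub_s_normal q hq
  let S := conjSub (q.comp inc) (q hs)
  have : S.Normal := hN
  let s' : S := ⟨q hs, self_mem_conjSub _ _⟩
  have hker1 : ∀ r ∈ Rel, q r = 1 := by
    intro r hr
    have : r ∈ q.ker := by rw [hker]; exact Subgroup.subset_normalClosure hr
    exact this
  -- the cocycle
  have hfmem : ∀ i : ℤ, ((q hs)⁻¹ * q hX) ^ i * (q hX) ^ (-i) ∈ S := by
    intro i
    rw [← QuotientGroup.eq_one_iff]
    have h0 : ((q hs : Γ) : Γ ⧸ S) = 1 := (QuotientGroup.eq_one_iff _).2 (self_mem_conjSub _ _)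
    rw [QuotientGroup.mk_mul, QuotientGroup.mk_zpow, QuotientGroup.mk_zpow, QuotientGroup.mk_mul,
      QuotientGroup.mk_inv, h0]
    simp
  let f : ℤ → S := fun i => ⟨((q hs)⁻¹ * q hX) ^ i * (q hX) ^ (-i), hfmem i⟩
  have hf : ∀ i, f (i + 1) = s'⁻¹ * MulAut.conjNormal (q hX) (f i) := by
    intro i
    apply Subtype.ext
    simp only [f, s', Subgroup.coe_mul, Subgroup.coe_inv, MulAut.conjNormal_apply]
    rw [add_comm i 1, zpow_add, zpow_one, neg_add, add_comm, zpow_add, zpow_neg (q hX) 1, zpow_one]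
    simp only [mul_assoc]
  let P : S →* Equiv.Perm (ℤ × S) :=
    { toFun := fun σ => Equiv.prodShear (Equiv.refl ℤ) (fun _ => Equiv.mulLeft σ)
      map_one' := by ext ⟨i, τ⟩ <;> simp
      map_mul' := by intro a b; ext ⟨i, τ⟩ <;> simp [mul_assoc] }
  let pX : Equiv.Perm (ℤ × S) :=
    Equiv.prodShear (Equiv.addRight 1) (fun _ => (MulAut.conjNormal (q hX)).toEquiv)
  let pY : Equiv.Perm (ℤ × S) :=
    Equiv.prodShear (Equiv.refl ℤ)
      (fun i => (MulAut.conjNormal (q hY)).toEquiv.trans (Equiv.mulRight (f i)))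
  have P_ap : ∀ σ i τ, P σ (i, τ) = (i, σ * τ) := fun _ _ _ => rfl
  have pX_ap : ∀ i τ, pX (i, τ) = (i + 1, MulAut.conjNormal (q hX) τ) := fun _ _ => rfl
  have pY_ap : ∀ i τ, pY (i, τ) = (i, MulAut.conjNormal (q hY) τ * f i) := fun _ _ => rfl
  let Ψ : F3 →* Equiv.Perm (ℤ × S) := FreeGroup.lift ![pX, pY, P s']
  have ΨX : Ψ hX = pX := by simp [Ψ, hX]
  have ΨY : Ψ hY = pY := by simp [Ψ, hY]
  have Ψs : Ψ hs = P s' := by simp [Ψ, hs]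
  have hXY : q hX * q hY = q hs * q ht * (q hY * q hX) := by
    rw [← map_mul q hs, ← inc_gc, gc]
    simp [inc_X, inc_Y]
  have hrel : pX * pY = P s' * pY * pX := by
    ext1 ⟨i, τ⟩
    simp only [Equiv.Perm.mul_apply, P_ap, pX_ap, pY_ap, hf]
    refine Prod.ext rfl ?_
    apply Subtype.ext
    have hcm := hc _ _ ((inferInstance : S.Normal).conj_mem _ τ.2 (q hY * q hX))
      (self_mem_conjSub (q.comp inc) (q ht))
    simp only [s', Subgroup.coe_mul, Subgroup.coe_inv, MulAut.conjNormal_apply]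
    have e1 : q hX * (q hY * τ * (q hY)⁻¹ * f i) * (q hX)⁻¹ =
      (q hX * q hY) * τ * (q hX * q hY)⁻¹ * (q hX * f i * (q hX)⁻¹) := by group
    rw [e1, hXY]
    have e2 : q hs * q ht * (q hY * q hX) * τ * (q hs * q ht * (q hY * q hX))⁻¹ =
      q hs * (q ht * (q hY * q hX * τ * (q hY * q hX)⁻¹)) * (q ht)⁻¹ * (q hs)⁻¹ := by group
    rw [e2, ← hcm.eq]
    group
  have Ψt : Ψ ht = 1 := by
    rw [ht, gc]
    simp only [map_mul, map_inv, inc_X, inc_Y, ΨX, ΨY, Ψs]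
    rw [hrel]; group
  have Ψconj : ∀ (w : F3) (σ : S), Ψ w * P σ = P (MulAut.conjNormal (q w) σ) * Ψ w := by
    have hof : ∀ (i : Fin 3) (σ : S), Ψ (FreeGroup.of i) * P σ =
        P (MulAut.conjNormal (q (FreeGroup.of i)) σ) * Ψ (FreeGroup.of i) := by
      intro i σ
      fin_cases i
      · change Ψ hX * P σ = P (MulAut.conjNormal (q hX) σ) * Ψ hX
        rw [ΨX]
        ext1 ⟨i, τ⟩
        simp only [Equiv.Perm.mul_apply, P_ap, pX_ap, map_mul]
      · change Ψ hY * P σ = P (MulAut.conjNormal (q hY) σ) * Ψ hY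
        rw [ΨY]
        ext1 ⟨i, τ⟩
        simp only [Equiv.Perm.mul_apply, P_ap, pY_ap, map_mul, mul_assoc]
      · change Ψ hs * P σ = P (MulAut.conjNormal (q hs) σ) * Ψ hs
        rw [Ψs, ← map_mul, ← map_mul]
        congr 1
        apply Subtype.ext
        simp [s', MulAut.conjNormal_apply]
    intro w
    induction w using FreeGroup.induction_on with
    | C1 => intro σ; simp
    | of i => exact hof i
    | inv_of i _ =>
      intro σ
      have := hof i (MulAut.conjNormal (q (FreeGroup.of i)⁻¹) σ)
      have e : MulAut.conjNormal (q (FreeGroup.of i)) (MulAut.conjNormal (q (FreeGroup.of i)⁻¹) σ)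
          = σ := by
        apply Subtype.ext
        simp only [MulAut.conjNormal_apply]
        rw [map_inv q]
        group
      rw [e] at this
      rw [map_inv Ψ, inv_mul_eq_iff_eq_mul, ← mul_assoc, this]
      group
    | mul x y hx hy =>
      intro σ
      rw [map_mul, mul_assoc, hy, ← mul_assoc, hx, mul_assoc, map_mul q]
      congr 2
      apply Subtype.ext
      simp only [MulAut.conjNormal_apply]
      group
  have ΨS : ∀ z ∈ conjSub inc hs, ∃ h : q z ∈ S, Ψ z = P ⟨q z, h⟩ := by
    intro z hz
    induction hz using Subgroup.closure_induction with
    | mem z hz =>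
      obtain ⟨g, rfl⟩ := hz
      have h : q (inc g * hs * (inc g)⁻¹) ∈ S := by
        have := conj_mem_conjSub (q.comp inc) (q hs) g
        simpa using this
      refine ⟨h, ?_⟩
      have := Ψconj (inc g) s'
      rw [map_mul, map_mul, Ψs, this, map_inv, mul_inv_cancel_right]
      congr 1
      apply Subtype.ext
      simp [MulAut.conjNormal_apply, s']
    | one => exact ⟨by simp, by
        rw [map_one, ← map_one P]; congr 1; apply Subtype.ext; simp⟩
    | mul a b _ _ ha hb =>
      obtain ⟨h1, h2⟩ := ha
      obtain ⟨h3, h4⟩ := hb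
      refine ⟨by rw [map_mul]; exact mul_mem h1 h3, ?_⟩
      rw [map_mul, h2, h4, ← map_mul]; congr 1; apply Subtype.ext; simp
    | inv a _ ha =>
      obtain ⟨h1, h2⟩ := ha
      refine ⟨by rw [map_inv]; exact inv_mem h1, ?_⟩
      rw [map_inv, h2, ← map_inv]; congr 1; apply Subtype.ext; simp
  have ΨT : conjSub inc ht ≤ Ψ.ker := by
    apply (Subgroup.closure_le _).2
    rintro z ⟨g, rfl⟩
    simp [MonoidHom.mem_ker, Ψt]
  have hkk : q.ker ≤ Ψ.ker := by
    rw [hker]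
    apply Subgroup.normalClosure_le_normal
    intro r hr
    rcases hRel r hr with h | h | ⟨z, rfl⟩
    · obtain ⟨h1, h2⟩ := ΨS r h
      rw [SetLike.mem_coe, MonoidHom.mem_ker, h2, ← map_one P]
      congr 1
      apply Subtype.ext
      exact hker1 r hr
    · exact ΨT h
    · simp [MonoidHom.mem_ker, Ψt]
  rw [← conjSub_map] at hxS hxT
  obtain ⟨z, hz, rfl⟩ := hxS
  obtain ⟨z', hz', hzz⟩ := hxT
  have h1 : Ψ z = 1 := by
    have : z'⁻¹ * z ∈ Ψ.ker := hkk (by simp [MonoidHom.mem_ker, hzz])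
    rw [MonoidHom.mem_ker, map_mul, map_inv, ΨT hz'] at this
    simpa using this
  obtain ⟨h2, h3⟩ := ΨS z hz
  rw [h3] at h1
  have := congrArg (fun p => (p (0, 1)).2) h1
  simp only [P_ap, Equiv.Perm.one_apply, mul_one] at this
  exact congrArg Subtype.val this

end partE

def κ₁ : F3 →* F2 := FreeGroup.lift ![gX, gY, gc]
def κ₂ : F3 →* F2 := FreeGroup.lift ![gX, gY, 1]

lemma κ₁_inc : κ₁.comp inc = MonoidHom.id F2 := by
  ext i
  fin_cases i <;> simp [κ₁, inc, hX, hY, gX, gY]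
lemma κ₂_inc : κ₂.comp inc = MonoidHom.id F2 := by
  ext i
  fin_cases i <;> simp [κ₂, inc, hX, hY, gX, gY]
lemma κ₁_inc' (g : F2) : κ₁ (inc g) = g := DFunLike.congr_fun κ₁_inc g
lemma κ₂_inc' (g : F2) : κ₂ (inc g) = g := DFunLike.congr_fun κ₂_inc g
lemma κ₁_s : κ₁ hs = gc := by simp [κ₁, hs]
lemma κ₂_s : κ₂ hs = 1 := by simp [κ₂, hs]
lemma κ₁_t : κ₁ ht = 1 := by rw [ht, map_mul, map_inv, κ₁_s, κ₁_inc']; simp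
lemma κ₂_t : κ₂ ht = gc := by rw [ht, map_mul, map_inv, κ₂_s, κ₂_inc']; simp

lemma κ₂_conjSub_s (z : F3) (hz : z ∈ conjSub inc hs) : κ₂ z = 1 := by
  have : conjSub inc hs ≤ κ₂.ker := by
    apply (Subgroup.closure_le _).2
    rintro z ⟨g, rfl⟩
    simp [MonoidHom.mem_ker, κ₂_s]
  exact this hz

lemma κ₁_conjSub_t (z : F3) (hz : z ∈ conjSub inc ht) : κ₁ z = 1 := by
  have : conjSub inc ht ≤ κ₁.ker := by
    apply (Subgroup.closure_le _).2
    rintro z ⟨g, rfl⟩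
    simp [MonoidHom.mem_ker, κ₁_t]
  exact this hz

lemma normalClosure_le_conjSub (f : F3 →* F2) (hf : f.comp inc = MonoidHom.id F2) (a : F3)
    (x : F2) (hx : x ∈ Subgroup.normalClosure {f a}) : ∃ y ∈ conjSub inc a, f y = x := by
  have : x ∈ (conjSub inc a).map f := by
    rw [conjSub_map, hf]
    have hle : Subgroup.normalClosure {f a} ≤ conjSub (MonoidHom.id F2) (f a) := by
      apply (Subgroup.closure_le _).2
      intro z hz
      rw [Group.mem_conjugatesOfSet_iff] at hz
      obtain ⟨w, hw, hc⟩ := hz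
      rw [Set.mem_singleton_iff] at hw
      subst hw
      obtain ⟨g, rfl⟩ := isConj_iff.1 hc
      exact conj_mem_conjSub (MonoidHom.id F2) (f a) g
    exact hle hx
  exact this

theorem fp_core {G : Type*} [Group G] (φ₁ φ₂ : F2 →* G) (R₁ R₂ : F2)
    (hk₁ : φ₁.ker = Subgroup.normalClosure {R₁}) (hk₂ : φ₂.ker = Subgroup.normalClosure {R₂})
    (hR₁ : R₁ ∈ Subgroup.normalClosure {gc}) (hR₂ : R₂ ∈ Subgroup.normalClosure {gc}) (R : ℕ)
    (h₁ : ∀ e, φ₁ gc ∈ EER (φ₁ (lt 0 e)) (φ₁ (lt 1 e)) (φ₁ gc) R)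
    (h₂ : ∀ e, φ₂ gc ∈ EER (φ₂ (lt 1 e)) (φ₂ (lt 0 e)) (φ₂ gc) R) :
    ∃ S : Finset F3, ((φ₁.comp κ₁).prod (φ₂.comp κ₂)).ker =
      Subgroup.normalClosure (S : Set F3) := by
  classical
  have hy₁ : ∀ e, ∃ y ∈ EER (inc (lt 0 e)) (inc (lt 1 e)) hs R, φ₁ (κ₁ y) = φ₁ gc := by
    intro e
    have := EER_map (φ₁.comp κ₁) (inc (lt 0 e)) (inc (lt 1 e)) hs R
    simp only [MonoidHom.comp_apply, κ₁_inc', κ₁_s] at this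
    have h := h₁ e
    rw [← this] at h
    exact h
  have hy₂ : ∀ e, ∃ y ∈ EER (inc (lt 1 e)) (inc (lt 0 e)) ht R, φ₂ (κ₂ y) = φ₂ gc := by
    intro e
    have := EER_map (φ₂.comp κ₂) (inc (lt 1 e)) (inc (lt 0 e)) ht R
    simp only [MonoidHom.comp_apply, κ₂_inc', κ₂_t] at this
    have h := h₂ e
    rw [← this] at h
    exact h
  choose y₁ hy₁E hy₁φ using hy₁
  choose y₂ hy₂E hy₂φ using hy₂
  obtain ⟨r₁, hr₁S, hr₁⟩ := normalClosure_le_conjSub κ₁ κ₁_inc hs R₁ (by rwa [κ₁_s])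
  obtain ⟨r₂, hr₂S, hr₂⟩ := normalClosure_le_conjSub κ₂ κ₂_inc ht R₂ (by rwa [κ₂_t])
  have hfin : {g : F2 | g.norm ≤ 4 * R + 2}.Finite := by
    refine Set.Finite.of_injOn (f := FreeGroup.toWord) (t := {l | l.length ≤ 4 * R + 2}) ?_ ?_
      (List.finite_length_le _ _)
    · intro g hg; exact hg
    · exact FreeGroup.toWord_injective.injOn
  let Rel : Set F3 := (fun g : F2 => (inc g * hs * (inc g)⁻¹) * ht * (inc g * hs * (inc g)⁻¹)⁻¹ * ht⁻¹) ''
      {g : F2 | g.norm ≤ 4 * R + 2} ∪ (Set.range (fun e => hs⁻¹ * y₁ e) ∪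
      (Set.range (fun e => ht⁻¹ * y₂ e) ∪ {r₁, r₂}))
  have hRelfin : Rel.Finite :=
    (hfin.image _).union ((Set.finite_range _).union ((Set.finite_range _).union (by simp)))
  have hs0 := self_mem_conjSub inc hs
  have ht0 := self_mem_conjSub inc ht
  have hy₁S : ∀ e, y₁ e ∈ conjSub inc hs := fun e => EER_le_conjSub inc _ _ _ _ (hy₁E e)
  have hy₂S : ∀ e, y₂ e ∈ conjSub inc ht := fun e => EER_le_conjSub inc _ _ _ _ (hy₂E e)
  refine ⟨hRelfin.toFinset, ?_⟩
  rw [Set.Finite.coe_toFinset]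
  apply le_antisymm
  · intro x hx
    rw [MonoidHom.mem_ker, MonoidHom.prod_apply, Prod.mk_eq_one] at hx
    obtain ⟨hx1, hx2⟩ := hx
    let q : F3 →* F3 ⧸ Subgroup.normalClosure Rel := QuotientGroup.mk' _
    have hq : Function.Surjective q := QuotientGroup.mk'_surjective _
    have hker : q.ker = Subgroup.normalClosure Rel := QuotientGroup.ker_mk' _
    have hqR : ∀ r ∈ Rel, q r = 1 := by
      intro r hr
      have : r ∈ q.ker := by rw [hker]; exact Subgroup.subset_normalClosure hr
      exact this
    have hqs : ∀ e, q (y₁ e) = q hs := by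
      intro e
      have := hqR (hs⁻¹ * y₁ e) (Or.inr (Or.inl ⟨e, rfl⟩))
      rw [map_mul, map_inv, inv_mul_eq_one] at this
      exact this.symm
    have hqt : ∀ e, q (y₂ e) = q ht := by
      intro e
      have := hqR (ht⁻¹ * y₂ e) (Or.inr (Or.inr (Or.inl ⟨e, rfl⟩)))
      rw [map_mul, map_inv, inv_mul_eq_one] at this
      exact this.symm
    have hcomm := all_commute (q.comp inc) (q hs) (q ht)
      (by rw [MonoidHom.comp_apply, inc_gc, map_mul]) R
      (by
        intro g hg
        have := hqR _ (Or.inl ⟨g, hg, rfl⟩)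
        simp only [map_mul, map_inv] at this
        rw [mul_inv_eq_one, mul_inv_eq_iff_eq_mul] at this
        exact this)
      (by
        intro e
        have := Subgroup.mem_map_of_mem q (hy₁E e)
        rwa [EER_map, hqs] at this)
      (by
        intro e
        have := Subgroup.mem_map_of_mem q (hy₂E e)
        rwa [EER_map, hqt] at this)
    have hc := conjSub_commute (q.comp inc) (q hs) (q ht) hcomm
    have hSN := conjSub_s_normal q hq
    have hTN := conjSub_t_normal q hq hc
    rw [← hker, MonoidHom.mem_ker]
    refine inter_trivial q hq hc Rel hker ?_ (q x) ?_ ?_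
    · intro r hr
      rcases hr with ⟨g, _, rfl⟩ | ⟨e, rfl⟩ | ⟨e, rfl⟩ | rfl | rfl
      · exact Or.inr (Or.inr ⟨_, rfl⟩)
      · exact Or.inl (mul_mem (inv_mem hs0) (hy₁S e))
      · exact Or.inr (Or.inl (mul_mem (inv_mem ht0) (hy₂S e)))
      · exact Or.inl hr₁S
      · exact Or.inr (Or.inl hr₂S)
    · let m := (QuotientGroup.mk' (conjSub (q.comp inc) (q hs))).comp q
      have hm : m = (m.comp inc).comp κ₂ := by
        have hms : m hs = 1 := (QuotientGroup.eq_one_iff _).2 (self_mem_conjSub _ _)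
        ext i
        fin_cases i
        · change m hX = m (inc (κ₂ hX))
          rw [← inc_X, κ₂_inc']
        · change m hY = m (inc (κ₂ hY))
          rw [← inc_Y, κ₂_inc']
        · change m hs = m (inc (κ₂ hs))
          rw [κ₂_s, hms]; simp
      have h4 : φ₂.ker ≤ (m.comp inc).ker := by
        rw [hk₂]
        apply Subgroup.normalClosure_le_normal
        rw [Set.singleton_subset_iff, SetLike.mem_coe, MonoidHom.mem_ker, ← hr₂,
          ← MonoidHom.comp_apply, ← hm]
        have := hqR r₂ (Or.inr (Or.inr (Or.inr (Or.inr rfl))))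
        simp only [m, MonoidHom.comp_apply, this, map_one]
      have h5 : m x = 1 := by rw [hm]; exact h4 hx2
      exact (QuotientGroup.eq_one_iff _).1 h5
    · let m := (QuotientGroup.mk' (conjSub (q.comp inc) (q ht))).comp q
      have hm : m = (m.comp inc).comp κ₁ := by
        have hmt : m ht = 1 := (QuotientGroup.eq_one_iff _).2 (self_mem_conjSub _ _)
        ext i
        fin_cases i
        · change m hX = m (inc (κ₁ hX))
          rw [← inc_X, κ₁_inc']
        · change m hY = m (inc (κ₁ hY))
          rw [← inc_Y, κ₁_inc']
        · change m hs = m (inc (κ₁ hs))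
          rw [κ₁_s, inc_gc, map_mul, hmt, mul_one]
      have h4 : φ₁.ker ≤ (m.comp inc).ker := by
        rw [hk₁]
        apply Subgroup.normalClosure_le_normal
        rw [Set.singleton_subset_iff, SetLike.mem_coe, MonoidHom.mem_ker, ← hr₁,
          ← MonoidHom.comp_apply, ← hm]
        have := hqR r₁ (Or.inr (Or.inr (Or.inr (Or.inl rfl))))
        simp only [m, MonoidHom.comp_apply, this, map_one]
      have h5 : m x = 1 := by rw [hm]; exact h4 hx1
      exact (QuotientGroup.eq_one_iff _).1 h5
  · apply Subgroup.normalClosure_le_normal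
    intro r hr
    rw [SetLike.mem_coe, MonoidHom.mem_ker, MonoidHom.prod_apply, Prod.mk_eq_one,
      MonoidHom.comp_apply, MonoidHom.comp_apply]
    rcases hr with ⟨g, _, rfl⟩ | ⟨e, rfl⟩ | ⟨e, rfl⟩ | rfl | rfl
    · simp [κ₁_t, κ₂_s, κ₂_t]
    · simp [κ₁_s, κ₂_s, hy₁φ, κ₂_conjSub_s _ (hy₁S e)]
    · simp [κ₁_t, κ₂_t, hy₂φ, κ₁_conjSub_t _ (hy₂S e)]
    · rw [hr₁, κ₂_conjSub_s _ hr₁S]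
      refine ⟨?_, map_one _⟩
      rw [← MonoidHom.mem_ker, hk₁]
      exact Subgroup.subset_normalClosure rfl
    · rw [hr₂, κ₁_conjSub_t _ hr₂S]
      refine ⟨map_one _, ?_⟩
      rw [← MonoidHom.mem_ker, hk₂]
      exact Subgroup.subset_normalClosure rfl

section partF
variable {A : Type*} [Group A]

lemma comm_all (h : F2 →* A) (hc : Commute (h gX) (h gY)) (x y : F2) : Commute (h x) (h y) := by
  have key : ∀ a : A, Commute a (h gX) → Commute a (h gY) → ∀ y : F2, Commute a (h y) := by
    intro a h1 h2 y
    have hof : ∀ i, Commute a (h (FreeGroup.of i)) := by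
      intro i
      fin_cases i
      · exact h1
      · exact h2
    induction y using FreeGroup.induction_on with
    | C1 => simp
    | of i => exact hof i
    | inv_of i _ => rw [map_inv]; exact (hof i).inv_right
    | mul x y hx hy => rw [map_mul]; exact hx.mul_right hy
  apply key
  · exact (key _ (Commute.refl _) hc x).symm
  · exact (key _ hc.symm (Commute.refl _) x).symm

lemma map_ev {B : Type*} [Group B] (f : A →* B) (x y : A) (l : List Bool) :
    f (ev x y l) = ev (f x) (f y) l := by
  induction l with
  | nil => simp [ev_nil]
  | cons b l ih => rw [ev_cons, ev_cons, map_mul, ih]; cases b <;> simp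

lemma ev_perm_comm (x y : A) (hc : Commute x y) {l l' : List Bool} (h : l.Perm l') :
    ev x y l = ev x y l' := by
  have := perm_conj x y ⊥ h 1 (by
    intro p
    have : x * y * x⁻¹ * y⁻¹ = 1 := by rw [hc.eq]; group
    simp [this])
  simpa [mul_inv_eq_one] using this

lemma exists_list (u : F2)
    (hu : u ∈ Submonoid.closure ({FreeGroup.of 0, FreeGroup.of 1} : Set (FreeGroup (Fin 2)))) :
    ∃ l, u = ev gX gY l := by
  induction hu using Submonoid.closure_induction with
  | mem x hx =>
    rcases hx with rfl | rfl
    · exact ⟨[true], by simp [ev, gX]⟩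
    · exact ⟨[false], by simp [ev, gY]⟩
  | one => exact ⟨[], by simp [ev]⟩
  | mul x y _ _ hx hy =>
    obtain ⟨l, rfl⟩ := hx
    obtain ⟨l', rfl⟩ := hy
    exact ⟨l ++ l', (ev_append _ _ _ _).symm⟩

lemma expSum_ev0 (l : List Bool) :
    expSum 0 (ev gX gY l) = Multiplicative.ofAdd ((l.count true : ℕ) : ℤ) := by
  induction l with
  | nil => simp [ev_nil]
  | cons b l ih =>
    rw [ev_cons, map_mul, ih]
    cases b
    · simp [expSum, gY]
    · simp [expSum, gX, ofAdd_add, mul_comm]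

lemma expSum_ev1 (l : List Bool) :
    expSum 1 (ev gX gY l) = Multiplicative.ofAdd ((l.count false : ℕ) : ℤ) := by
  induction l with
  | nil => simp [ev_nil]
  | cons b l ih =>
    rw [ev_cons, map_mul, ih]
    cases b
    · simp [expSum, gY, ofAdd_add, mul_comm]
    · simp [expSum, gX]

def psiInv : F2 →* F2 := FreeGroup.lift ![gY * gX ^ 4, gX * gY * gX ^ 4]
def psiFun : F2 →* F2 := FreeGroup.lift ![gY * gX⁻¹, gX * (gX * gY⁻¹) ^ 4]

lemma psiInv_X : psiInv gX = gY * gX ^ 4 := by simp [psiInv, gX]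
lemma psiInv_Y : psiInv gY = gX * gY * gX ^ 4 := by simp [psiInv, gY]
lemma psiFun_X : psiFun gX = gY * gX⁻¹ := by simp [psiFun, gX]
lemma psiFun_Y : psiFun gY = gX * (gX * gY⁻¹) ^ 4 := by simp [psiFun, gY]

lemma hom_ext2 {f g : F2 →* A} (h0 : f gX = g gX) (h1 : f gY = g gY) : f = g := by
  ext i
  fin_cases i
  · exact h0
  · exact h1

def psi : F2 ≃* F2 := MonoidHom.toMulEquiv psiFun psiInv
  (by
    apply hom_ext2
    · simp only [MonoidHom.comp_apply, psiFun_X, map_mul, map_inv, psiInv_X, psiInv_Y,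
        MonoidHom.id_apply]; group
    · simp only [MonoidHom.comp_apply, psiFun_Y, map_mul, map_inv, map_pow, psiInv_X, psiInv_Y,
        MonoidHom.id_apply]; simp [pow_succ, mul_assoc])
  (by
    apply hom_ext2
    · simp only [MonoidHom.comp_apply, psiInv_X, map_mul, map_pow, psiFun_X, psiFun_Y,
        MonoidHom.id_apply]; simp [pow_succ, mul_assoc]
    · simp only [MonoidHom.comp_apply, psiInv_Y, map_mul, map_pow, psiFun_X, psiFun_Y,
        MonoidHom.id_apply]; simp [pow_succ, mul_assoc])

def swFun : F2 →* F2 := FreeGroup.lift ![gY, gX]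
lemma swFun_X : swFun gX = gY := by simp [swFun, gX]
lemma swFun_Y : swFun gY = gX := by simp [swFun, gY]
lemma swFun_swFun : swFun.comp swFun = MonoidHom.id F2 := by
  apply hom_ext2 <;> simp [swFun_X, swFun_Y]
lemma swFun_swFun' (x : F2) : swFun (swFun x) = x := DFunLike.congr_fun swFun_swFun x
def sw : F2 ≃* F2 := MonoidHom.toMulEquiv swFun swFun swFun_swFun swFun_swFun

lemma swFun_gc : swFun gc = gc⁻¹ := by
  simp only [gc, map_mul, map_inv, swFun_X, swFun_Y]; group

lemma ker_comp_equiv (φ : F2 →* A) (e : F2 ≃* F2) (r : F2)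
    (h : φ.ker = Subgroup.normalClosure {r}) :
    (φ.comp e.toMonoidHom).ker = Subgroup.normalClosure {e.symm r} := by
  have h1 : (φ.comp e.toMonoidHom).ker = φ.ker.comap e.toMonoidHom := rfl
  have h2 : φ.ker.comap e.toMonoidHom = φ.ker.map e.symm.toMonoidHom :=
    Subgroup.comap_equiv_eq_map_symm' e φ.ker
  rw [h1, h2, h, Subgroup.map_normalClosure _ _ e.symm.surjective]
  simp

lemma lt_0t : lt 0 true = gX := rfl
lemma lt_0f : lt 0 false = gX⁻¹ := rfl
lemma lt_1t : lt 1 true = gY := rfl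
lemma lt_1f : lt 1 false = gY⁻¹ := rfl
lemma swFun_lt0 (e : Bool) : swFun (lt 0 e) = lt 1 e := by
  cases e <;> simp [lt_0t, lt_0f, lt_1t, lt_1f, swFun_X]
lemma swFun_lt1 (e : Bool) : swFun (lt 1 e) = lt 0 e := by
  cases e <;> simp [lt_0t, lt_0f, lt_1t, lt_1f, swFun_Y]

lemma mk_gc_comm (x y : F2) :
    Commute (QuotientGroup.mk' (Subgroup.normalClosure {gc}) x)
      (QuotientGroup.mk' (Subgroup.normalClosure {gc}) y) := by
  apply comm_all
  have : QuotientGroup.mk' (Subgroup.normalClosure {gc}) gc = 1 :=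
    (QuotientGroup.eq_one_iff _).2 (Subgroup.subset_normalClosure rfl)
  rw [gc, map_mul, map_inv, mul_inv_eq_one, map_mul, map_inv, mul_inv_eq_iff_eq_mul,
    map_mul] at this
  exact this

lemma commutator_le_gc : commutator F2 ≤ Subgroup.normalClosure {gc} := by
  rw [commutator_def, Subgroup.commutator_le]
  intro x _ y _
  rw [← QuotientGroup.eq_one_iff]
  have := (mk_gc_comm x y).eq
  simp only [QuotientGroup.mk'_apply] at this
  rw [commutatorElement_def, QuotientGroup.mk_mul, QuotientGroup.mk_mul, QuotientGroup.mk_mul,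
    this, QuotientGroup.mk_inv, QuotientGroup.mk_inv]
  group

end partF

lemma hom_kill {A : Type*} [CommGroup A] (h : F2 →* A) {x : F2}
    (hx : x ∈ Subgroup.normalClosure {gc}) : h x = 1 := by
  have : Subgroup.normalClosure {gc} ≤ h.ker := by
    apply Subgroup.normalClosure_le_normal
    rw [Set.singleton_subset_iff, SetLike.mem_coe, MonoidHom.mem_ker, gc]
    simp only [map_mul, map_inv]
    rw [mul_comm (h gX)]
    group
  exact this hx

lemma kappa_agree {A : Type*} [CommGroup A] (h : F2 →* A) (w : F3) : h (κ₁ w) = h (κ₂ w) := by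
  have hgc : h gc = 1 := hom_kill h (Subgroup.subset_normalClosure rfl)
  have : h.comp κ₁ = h.comp κ₂ := by
    ext i
    fin_cases i
    · change h (κ₁ hX) = h (κ₂ hX)
      rw [← inc_X, κ₁_inc', κ₂_inc']
    · change h (κ₁ hY) = h (κ₂ hY)
      rw [← inc_Y, κ₁_inc', κ₂_inc']
    · change h (κ₁ hs) = h (κ₂ hs)
      rw [κ₁_s, κ₂_s, hgc, map_one]
  exact DFunLike.congr_fun this w

theorem final_aux {G : Type*} [Group G] (φ : F2 →* G) (hφ : Function.Surjective φ) (r : F2)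
    (hk : φ.ker = Subgroup.normalClosure {r}) (hr : r ∈ Subgroup.normalClosure {gc})
    (hr' : swFun r ∈ Subgroup.normalClosure {gc}) (R : ℕ)
    (h₁ : ∀ e, φ gc ∈ EER (φ (lt 0 e)) (φ (lt 1 e)) (φ gc) R) :
    ∃ μ : (G ⧸ commutator G) ≃* (G ⧸ commutator G),
      FinitelyPresentedGroup ↥(fibreProduct (commutator G) (commutator G) μ) := by
  classical
  let φ₂ : F2 →* G := φ.comp swFun
  have hφ₂ : Function.Surjective φ₂ := by
    intro g
    obtain ⟨w, rfl⟩ := hφ g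
    exact ⟨swFun w, by simp [φ₂, swFun_swFun']⟩
  have hk₂ : φ₂.ker = Subgroup.normalClosure {swFun r} := ker_comp_equiv φ sw r hk
  have h₂ : ∀ e, φ₂ gc ∈ EER (φ₂ (lt 1 e)) (φ₂ (lt 0 e)) (φ₂ gc) R := by
    intro e
    simp only [φ₂, MonoidHom.comp_apply, swFun_gc, swFun_lt0, swFun_lt1, map_inv]
    exact EER_inv _ _ _ _ (inv_mem (h₁ e))
  obtain ⟨S, hS⟩ := fp_core φ φ₂ r (swFun r) hk hk₂ hr hr' R h₁ h₂
  -- the twisting automorphism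
  have hle : φ.ker ≤ ((Abelianization.of (G := G)).comp φ₂).ker := by
    rw [hk]
    apply Subgroup.normalClosure_le_normal
    rw [Set.singleton_subset_iff, SetLike.mem_coe, MonoidHom.mem_ker]
    exact hom_kill _ hr
  let θ : G →* Abelianization G := φ.liftOfSurjective hφ ⟨_, hle⟩
  have hθ : ∀ w, θ (φ w) = Abelianization.of (φ₂ w) := by
    intro w
    exact MonoidHom.liftOfRightInverse_comp_apply _ _ _ ⟨_, hle⟩ w
  let M : Abelianization G →* Abelianization G := Abelianization.lift θ
  have hM : ∀ w, M (Abelianization.of (φ w)) = Abelianization.of (φ₂ w) := by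
    intro w
    rw [← hθ]
    exact Abelianization.lift_apply_of θ _
  have hMM : M.comp M = MonoidHom.id _ := by
    apply Abelianization.hom_ext
    ext g
    obtain ⟨w, rfl⟩ := hφ g
    simp only [MonoidHom.comp_apply, MonoidHom.id_apply]
    rw [hM]
    have : φ₂ w = φ (swFun w) := rfl
    rw [this, hM]
    simp [φ₂, swFun_swFun']
  let μ : Abelianization G ≃* Abelianization G := MonoidHom.toMulEquiv M M hMM hMM
  let μ' : (G ⧸ commutator G) ≃* (G ⧸ commutator G) := μ
  have hμ : ∀ w, μ' (QuotientGroup.mk (φ w)) = QuotientGroup.mk (φ₂ w) := hM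
  refine ⟨μ', 3, ((φ.comp κ₁).prod (φ₂.comp κ₂)).codRestrict _ ?_, S, ?_, ?_⟩
  · intro w
    change μ' (QuotientGroup.mk (φ (κ₁ w))) = QuotientGroup.mk (φ₂ (κ₂ w))
    rw [hμ]
    exact kappa_agree ((Abelianization.of (G := G)).comp φ₂) w
  · rintro ⟨⟨g₁, g₂⟩, hg⟩
    obtain ⟨w, rfl⟩ := hφ g₁
    have hg' : μ' (QuotientGroup.mk (φ w)) = QuotientGroup.mk g₂ := hg
    rw [hμ, QuotientGroup.eq] at hg'
    have hcm : commutator G = (commutator F2).map φ₂ := by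
      rw [commutator_def, commutator_def, Subgroup.map_commutator,
        Subgroup.map_top_of_surjective _ hφ₂]
    rw [hcm] at hg'
    obtain ⟨x, hx, hxe⟩ := hg'
    obtain ⟨y, hy, hyx⟩ := normalClosure_le_conjSub κ₂ κ₂_inc ht x
      (by rw [κ₂_t]; exact commutator_le_gc hx)
    refine ⟨inc w * y, ?_⟩
    apply Subtype.ext
    change (φ (κ₁ (inc w * y)), φ₂ (κ₂ (inc w * y))) = (φ w, g₂)
    rw [map_mul κ₁, map_mul κ₂, κ₁_inc', κ₂_inc', κ₁_conjSub_t y hy, hyx, mul_one, map_mul, hxe]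
    simp
  · rw [MonoidHom.ker_codRestrict, hS]

lemma rel_kill {A : Type*} [Group A] (h : F2 →* A) (hc : Commute (h gX) (h gY))
    {lu lv : List Bool} (hp : lu.Perm lv) : h (ev gX gY lu * (ev gX gY lv)⁻¹) = 1 := by
  rw [map_mul, map_inv, mul_inv_eq_one, map_ev, map_ev]
  exact ev_perm_comm _ _ hc hp


/-- Let `G = ⟨a, b ∣ u = v⟩` be a one-relator group where `u ≠ v` are positive words in
the two generators with the same exponent sum in each generator. Then some twisted
`G'`-fibre product in `G × G` is finitely presented. -/
theorem one_relator_positive_words_exists_fp_twisted_fibre_product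
    (u v : FreeGroup (Fin 2))
    (hu : u ∈ Submonoid.closure ({FreeGroup.of 0, FreeGroup.of 1} : Set (FreeGroup (Fin 2))))
    (hv : v ∈ Submonoid.closure ({FreeGroup.of 0, FreeGroup.of 1} : Set (FreeGroup (Fin 2))))
    (huv : u ≠ v)
    (ha : expSum 0 u = expSum 0 v) (hb : expSum 1 u = expSum 1 v) :
    ∃ μ : (PresentedGroup ({u * v⁻¹} : Set (FreeGroup (Fin 2))) ⧸
            commutator (PresentedGroup ({u * v⁻¹} : Set (FreeGroup (Fin 2))))) ≃*
          (PresentedGroup ({u * v⁻¹} : Set (FreeGroup (Fin 2))) ⧸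
            commutator (PresentedGroup ({u * v⁻¹} : Set (FreeGroup (Fin 2))))),
      FinitelyPresentedGroup
        ↥(fibreProduct
            (commutator (PresentedGroup ({u * v⁻¹} : Set (FreeGroup (Fin 2)))))
            (commutator (PresentedGroup ({u * v⁻¹} : Set (FreeGroup (Fin 2))))) μ) := by
  obtain ⟨lu, rfl⟩ := exists_list u hu
  obtain ⟨lv, rfl⟩ := exists_list v hv
  have hne : lu ≠ lv := fun h => huv (by rw [h])
  have hp : lu.Perm lv := by
    rw [List.perm_iff_count]
    rw [expSum_ev0, expSum_ev0] at ha
    rw [expSum_ev1, expSum_ev1] at hb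
    have ha' := Multiplicative.ofAdd.injective ha
    have hb' := Multiplicative.ofAdd.injective hb
    intro b
    cases b
    · exact_mod_cast hb'
    · exact_mod_cast ha'
  set r : F2 := ev gX gY lu * (ev gX gY lv)⁻¹ with hrdef
  have hkp : (PresentedGroup.mk ({r} : Set F2)).ker = Subgroup.normalClosure {r} :=
    QuotientGroup.ker_mk' _
  have hpsi : ∀ x, psi (psiInv x) = x := fun x => psi.apply_symm_apply x
  let φ : F2 →* PresentedGroup ({r} : Set F2) :=
    (PresentedGroup.mk ({r} : Set F2)).comp psi.toMonoidHom
  have hφpsi : ∀ x, φ (psiInv x) = PresentedGroup.mk ({r} : Set F2) x := by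
    intro x
    change PresentedGroup.mk ({r} : Set F2) (psi (psiInv x)) = _
    rw [hpsi]
  have hr1 : PresentedGroup.mk ({r} : Set F2) r = 1 := by
    rw [← MonoidHom.mem_ker, hkp]
    exact Subgroup.subset_normalClosure rfl
  have hφs : Function.Surjective φ := by
    intro g
    obtain ⟨w, rfl⟩ := PresentedGroup.mk_surjective _ g
    exact ⟨psiInv w, hφpsi w⟩
  have hkill : ∀ f : F2 →* F2, f r ∈ Subgroup.normalClosure {gc} := by
    intro f
    rw [← QuotientGroup.eq_one_iff]
    exact rel_kill ((QuotientGroup.mk' (Subgroup.normalClosure {gc})).comp f)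
      (mk_gc_comm _ _) hp
  have hS := S_both (φ gX) (φ gY) lu lv hne hp (by
    have e1 : φ gY * φ gX ^ 4 = φ (psiInv gX) := by rw [psiInv_X, map_mul, map_pow]
    have e2 : φ gX * φ gY * φ gX ^ 4 = φ (psiInv gY) := by
      rw [psiInv_Y, map_mul, map_mul, map_pow]
    rw [e1, e2, hφpsi, hφpsi, ← map_ev, ← map_ev, ← mul_inv_eq_one, ← map_inv, ← map_mul]
    exact hr1)
  obtain ⟨R, hR1, hR2⟩ := hS
  have hgc : φ gc = φ gX * φ gY * (φ gX)⁻¹ * (φ gY)⁻¹ := by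
    simp only [gc, map_mul, map_inv]
  refine final_aux φ hφs (psiInv r) (ker_comp_equiv _ psi r hkp) (hkill psiInv)
    (hkill (swFun.comp psiInv)) R ?_
  intro e
  rw [hgc]
  cases e
  · rw [lt_0f, lt_1f, map_inv, map_inv]
    exact hR2
  · rw [lt_0t, lt_1t]
    exact hR1
end
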